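/- Every collision (n, k, m, l) with n ≤ 10^6 and m ≤ 10^6 — that is, every quadruple of natural numbers with 2 ≤ k ≤ n/2, 2 ≤ l ≤ m/2, k < l, and C(n, k) = C(m, l) — is either one of the nine quadruples (16, 2, 10, 3), (21, 2, 10, 4), (56, 2, 22, 3), (120, 2, 36, 3), (153, 2, 19, 5), (221, 2, 17, 8), (78, 2, 15, 5), (78, 2, 14, 6), (15, 5, 14, 6), or of the form (F(2i+2)·F(2i+3), F(2i)·F(2i+3), F(2i+2)·F(2i+3) − 1, F(2i)·F(2i+3) + 1) for some natural number i ≥ 1, where F denotes the Fibonacci sequence. -/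

import Mathlib

namespace BinomialCollision

/-- `f s`, arranged so that the kernel evaluates `s` to a literal first. -/
def force {α : Type} (s : ℕ) (f : ℕ → α) : α :=
  Nat.rec (motive := fun _ => α) (f 0) (fun n _ => f (Nat.succ n)) s

def allBelow (n : ℕ) (p : ℕ → Bool) : Bool :=
  Nat.rec (motive := fun _ => Bool) true (fun i r => cond (p i) r false) n

def allMem {α : Type} (l : List α) (p : α → Bool) : Bool :=
  List.rec (motive := fun _ => Bool) true (fun a _ r => cond (p a) r false) l

def anyMem {α : Type} (l : List α) (p : α → Bool) : Bool :=
  List.rec (motive := fun _ => Bool) false (fun a _ r => cond (p a) true r) l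

def anyBelow (n : ℕ) (p : ℕ → Bool) : Bool :=
  Nat.rec (motive := fun _ => Bool) false (fun i r => cond (p i) true r) n

@[simp] theorem force_eq {α : Type} (s : ℕ) (f : ℕ → α) : force s f = f s := by
  cases s <;> rfl

theorem of_cond_false {a b : Bool} (h : cond a b false = true) : a = true ∧ b = true := by
  cases a <;> simp_all

theorem of_cond_true {a b : Bool} (h : cond a true b = true) : a = true ∨ b = true := by
  cases a <;> simp_all

theorem allBelow_spec {n : ℕ} {p : ℕ → Bool} (h : allBelow n p = true) :
    ∀ i < n, p i = true := by
  induction n with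
  | zero => intro i hi; omega
  | succ n ih =>
    obtain ⟨h1, h2⟩ := of_cond_false (a := p n) (b := allBelow n p) h
    intro i hi
    rcases Nat.lt_succ_iff_lt_or_eq.1 hi with hi | rfl
    · exact ih h2 i hi
    · exact h1

theorem anyBelow_spec {n : ℕ} {p : ℕ → Bool} (h : anyBelow n p = true) :
    ∃ i < n, p i = true := by
  induction n with
  | zero => exact absurd h (by simp [anyBelow])
  | succ n ih =>
    rcases of_cond_true (a := p n) (b := anyBelow n p) h with h1 | h1
    · exact ⟨n, by omega, h1⟩
    · obtain ⟨i, hi, h⟩ := ih h1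
      exact ⟨i, by omega, h⟩

theorem allMem_spec {α : Type} {l : List α} {p : α → Bool} (h : allMem l p = true) :
    ∀ a ∈ l, p a = true := by
  induction l with
  | nil => simp
  | cons a l ih =>
    obtain ⟨h1, h2⟩ := of_cond_false (a := p a) (b := allMem l p) h
    intro b hb
    rcases List.mem_cons.1 hb with rfl | hb
    · exact h1
    · exact ih h2 b hb

theorem anyMem_spec {α : Type} {l : List α} {p : α → Bool} (h : anyMem l p = true) :
    ∃ a ∈ l, p a = true := by
  induction l with
  | nil => exact absurd h (by simp [anyMem])
  | cons a l ih =>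
    rcases of_cond_true (a := p a) (b := anyMem l p) h with h1 | h1
    · exact ⟨a, by simp, h1⟩
    · obtain ⟨b, hb, h⟩ := ih h1
      exact ⟨b, by simp [hb], h⟩

def descFac (n k : ℕ) : ℕ :=
  Nat.rec (motive := fun _ => ℕ) 1 (fun i r => Nat.mul (Nat.sub n i) r) k

@[simp] theorem descFac_eq (n k : ℕ) : descFac n k = n.descFactorial k := by
  induction k with
  | zero => simp [descFac]
  | succ k ih =>
    rw [Nat.descFactorial_succ, ← ih]; rfl

/-- `C(M, k) < C(B, l)`, without division. -/
def chooseLt (M k B l : ℕ) : Bool :=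
  Nat.ble (Nat.succ (Nat.mul (descFac M k) (descFac l l))) (Nat.mul (descFac B l) (descFac k k))

theorem chooseLt_spec {M k B l : ℕ} (h : chooseLt M k B l = true) : M.choose k < B.choose l := by
  have h := Nat.le_of_ble_eq_true h
  simp only [descFac_eq, Nat.mul_eq, Nat.descFactorial_self, Nat.succ_le_iff,
    Nat.descFactorial_eq_factorial_mul_choose] at h
  have : (k.factorial * l.factorial) * M.choose k < (k.factorial * l.factorial) * B.choose l := by
    nlinarith
  exact Nat.lt_of_mul_lt_mul_left this

/-- Folds `F` over the residues modulo `q` of `C(r, l)`, for `r` counted up `fuel` times. -/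
def chooseFold (q l : ℕ) (F : ℕ → ℕ → ℕ → ℕ) (fuel : ℕ) : ℕ → ℕ → ℕ → ℕ :=
  Nat.rec (motive := fun _ => ℕ → ℕ → ℕ → ℕ) (fun _ _ A => A)
    (fun _ rec r v A => force (Nat.succ r) fun r' =>
      force (Nat.div (Nat.mul v r') (Nat.sub r' l)) fun v' =>
        rec r' v' (F r (Nat.mul (Nat.succ q) (Nat.mod v q)) A)) fuel

/-- The bits `(q + 1) * (C(r, l) % q) + r` for `r < q`. -/
def rowMask (l q : ℕ) : ℕ :=
  chooseFold q l (fun r s A => Nat.lor A (Nat.pow 2 (Nat.add s r))) (Nat.sub q l) l 1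
    (Nat.sub (Nat.pow 2 l) 1)

/-- A block of `q` bits from `(q + 1) * v` on, for each residue `v` of some `C(r, k)`. -/
def imageMask (k q : ℕ) : ℕ :=
  chooseFold q k (fun _ s A => Nat.lor A (Nat.shiftLeft (Nat.sub (Nat.pow 2 q) 1) s)) (Nat.sub q k)
    k 1 (Nat.sub (Nat.pow 2 q) 1)

/-- The residues `r` modulo `q` for which `C(r, l)` is a value of `C(·, k)` modulo `q`. -/
def pattern (k l q : ℕ) : ℕ :=
  Nat.mod (Nat.land (rowMask l q) (imageMask k q)) (Nat.sub (Nat.pow 2 (Nat.succ q)) 1)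

def repunit (s t : ℕ) : ℕ :=
  Nat.div (Nat.sub (Nat.pow 2 (Nat.mul s t)) 1) (Nat.sub (Nat.pow 2 s) 1)

/-- The `m` for which `C(m, l)` is a value of `C(·, k)`. -/
def knownMask (k l : ℕ) : ℕ :=
  cond (Nat.beq k 2)
    (cond (Nat.beq l 3) (2 ^ 10 + 2 ^ 22 + 2 ^ 36)
      (cond (Nat.beq l 4) (2 ^ 10)
        (cond (Nat.beq l 5) (2 ^ 19 + 2 ^ 15)
          (cond (Nat.beq l 8) (2 ^ 17) (cond (Nat.beq l 6) (2 ^ 14) 0)))))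
    (cond (Nat.beq k 5) (cond (Nat.beq l 6) (2 ^ 14) 0) 0)

def sieve (k l B E : ℕ) (qs : List ℕ) : ℕ → Bool :=
  List.rec (motive := fun _ => ℕ → Bool) (fun M => Nat.beq M E)
    (fun q _ rec M => cond (Nat.ble q l) (rec M) (cond (Nat.beq M E) true
      (rec (Nat.land M (Nat.mul (pattern k l q) (repunit q (Nat.succ (Nat.div B q))))))))
    qs

/-- The sieve for `C(n, k) = C(m, l)`, where `l` starts at the third argument and `bounds` lists
strict upper bounds for `m`; the last one is `2 * l`. -/
def smallCheck (k : ℕ) (qs : List ℕ) (bounds : List ℕ) : ℕ → Bool :=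
  List.rec (motive := fun _ => ℕ → Bool) (fun _ => false)
    (fun B _ rec l => cond (chooseLt 1000000 k B l)
      (cond (Nat.ble B (Nat.mul 2 l)) true
        (cond (sieve k l B (knownMask k l) qs
            (Nat.shiftLeft (Nat.shiftRight (Nat.sub (Nat.pow 2 B) 1) (Nat.mul 2 l)) (Nat.mul 2 l)))
          (force (Nat.succ l) rec) false)) false)
    bounds

def bounds : List (ℕ × List ℕ) :=
  [(2, [14424, 1863, 572, 270, 162, 113, 87, 72, 62, 56, 52, 49, 46, 45, 44, 43, 43, 42, 42]), (3,
    [44723, 7250, 2224, 979, 539, 344, 244, 186, 150, 126, 110, 98, 89, 83, 78, 74, 71, 68, 66, 65,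
    64, 63, 62, 62, 61, 61, 61, 62]), (4, [87057, 17630, 5762, 2534, 1357, 833, 564, 412, 318, 257,
    214, 184, 162, 145, 133, 122, 114, 108, 103, 98, 95, 92, 89, 87, 85, 84, 83, 82, 81, 80, 80, 80,
    79, 79, 79, 80]), (5, [134803, 32935, 11640, 5253, 2811, 1701, 1128, 803, 604, 474, 386, 324,
    278, 243, 217, 196, 179, 166, 155, 146, 138, 132, 127, 122, 118, 115, 112, 109, 107, 105, 104,
    102, 101, 100, 100, 99, 98, 98, 97, 97, 97, 97, 97, 98]), (6, [183482, 52307, 19970, 9343, 5064,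
    3063, 2015, 1416, 1048, 810, 648, 533, 450, 387, 339, 302, 272, 248, 228, 212, 198, 187, 177,
    169, 161, 155, 150, 145, 141, 137, 134, 131, 129, 127, 125, 123, 122, 121, 119, 118, 118, 117,
    116, 116, 115, 115, 115, 115, 114, 114, 114]), (7, [230618, 74656, 30606, 14886, 8225, 5011,
    3296, 2303, 1691, 1293, 1022, 832, 693, 589, 510, 448, 399, 359, 327, 300, 278, 259, 243, 229,
    217, 207, 198, 191, 184, 178, 172, 168, 163, 160, 156, 153, 151, 148, 146, 144, 142, 141, 140,
    138, 137, 136, 135, 135, 134, 134, 133, 133, 132, 132, 132, 132, 132, 132, 132]), (8, [275021,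
    98957, 43253, 21862, 12350, 7611, 5028, 3513, 2570, 1954, 1534, 1238, 1022, 861, 738, 642, 566,
    505, 456, 415, 381, 352, 327, 307, 289, 273, 259, 247, 237, 228, 219, 212, 206, 200, 194, 190,
    185, 182, 178, 175, 172, 169, 167, 165, 163, 161, 160, 158, 157, 156, 155, 154, 153, 152, 152,
    151, 151, 150, 150, 149, 149, 149, 149, 149, 149, 149, 150]), (9, [316232, 124363, 57556, 30177,
    17444, 10900, 7253, 5083, 3718, 2819, 2204, 1769, 1452, 1215, 1035, 894, 783, 694, 621, 561,
    511, 469, 434, 403, 377, 354, 335, 317, 302, 289, 277, 266, 256, 248, 240, 233, 227, 221, 216,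
    211, 207, 203, 199, 196, 193, 190, 188, 186, 184, 182, 180, 178, 177, 175, 174, 173, 172, 171,
    170, 170, 169, 168, 168, 167, 167, 167, 166, 166, 166, 166, 166, 165, 165, 166]), (10, [354179,
    150221, 73153, 39691, 23474, 14886, 9997, 7040, 5160, 3912, 3053, 2443, 1997, 1664, 1410, 1212,
    1055, 929, 827, 743, 673, 614, 565, 522, 485, 454, 426, 402, 381, 362, 345, 330, 317, 305, 294,
    285, 276, 268, 260, 254, 248, 242, 237, 232, 228, 224, 220, 217, 214, 211, 209, 206, 204, 202,
    200, 198, 196, 195, 194, 192, 191, 190, 189, 188, 187, 187, 186, 185, 185, 184, 184, 184, 183,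
    183, 183, 183, 182, 182, 182, 182, 182]), (11, [388988, 176051, 89709, 50244, 30379, 19560,
    13268, 9403, 6916, 5251, 4097, 3274, 2671, 2218, 1873, 1603, 1390, 1219, 1080, 966, 871, 791,
    724, 666, 616, 574, 536, 504, 475, 449, 427, 407, 389, 373, 358, 345, 333, 322, 312, 303, 295,
    287, 280, 274, 268, 263, 258, 253, 249, 245, 241, 238, 235, 232, 229, 226, 224, 222, 220, 218,
    216, 214, 213, 212, 210, 209, 208, 207, 206, 205, 204, 204, 203, 202, 202, 201, 201, 200, 200,
    200, 199, 199, 199, 199, 199, 199, 199, 199, 200]), (12, [420876, 201513, 106932, 61670, 38083,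
    24891, 17064, 12180, 9000, 6850, 5351, 4275, 3483, 2888, 2432, 2077, 1795, 1569, 1385, 1234,
    1108, 1003, 914, 838, 772, 716, 667, 624, 586, 553, 523, 496, 473, 452, 432, 415, 399, 385, 372,
    360, 349, 339, 330, 322, 314, 307, 300, 294, 288, 283, 278, 273, 269, 265, 262, 258, 255, 252,
    249, 246, 244, 242, 240, 238, 236, 234, 232, 231, 229, 228, 227, 226, 225, 224, 223, 222, 221,
    220, 220, 219, 218, 218, 217, 217, 217, 216, 216, 216, 216, 215, 215, 215, 215, 215, 215, 216]),
    (13, [450090, 226374, 124572, 73806, 46496, 30841, 21369, 15370, 11416, 8720, 6824, 5456, 4445,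
    3682, 3097, 2639, 2276, 1984, 1747, 1552, 1390, 1253, 1138, 1040, 956, 883, 820, 764, 716, 673,
    635, 601, 570, 543, 518, 496, 476, 457, 441, 426, 412, 399, 387, 376, 366, 357, 348, 340, 333,
    326, 320, 314, 308, 303, 298, 294, 289, 285, 282, 278, 275, 272, 269, 266, 264, 261, 259, 257,
    255, 253, 251, 250, 248, 247, 246, 244, 243, 242, 241, 240, 239, 238, 238, 237, 236, 236, 235,
    234, 234, 234, 233, 233, 233, 232, 232, 232, 232, 232, 231, 231, 231, 231, 232])]

def sievePrimes : List ℕ :=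
  [2, 3, 5, 7, 11, 13, 17, 19, 23, 29, 31, 37, 41, 43, 47, 53, 59, 61, 67, 71, 73, 79, 83, 89, 97,
    101, 103, 107, 109, 113, 127, 131, 137, 139, 149, 151, 157, 163, 167, 173, 179, 181, 191, 193,
    197, 199, 211, 223, 227, 229, 233, 239, 241, 251, 257, 263, 269, 271, 277, 281, 283, 293, 307,
    311, 313, 317, 331, 337, 347, 349, 353, 359, 367, 373, 379, 383, 389, 397, 401, 409, 419]

theorem smallCheck_bounds : allMem bounds (fun a => force a.1 fun k =>
    smallCheck k sievePrimes a.2 (Nat.succ k)) = true := by decide +kernel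

theorem or_two_pow_eq_add {x i : ℕ} (h : x.testBit i = false) : x ||| 2 ^ i = x + 2 ^ i := by
  have h0 : x / 2 ^ i % 2 = 0 := by
    rw [Nat.testBit_eq_decide_div_mod_eq] at h
    have := of_decide_eq_false h
    omega
  obtain ⟨c, hc⟩ : ∃ c, x / 2 ^ i = 2 * c := ⟨x / 2 ^ i / 2, by omega⟩
  have hx : x = 2 ^ i * (2 * c) + x % 2 ^ i := by rw [← hc, Nat.div_add_mod]
  have hlt : x % 2 ^ i < 2 ^ i := Nat.mod_lt _ (by positivity)
  have hx' : x + 2 ^ i = 2 ^ i * (2 * c + 1) + x % 2 ^ i := by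
    conv_lhs => rw [hx]
    ring
  apply Nat.eq_of_testBit_eq
  intro j
  rw [hx', Nat.testBit_or, Nat.testBit_two_pow_mul_add _ hlt, Nat.testBit_two_pow]
  conv_lhs => rw [hx, Nat.testBit_two_pow_mul_add _ hlt]
  split_ifs with hj
  · have : ¬ i = j := by omega
    simp [this]
  · rcases eq_or_ne i j with rfl | hij
    · simp
    · obtain ⟨t, ht⟩ : ∃ t, j - i = t + 1 := ⟨j - i - 1, by omega⟩
      rw [ht, Nat.testBit_succ, Nat.testBit_succ]
      simp only [hij, decide_false, Bool.or_false]
      congr 1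
      omega

theorem chooseFold_induction {q l fuel : ℕ} {F : ℕ → ℕ → ℕ → ℕ} {P : ℕ → ℕ → Prop}
    (step : ∀ r A, l ≤ r → r < l + fuel → P r A →
      P (r + 1) (F r ((q + 1) * (r.choose l % q)) A))
    {A : ℕ} (h0 : P l A) : P (l + fuel) (chooseFold q l F fuel l 1 A) := by
  suffices H : ∀ fuel' r A, l ≤ r → r + fuel' = l + fuel → P r A →
      P (l + fuel) (chooseFold q l F fuel' r (r.choose l) A) by
    have := H fuel l A le_rfl rfl h0
    rwa [Nat.choose_self] at this
  intro fuel'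
  induction fuel' with
  | zero =>
    intro r A _ hr h
    rw [← hr]
    exact h
  | succ f ih =>
    intro r A hl hr h
    have e : r.choose l * (r + 1) / (r + 1 - l) = (r + 1).choose l := by
      rw [Nat.choose_mul_succ_eq]
      exact Nat.mul_div_cancel _ (by omega)
    have : chooseFold q l F (f + 1) r (r.choose l) A
        = chooseFold q l F f (r + 1) ((r + 1).choose l) (F r ((q + 1) * (r.choose l % q)) A) := by
      rw [← e]
      simp only [chooseFold, force_eq]
      rfl
    rw [this]
    exact ih (r + 1) _ (by omega) (by omega) (step r A hl (by omega) h)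

theorem testBit_imageMask {k q r i : ℕ} (hk : k ≤ q) (hr : r < q) (hi : i < q) :
    (imageMask k q).testBit ((q + 1) * (r.choose k % q) + i) = true := by
  suffices H : ∀ r < k + (q - k),
      (imageMask k q).testBit ((q + 1) * (r.choose k % q) + i) = true from H r (by omega)
  apply chooseFold_induction (P := fun s A => ∀ r < s,
    A.testBit ((q + 1) * (r.choose k % q) + i) = true)
  · intro s A _ _ h r hr
    simp only [Nat.lor_eq, Nat.shiftLeft_eq', Nat.testBit_or, Nat.testBit_shiftLeft,
      Bool.or_eq_true]
    rcases Nat.lt_succ_iff_lt_or_eq.1 hr with hr | rfl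
    · exact Or.inl (h r hr)
    · right
      simp [hi]
  · intro r hr
    rw [Nat.choose_eq_zero_of_lt hr]
    simp [hi]

theorem exists_modEq_and_rowMask {l q : ℕ} (hl : l ≤ q) (I : ℕ) :
    ∃ Q < 2 ^ q, rowMask l q &&& I ≡ Q [MOD 2 ^ (q + 1) - 1] ∧
      ∀ r < q, I.testBit ((q + 1) * (r.choose l % q) + r) = true → Q.testBit r = true := by
  have H : (∀ i, (rowMask l q).testBit i = true → i % (q + 1) < l + (q - l)) ∧
      ∃ Q < 2 ^ (l + (q - l)), rowMask l q &&& I ≡ Q [MOD 2 ^ (q + 1) - 1] ∧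
      ∀ r < l + (q - l), I.testBit ((q + 1) * (r.choose l % q) + r) = true →
        Q.testBit r = true := by
    apply chooseFold_induction (P := fun s A => (∀ i, A.testBit i = true → i % (q + 1) < s) ∧
      ∃ Q < 2 ^ s, A &&& I ≡ Q [MOD 2 ^ (q + 1) - 1] ∧
      ∀ r < s, I.testBit ((q + 1) * (r.choose l % q) + r) = true → Q.testBit r = true)
    · rintro r A hlr hrq ⟨hA, Q, hQ, hAQ, hbit⟩
      set s := (q + 1) * (r.choose l % q) with hs
      have hmod : (s + r) % (q + 1) = r := by
        have : r < q := by have : q.sub l = q - l := rfl; omega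
        rw [hs, Nat.mul_add_mod, Nat.mod_eq_of_lt (by omega)]
      simp only [Nat.lor_eq, Nat.add_eq, Nat.pow_eq]
      refine ⟨?_, ?_⟩
      · intro i hi
        rw [Nat.testBit_or, Bool.or_eq_true, Nat.testBit_two_pow] at hi
        rcases hi with hi | hi
        · exact (hA i hi).trans (by omega)
        · rw [← of_decide_eq_true hi, hmod]; omega
      · have hd : (A ||| 2 ^ (s + r)) &&& I = (A &&& I) ||| ((2 ^ (s + r)) &&& I) :=
          Nat.and_or_distrib_right _ _ _
        rw [hd, Nat.and_comm (2 ^ (s + r)) I, Nat.and_two_pow]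
        rcases hI : I.testBit (s + r) with _ | _
        · refine ⟨Q, hQ.trans (Nat.pow_lt_pow_right (by omega) (by omega)), by simpa using hAQ, ?_⟩
          intro r' hr' h'
          rcases Nat.lt_succ_iff_lt_or_eq.1 hr' with hr' | rfl
          · exact hbit r' hr' h'
          · rw [← hs, hI] at h'; exact absurd h' (by simp)
        · have hAs : A.testBit (s + r) = false := by
            by_contra hne
            have := hA _ (by simpa using hne)
            omega
          refine ⟨Q + 2 ^ r, by rw [pow_succ]; omega, ?_, ?_⟩
          · simp only [Bool.toNat_true, one_mul]
            rw [or_two_pow_eq_add (by simp [hAs])]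
            refine Nat.ModEq.add hAQ ?_
            rw [pow_add (2 : ℕ) s r, hs, pow_mul]
            have h1 : 2 ^ (q + 1) ≡ 1 [MOD 2 ^ (q + 1) - 1] := by
              have : 2 ^ (q + 1) = (2 ^ (q + 1) - 1) + 1 :=
                (Nat.sub_add_cancel Nat.one_le_two_pow).symm
              conv_lhs => rw [this]
              simp [Nat.ModEq]
            simpa using (h1.pow (r.choose l % q)).mul_right (2 ^ r)
          · intro r' hr' h'
            rw [← or_two_pow_eq_add (Nat.testBit_lt_two_pow hQ), Nat.testBit_or,
              Nat.testBit_two_pow, Bool.or_eq_true]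
            rcases Nat.lt_succ_iff_lt_or_eq.1 hr' with hr' | rfl
            · exact Or.inl (hbit r' hr' h')
            · simp
    · have hlt : (2 ^ l - 1) &&& I < 2 ^ l := by
        rw [Nat.and_comm, Nat.and_two_pow_sub_one_eq_mod]
        exact Nat.mod_lt _ (by positivity)
      refine ⟨?_, (2 ^ l - 1) &&& I, hlt, Nat.ModEq.refl _, ?_⟩
      · intro i hi
        have : i < l := by simpa using hi
        exact (Nat.mod_le _ _).trans_lt this
      · intro r hr h
        rw [Nat.choose_eq_zero_of_lt hr] at h
        simpa [hr] using h
  rw [Nat.add_sub_cancel' hl] at H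
  exact H.2

theorem pattern_spec {k l q n m : ℕ} [Fact q.Prime] (hkl : k < l) (hlq : l < q)
    (h : n.choose k = m.choose l) :
    pattern k l q < 2 ^ q ∧ (pattern k l q).testBit (m % q) = true := by
  have hq : 0 < q := by omega
  have lucas : ∀ n k, k < q → n.choose k % q = (n % q).choose k % q := by
    intro n k hk
    have := Choose.choose_modEq_choose_mod_mul_choose_div_nat (p := q) (n := n) (k := k)
    rw [Nat.mod_eq_of_lt hk, Nat.div_eq_of_lt hk, Nat.choose_zero_right, mul_one] at this
    exact this
  obtain ⟨Q, hQ, hmod, hbit⟩ := exists_modEq_and_rowMask hlq.le (imageMask k q)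
  have hlt : Q < 2 ^ (q + 1) - 1 := by
    have : 1 ≤ 2 ^ q := Nat.one_le_two_pow
    rw [pow_succ]
    omega
  have e : pattern k l q = Q := by
    have : pattern k l q = (rowMask l q &&& imageMask k q) % (2 ^ (q + 1) - 1) := rfl
    rw [this, hmod, Nat.mod_eq_of_lt hlt]
  rw [e]
  refine ⟨hQ, hbit _ (Nat.mod_lt _ hq) ?_⟩
  rw [← lucas m l hlq, ← h, lucas n k (by omega)]
  exact testBit_imageMask (by omega) (Nat.mod_lt _ hq) (Nat.mod_lt _ hq)

theorem testBit_mul_repunit {x s : ℕ} (hs : 0 < s) (hx : x < 2 ^ s) (t i : ℕ) (hi : i < s * t) :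
    (x * repunit s t).testBit i = x.testBit (i % s) := by
  have h2 : 2 ≤ 2 ^ s := by
    calc 2 = 2 ^ 1 := rfl
      _ ≤ 2 ^ s := Nat.pow_le_pow_right (by omega) hs
  have e : repunit s t = ∑ i ∈ Finset.range t, (2 ^ s) ^ i := by
    rw [Nat.geomSum_eq h2, ← pow_mul]; rfl
  rw [e]
  clear e
  induction t generalizing i with
  | zero => simp at hi
  | succ t ih =>
    rw [Finset.sum_range_succ', pow_zero]
    have : x * (∑ k ∈ Finset.range t, (2 ^ s) ^ (k + 1) + 1)
        = 2 ^ s * (x * ∑ k ∈ Finset.range t, (2 ^ s) ^ k) + x := by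
      simp only [pow_succ', ← Finset.mul_sum]
      ring
    rw [this, Nat.testBit_two_pow_mul_add _ hx]
    split_ifs with h
    · rw [Nat.mod_eq_of_lt h]
    · rw [ih (i - s) (by rw [mul_add, mul_one] at hi; omega), Nat.mod_eq_sub_mod (a := i) (by omega)]

theorem sieve_spec {k l B E n m : ℕ} (hkl : k < l) (hmB : m < B)
    (h : n.choose k = m.choose l) {qs : List ℕ} (hqs : ∀ q ∈ qs, q.Prime) :
    ∀ M : ℕ, sieve k l B E qs M = true → M.testBit m = true → E.testBit m = true := by
  induction qs with
  | nil =>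
    intro M hM hm
    rwa [← Nat.eq_of_beq_eq_true (n := M) (m := E) hM]
  | cons q qs ih =>
    intro M hM hm
    have ih := ih fun q hq => hqs q (by simp [hq])
    have : Fact q.Prime := ⟨hqs q (by simp)⟩
    have e : sieve k l B E (q :: qs) M = cond (Nat.ble q l) (sieve k l B E qs M)
      (cond (Nat.beq M E) true (sieve k l B E qs
        (M &&& (pattern k l q * repunit q (B / q + 1))))) := rfl
    rw [e] at hM
    cases hql : Nat.ble q l with
    | true =>
      rw [hql] at hM
      exact ih M hM hm
    | false =>
      rw [hql] at hM
      have hlq : l < q := by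
        by_contra hcon
        have := Nat.ble_eq_true_of_le (show q ≤ l by omega)
        rw [hql] at this
        exact absurd this (by simp)
      cases hME : Nat.beq M E with
      | true => rwa [← Nat.eq_of_beq_eq_true hME]
      | false =>
        rw [hME] at hM
        refine ih _ hM ?_
        obtain ⟨h1, h2⟩ := pattern_spec hkl hlq h
        rw [Nat.testBit_and, hm, Bool.true_and,
          testBit_mul_repunit (by omega) h1 _ _ ?_, h2]
        have := Nat.div_add_mod B q
        have := Nat.mod_lt B (show 0 < q by omega)
        rw [mul_add, mul_one]
        omega

theorem smallCheck_spec {k n : ℕ} (hn : n ≤ 1000000) {qs : List ℕ}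
    (hqs : ∀ q ∈ qs, q.Prime) {bounds : List ℕ} :
    ∀ l₀ : ℕ, smallCheck k qs bounds l₀ = true → ∀ l m, l₀ ≤ l → k < l₀ → 2 * l ≤ m →
      n.choose k = m.choose l → (knownMask k l).testBit m = true := by
  induction bounds with
  | nil => intro l₀ h; exact absurd h (by simp [smallCheck])
  | cons B bounds ih =>
    intro l₀ h l m hl hk hm heq
    have e : smallCheck k qs (B :: bounds) l₀ = cond (chooseLt 1000000 k B l₀)
      (cond (Nat.ble B (2 * l₀)) true
        (cond (sieve k l₀ B (knownMask k l₀) qs (((2 ^ B - 1) >>> (2 * l₀)) <<< (2 * l₀)))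
          (force (Nat.succ l₀) (smallCheck k qs bounds)) false)) false := rfl
    rw [e] at h
    obtain ⟨h1, h2⟩ := of_cond_false h
    have hB := chooseLt_spec h1
    have hnk : n.choose k ≤ (1000000).choose k := Nat.choose_le_choose k hn
    rcases of_cond_true h2 with h3 | h3
    · exfalso
      have hBl := Nat.le_of_ble_eq_true h3
      have : B.choose l₀ ≤ m.choose l := by
        calc B.choose l₀ ≤ (2 * l₀).choose l₀ := Nat.choose_le_choose _ hBl
          _ = l₀.centralBinom := (Nat.centralBinom_eq_two_mul_choose _).symm
          _ ≤ l.centralBinom := Nat.centralBinom_strictMono.monotone hl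
          _ = (2 * l).choose l := Nat.centralBinom_eq_two_mul_choose _
          _ ≤ m.choose l := Nat.choose_le_choose _ hm
      omega
    · obtain ⟨h4, h5⟩ := of_cond_false h3
      rcases hl.eq_or_lt with rfl | hl
      · have hmB : m < B := by
          by_contra hcon
          have := Nat.choose_le_choose l₀ (show B ≤ m by omega)
          omega
        refine sieve_spec hk hmB heq hqs _ h4 ?_
        simp [Nat.testBit_shiftLeft, Nat.testBit_shiftRight, hmB, hm]
      · rw [force_eq] at h5
        exact ih _ h5 l m hl (by omega) hm heq

theorem eq_of_choose_eq_choose {a b k : ℕ} (hk : 1 ≤ k) (ha : k ≤ a) (hb : k ≤ b)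
    (h : a.choose k = b.choose k) : a = b := by
  have key : ∀ a b : ℕ, k ≤ a → a < b → a.choose k < b.choose k := by
    intro a b ha hab
    have h1 : (a + 1).choose k ≤ b.choose k := Nat.choose_le_choose k hab
    obtain ⟨j, rfl⟩ : ∃ j, k = j + 1 := ⟨k - 1, by omega⟩
    have h2 := Nat.choose_succ_succ' a j
    have h3 : 0 < a.choose j := Nat.choose_pos (by omega)
    omega
  rcases lt_trichotomy a b with hab | hab | hab
  · exact absurd h (key a b ha hab).ne
  · exact hab
  · exact absurd h (key b a hb hab).ne'

theorem cases_of_testBit_knownMask {k l m : ℕ} (h : (knownMask k l).testBit m = true) :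
    (k = 2 ∧ ((l = 3 ∧ (m = 10 ∨ m = 22 ∨ m = 36)) ∨ (l = 4 ∧ m = 10) ∨
      (l = 5 ∧ (m = 19 ∨ m = 15)) ∨ (l = 8 ∧ m = 17) ∨ (l = 6 ∧ m = 14))) ∨
    (k = 5 ∧ l = 6 ∧ m = 14) := by
  have hb : ∀ a b : ℕ, Nat.beq a b = decide (a = b) := fun a b => by
    rw [Bool.eq_iff_iff]; simp
  have hm : m < 37 := by
    by_contra hcon
    have hlt : knownMask k l < 2 ^ 37 := by
      simp only [knownMask, hb, Bool.cond_decide]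
      split_ifs <;> norm_num
    rw [Nat.testBit_lt_two_pow (hlt.trans_le (Nat.pow_le_pow_right (by omega) (by omega)))] at h
    simp at h
  simp only [knownMask, hb, Bool.cond_decide] at h
  split_ifs at h with h1 h2 h3 h4 h5 h6 h7 h8 <;> interval_cases m <;> first
    | (exfalso; revert h; decide)
    | omega

theorem cases_of_le_thirteen {n k m l : ℕ} (hn : n ≤ 10 ^ 6)
    (hk2 : 2 ≤ k) (hk : k ≤ 13) (hkn : 2 * k ≤ n) (hlm : 2 * l ≤ m) (hkl : k < l)
    (heq : n.choose k = m.choose l) :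
    (n, k, m, l) = (16, 2, 10, 3) ∨ (n, k, m, l) = (21, 2, 10, 4) ∨
    (n, k, m, l) = (56, 2, 22, 3) ∨ (n, k, m, l) = (120, 2, 36, 3) ∨
    (n, k, m, l) = (153, 2, 19, 5) ∨ (n, k, m, l) = (221, 2, 17, 8) ∨
    (n, k, m, l) = (78, 2, 15, 5) ∨ (n, k, m, l) = (78, 2, 14, 6) ∨
    (n, k, m, l) = (15, 5, 14, 6) := by
  have hmem : ∃ a ∈ bounds, a.1 = k := by
    have : ∀ k < 14, 2 ≤ k → ∃ a ∈ bounds, a.1 = k := by decide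
    exact this k (by omega) hk2
  obtain ⟨a, ha, rfl⟩ := hmem
  have hqs : ∀ q ∈ sievePrimes, q.Prime := by
    unfold sievePrimes
    simp only [List.forall_mem_cons, List.not_mem_nil, false_imp_iff, implies_true, and_true]
    norm_num
  have h := allMem_spec smallCheck_bounds a ha
  rw [force_eq] at h
  have hbit := smallCheck_spec (by simpa using hn) hqs _ h l m hkl (Nat.lt_succ_self _) hlm heq
  have key : ∀ n₀, a.1 ≤ n₀ → n₀.choose a.1 = m.choose l → n = n₀ := fun n₀ h0 h1 =>
    eq_of_choose_eq_choose (by omega) (by omega) h0 (heq.trans h1.symm)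
  simp only [Prod.mk.injEq]
  rcases cases_of_testBit_knownMask hbit with ⟨hk, h⟩ | ⟨hk, rfl, rfl⟩
  · rw [hk] at key ⊢
    rcases h with ⟨rfl, rfl | rfl | rfl⟩ | ⟨rfl, rfl⟩ | ⟨rfl, rfl | rfl⟩ | ⟨rfl, rfl⟩ | ⟨rfl, rfl⟩
    · rw [key 16 (by norm_num) (by decide +kernel)]; simp
    · rw [key 56 (by norm_num) (by decide +kernel)]; simp
    · rw [key 120 (by norm_num) (by decide +kernel)]; simp
    · rw [key 21 (by norm_num) (by decide +kernel)]; simp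
    · rw [key 153 (by norm_num) (by decide +kernel)]; simp
    · rw [key 78 (by norm_num) (by decide +kernel)]; simp
    · rw [key 221 (by norm_num) (by decide +kernel)]; simp
    · rw [key 78 (by norm_num) (by decide +kernel)]; simp
  · rw [hk] at key ⊢
    rw [key 15 (by norm_num) (by decide +kernel)]; simp

/-- The union of the shifts of `x` by `i * s` for `i < 2 ^ f`. -/
def stretch (f : ℕ) : ℕ → ℕ → ℕ :=
  Nat.rec (motive := fun _ => ℕ → ℕ → ℕ) (fun _ x => x)
    (fun _ r s x => force (Nat.add s s) fun t => r t (Nat.lor x (Nat.shiftLeft x s))) f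

/-- The union of the shifts of `x` by `i < L`, for positive `L`. -/
def smear (L x : ℕ) : ℕ :=
  Nat.lor (stretch (Nat.log2 L) 1 x)
    (Nat.shiftLeft (stretch (Nat.log2 L) 1 x) (Nat.sub L (Nat.pow 2 (Nat.log2 L))))

/-- The bits `j * q * i ≤ N` with `q` in the list and `q ≤ i` are added to the last argument. -/
def sieveOut (N j : ℕ) (qs : List ℕ) : ℕ → ℕ :=
  List.rec (motive := fun _ => ℕ → ℕ) (fun U => U)
    (fun q _ r U => force (Nat.mul j q) fun s => force (Nat.mul s q) fun s2 =>
      cond (Nat.ble s2 N)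
        (r (Nat.lor U (Nat.shiftLeft
          (stretch (Nat.succ (Nat.log2 (Nat.div (Nat.sub N s2) s))) s 1) s2)))
        (r U)) qs

def multiples (N j : ℕ) : ℕ :=
  Nat.land (Nat.sub (Nat.pow 2 (Nat.succ N)) 1)
    (Nat.shiftLeft (stretch (Nat.succ (Nat.log2 (Nat.div N j))) j 1) (Nat.mul 2 j))

/-- The bits `j * p ≤ N` with `p` prime. -/
def primeMultiples (N : ℕ) (qs : List ℕ) (j : ℕ) : ℕ :=
  Nat.xor (multiples N j) (Nat.land (multiples N j) (sieveOut N j qs 0))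

def withMasks (N S : ℕ) (qs : List ℕ) (js : List ℕ) : (List (ℕ × ℕ) → Bool) → Bool :=
  List.rec (motive := fun _ => (List (ℕ × ℕ) → Bool) → Bool) (fun k => k [])
    (fun j _ r k => r fun l => k ((j, smear S (primeMultiples N qs j)) :: l)) js

/-- A threshold at least `c * jj` with few distinct values. -/
def threshold (c jj : ℕ) : ℕ := Nat.shiftLeft (Nat.succ (Nat.shiftRight (Nat.mul c jj) 13)) 13

def pairInner (PL c j A : ℕ) (l : List (ℕ × ℕ)) : ℕ → ℕ :=
  List.rec (motive := fun _ => ℕ → ℕ) (fun acc => acc)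
    (fun a _ r acc => force (Nat.mul j a.1) fun jj => cond (Nat.ble jj PL)
      (cond (Nat.beq (Nat.gcd j a.1) 1)
        (force (threshold c jj) fun T =>
          r (Nat.lor acc (Nat.land (Nat.land A a.2)
            (Nat.sub (Nat.pow 2 1048576) (Nat.pow 2 T)))))
        (r acc))
      acc) l

def pairKill (PL c : ℕ) (l : List (ℕ × ℕ)) : ℕ → ℕ :=
  List.rec (motive := fun _ => ℕ → ℕ) (fun acc => acc)
    (fun a t r acc => force (pairInner PL c a.1 a.2 t acc) r) l

/-- Tests `p` at all positions below `2 ^ d` of nonzero bits, offset by the third argument. -/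
def allBits (d : ℕ) (p : ℕ → Bool) : ℕ → ℕ → Bool :=
  Nat.rec (motive := fun _ => ℕ → ℕ → Bool)
    (fun off m => cond (Nat.beq m 0) true (p off))
    (fun i r off m => cond (Nat.beq m 0) true
      (cond (force (Nat.mod m (Nat.pow 2 (Nat.pow 2 i))) fun lo => r off lo)
        (force (Nat.shiftRight m (Nat.pow 2 i)) fun hi =>
          force (Nat.add off (Nat.pow 2 i)) fun o => r o hi) false)) d

def rangeMask (lo hi : ℕ) : ℕ :=
  Nat.xor (Nat.sub (Nat.pow 2 (Nat.succ hi)) 1) (Nat.sub (Nat.pow 2 lo) 1)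

/-- Tests `p` at all `x` in `[W, N]` that are not excluded by prime multiples in `(x - S, x]`. -/
def testSurvivors (N W S c PL : ℕ) (qs js : List ℕ) (p : ℕ → Bool) : Bool :=
  withMasks N S qs js fun l => force (pairKill PL c l 0) fun K =>
    force (smear S (primeMultiples N qs 1)) fun P =>
      force (rangeMask W N) fun F =>
        force (Nat.xor F (Nat.land F (Nat.lor P K))) fun m => allBits 20 p 0 m

/-- Every `x` in `[lo, hi]` has a prime in `(x - δ, x]`. -/
def testGaps (N : ℕ) (qs : List ℕ) (lo hi δ : ℕ) : Bool :=
  force (rangeMask lo hi) fun F =>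
    Nat.beq (Nat.land F (smear δ (primeMultiples N qs 1))) F

theorem testBit_stretch (f : ℕ) : ∀ s x t : ℕ, (stretch f s x).testBit t = true ↔
    ∃ i < 2 ^ f, i * s ≤ t ∧ x.testBit (t - i * s) = true := by
  induction f with
  | zero =>
    intro s x t
    constructor
    · intro h
      exact ⟨0, by simp, by simp, by rwa [zero_mul, Nat.sub_zero]⟩
    · rintro ⟨i, hi, _, h⟩
      obtain rfl : i = 0 := by simpa using hi
      rwa [zero_mul, Nat.sub_zero] at h
  | succ f ih =>
    intro s x t
    have e : stretch (f + 1) s x = stretch f (s + s) (x ||| x <<< s) := by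
      exact force_eq (s + s) fun t => stretch f t (x ||| x <<< s)
    rw [e, ih]
    simp only [Nat.testBit_or, Nat.testBit_shiftLeft, Bool.or_eq_true, Bool.and_eq_true,
      decide_eq_true_eq, ge_iff_le]
    constructor
    · rintro ⟨i, hi, hle, h | ⟨h1, h⟩⟩
      · exact ⟨2 * i, by rw [pow_succ]; omega, by linarith, by
          rwa [show 2 * i * s = i * (s + s) by ring]⟩
      · have e2 : (2 * i + 1) * s = i * (s + s) + s := by ring
        exact ⟨2 * i + 1, by rw [pow_succ]; omega, by omega, by rwa [e2, ← Nat.sub_sub]⟩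
    · rintro ⟨i, hi, hle, h⟩
      rw [pow_succ] at hi
      rcases Nat.even_or_odd' i with ⟨c, rfl | rfl⟩
      · have e2 : 2 * c * s = c * (s + s) := by ring
        rw [e2] at hle h
        exact ⟨c, by omega, hle, Or.inl h⟩
      · have e2 : (2 * c + 1) * s = c * (s + s) + s := by ring
        rw [e2] at hle h
        exact ⟨c, by omega, by omega, Or.inr ⟨by omega, by rwa [Nat.sub_sub]⟩⟩

theorem of_testBit_smear {L x t : ℕ} (hL : L ≠ 0) (h : (smear L x).testBit t = true) :
    ∃ y < L, y ≤ t ∧ x.testBit (t - y) = true := by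
  have hlog : 2 ^ Nat.log2 L ≤ L := Nat.log2_self_le hL
  have e : smear L x = stretch (Nat.log2 L) 1 x ||| stretch (Nat.log2 L) 1 x <<< (L - 2 ^ Nat.log2 L) :=
    rfl
  rw [e, Nat.testBit_or, Nat.testBit_shiftLeft, Bool.or_eq_true, Bool.and_eq_true,
    testBit_stretch, testBit_stretch] at h
  simp only [mul_one, decide_eq_true_eq] at h
  rcases h with ⟨i, hi, hit, h⟩ | ⟨h1, i, hi, hit, h⟩
  · exact ⟨i, by omega, hit, h⟩
  · exact ⟨i + (L - 2 ^ Nat.log2 L), by omega, by omega, by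
      rwa [Nat.add_comm i, ← Nat.sub_sub]⟩

theorem testBit_progression {N s s2 t : ℕ} (hs : s ≠ 0) (h2 : s2 ≤ t) (ht : t ≤ N)
    (h : s ∣ t - s2) :
    ((stretch (Nat.log2 ((N - s2) / s) + 1) s 1) <<< s2).testBit t = true := by
  rw [Nat.testBit_shiftLeft, Bool.and_eq_true, testBit_stretch]
  obtain ⟨i, hi⟩ := h
  refine ⟨by simpa using h2, i, ?_, by rw [hi, mul_comm], by rw [hi, mul_comm]; simp⟩
  refine lt_of_le_of_lt ?_ Nat.lt_log2_self
  rw [Nat.le_div_iff_mul_le (by omega), mul_comm, ← hi]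
  omega

theorem testBit_sieveOut {N j t : ℕ} (hj : j ≠ 0) (ht : t ≤ N) {qs : List ℕ} :
    ∀ U : ℕ, (U.testBit t = true ∨ ∃ q ∈ qs, q ≠ 0 ∧ j * q ∣ t ∧ j * q * q ≤ t) →
      (sieveOut N j qs U).testBit t = true := by
  induction qs with
  | nil =>
    rintro U (h | ⟨q, hq, -⟩)
    · exact h
    · simp at hq
  | cons q qs ih =>
    intro U h
    have e : sieveOut N j (q :: qs) U = cond (Nat.ble (j * q * q) N)
        (sieveOut N j qs (U ||| stretch (Nat.log2 ((N - j * q * q) / (j * q)) + 1) (j * q) 1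
          <<< (j * q * q)))
        (sieveOut N j qs U) := by
      change force (j * q) (fun s => force (s * q) fun s2 => cond (Nat.ble s2 N)
        (sieveOut N j qs (U ||| stretch (Nat.log2 ((N - s2) / s) + 1) s 1 <<< s2))
        (sieveOut N j qs U)) = _
      rw [force_eq, force_eq]
    rw [e]
    cases hb : Nat.ble (j * q * q) N with
    | true =>
      apply ih
      rw [Nat.testBit_or, Bool.or_eq_true]
      rcases h with h | ⟨q', hq', h0, hd, hle⟩
      · exact Or.inl (Or.inl h)
      · rcases List.mem_cons.1 hq' with rfl | hq'
        · exact Or.inl (Or.inr (testBit_progression (mul_ne_zero hj h0) hle ht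
            (Nat.dvd_sub hd (Dvd.intro _ rfl))))
        · exact Or.inr ⟨q', hq', h0, hd, hle⟩
    | false =>
      apply ih
      rcases h with h | ⟨q', hq', h0, hd, hle⟩
      · exact Or.inl h
      · rcases List.mem_cons.1 hq' with rfl | hq'
        · have := Nat.ble_eq_true_of_le (hle.trans ht)
          rw [hb] at this
          exact absurd this (by simp)
        · exact Or.inr ⟨q', hq', h0, hd, hle⟩

theorem exists_prime_of_testBit_primeMultiples {N j t : ℕ} {qs : List ℕ}
    (hqs : ∀ q : ℕ, q.Prime → q ≤ 1000 → q ∈ qs) (hN : N ≤ 1000000) (hj : j ≠ 0)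
    (h : (primeMultiples N qs j).testBit t = true) : t ≤ N ∧ ∃ p : ℕ, p.Prime ∧ t = j * p := by
  have e : primeMultiples N qs j = multiples N j ^^^ (multiples N j &&& sieveOut N j qs 0) := rfl
  have e2 : multiples N j = (2 ^ (N + 1) - 1) &&&
    (stretch (Nat.log2 (N / j) + 1) j 1 <<< (2 * j)) := rfl
  rw [e, Nat.testBit_xor, Nat.testBit_and] at h
  obtain ⟨h1, h2⟩ : (multiples N j).testBit t = true ∧ (sieveOut N j qs 0).testBit t = false := by
    revert h
    cases (multiples N j).testBit t <;> cases (sieveOut N j qs 0).testBit t <;> simp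
  rw [e2, Nat.testBit_and, Nat.testBit_two_pow_sub_one, Bool.and_eq_true, Nat.testBit_shiftLeft,
    Bool.and_eq_true, testBit_stretch] at h1
  obtain ⟨h3, h4, i, -, hi, h5⟩ := h1
  have h3 : t ≤ N := by have := of_decide_eq_true h3; omega
  have h4 : 2 * j ≤ t := of_decide_eq_true h4
  have h6 : t - 2 * j - i * j = 0 := by
    by_contra hne
    rw [Nat.testBit_one_eq_true_iff_self_eq_zero] at h5
    exact hne h5
  have h7 : t = j * (i + 2) := by
    have : j * (i + 2) = i * j + 2 * j := by ring
    omega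
  refine ⟨h3, i + 2, ?_, h7⟩
  by_contra hp
  have hsq := Nat.minFac_sq_le_self (n := i + 2) (by omega) hp
  have hmp : (i + 2).minFac.Prime := Nat.minFac_prime (by omega)
  set q := (i + 2).minFac with hq
  have hle : j * (q * q) ≤ t := by
    rw [h7]
    exact Nat.mul_le_mul le_rfl (by rwa [← sq])
  have hq1000 : q ≤ 1000 := by
    have : 1 ≤ j := by omega
    nlinarith
  have : (sieveOut N j qs 0).testBit t = true := by
    refine testBit_sieveOut hj h3 0 (Or.inr ⟨q, hqs q hmp hq1000, hmp.ne_zero, ?_, ?_⟩)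
    · rw [h7]
      exact Nat.mul_dvd_mul_left _ (Nat.minFac_dvd _)
    · rwa [mul_assoc]
  rw [h2] at this
  exact absurd this (by simp)

/-- Some `j * p` with `p` prime lies in `(x - S, x]`. -/
def HasPrimeMultiple (S x j : ℕ) : Prop := ∃ p : ℕ, p.Prime ∧ j * p ≤ x ∧ x < j * p + S

/-- Two prime multiples in `(x - S, x]` with small coprime cofactors. -/
def HasPair (S c x : ℕ) : Prop :=
  ∃ i j : ℕ, i.Coprime j ∧ c * (i * j) ≤ x ∧ HasPrimeMultiple S x i ∧ HasPrimeMultiple S x j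

theorem hasPrimeMultiple_of_testBit_smear {N j S x : ℕ} {qs : List ℕ}
    (hqs : ∀ q : ℕ, q.Prime → q ≤ 1000 → q ∈ qs) (hN : N ≤ 1000000) (hj : j ≠ 0) (hS : S ≠ 0)
    (h : (smear S (primeMultiples N qs j)).testBit x = true) : HasPrimeMultiple S x j := by
  obtain ⟨y, hy, hyx, h⟩ := of_testBit_smear hS h
  obtain ⟨-, p, hp, ht⟩ := exists_prime_of_testBit_primeMultiples hqs hN hj h
  exact ⟨p, hp, by omega, by omega⟩

theorem withMasks_eq {N S : ℕ} {qs js : List ℕ} : ∀ k : List (ℕ × ℕ) → Bool,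
    withMasks N S qs js k = k (js.map fun j => (j, smear S (primeMultiples N qs j))) := by
  induction js with
  | nil => intro k; rfl
  | cons j js ih => intro k; exact ih _

theorem le_threshold (c jj : ℕ) : c * jj ≤ threshold c jj := by
  have e : threshold c jj = ((c * jj) >>> 13 + 1) <<< 13 := rfl
  rw [e, Nat.shiftLeft_eq, Nat.shiftRight_eq_div_pow]
  omega

theorem le_of_testBit_two_pow_sub {a T i : ℕ} (h : (2 ^ a - 2 ^ T).testBit i = true) : T ≤ i := by
  by_contra hcon
  rcases le_total T a with hT | hT
  · have e : 2 ^ a - 2 ^ T = (2 ^ (a - T) - 1) <<< T := by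
      rw [Nat.shiftLeft_eq, Nat.sub_mul, ← pow_add, Nat.sub_add_cancel hT, one_mul]
    rw [e, Nat.testBit_shiftLeft] at h
    simp only [Bool.and_eq_true, decide_eq_true_eq] at h
    omega
  · have : 2 ^ a ≤ 2 ^ T := Nat.pow_le_pow_right (by omega) hT
    rw [Nat.sub_eq_zero_of_le this] at h
    simp at h

theorem pairInner_spec {PL c S j A : ℕ} {l : List (ℕ × ℕ)}
    (hA : ∀ x, A.testBit x = true → HasPrimeMultiple S x j)
    (hl : ∀ a ∈ l, ∀ x, a.2.testBit x = true → HasPrimeMultiple S x a.1) :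
    ∀ acc : ℕ, (∀ x, acc.testBit x = true → HasPair S c x) →
      ∀ x, (pairInner PL c j A l acc).testBit x = true → HasPair S c x := by
  induction l with
  | nil => intro acc h x; exact h x
  | cons a l ih =>
    intro acc hacc
    have ih := ih fun b hb => hl b (by simp [hb])
    have e : pairInner PL c j A (a :: l) acc = cond (Nat.ble (j * a.1) PL)
        (cond (Nat.beq (Nat.gcd j a.1) 1)
          (pairInner PL c j A l (acc ||| ((A &&& a.2) &&&
            (2 ^ 1048576 - 2 ^ threshold c (j * a.1)))))
          (pairInner PL c j A l acc))
        acc := by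
      change force (j * a.1) (fun jj => cond (Nat.ble jj PL)
        (cond (Nat.beq (Nat.gcd j a.1) 1)
          (force (threshold c jj) fun T => pairInner PL c j A l (acc ||| ((A &&& a.2) &&&
            (2 ^ 1048576 - 2 ^ T))))
          (pairInner PL c j A l acc)) acc) = _
      rw [force_eq, force_eq]
    rw [e]
    cases Nat.ble (j * a.1) PL with
    | false => exact hacc
    | true =>
      cases hg : Nat.beq (Nat.gcd j a.1) 1 with
      | false => exact ih acc hacc
      | true =>
        refine ih _ fun x hx => ?_
        rw [Nat.testBit_or, Bool.or_eq_true] at hx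
        rcases hx with hx | hx
        · exact hacc x hx
        · rw [Nat.testBit_and, Nat.testBit_and, Bool.and_eq_true, Bool.and_eq_true] at hx
          exact ⟨j, a.1, Nat.eq_of_beq_eq_true hg,
            (le_threshold _ _).trans (le_of_testBit_two_pow_sub hx.2), hA x hx.1.1,
            hl a (by simp) x hx.1.2⟩

theorem pairKill_spec {PL c S : ℕ} {l : List (ℕ × ℕ)}
    (hl : ∀ a ∈ l, ∀ x, a.2.testBit x = true → HasPrimeMultiple S x a.1) :
    ∀ acc : ℕ, (∀ x, acc.testBit x = true → HasPair S c x) →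
      ∀ x, (pairKill PL c l acc).testBit x = true → HasPair S c x := by
  induction l with
  | nil => intro acc h x; exact h x
  | cons a l ih =>
    intro acc hacc
    have e : pairKill PL c (a :: l) acc
        = force (pairInner PL c a.1 a.2 l acc) (pairKill PL c l) := rfl
    rw [e, force_eq]
    exact ih (fun b hb => hl b (by simp [hb])) _
      (pairInner_spec (hl a (by simp)) (fun b hb => hl b (by simp [hb])) acc hacc)

theorem allBits_spec {p : ℕ → Bool} (d : ℕ) : ∀ off m : ℕ, allBits d p off m = true →
    ∀ i < 2 ^ d, m.testBit i = true → p (off + i) = true := by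
  induction d with
  | zero =>
    intro off m h i hi hm
    obtain rfl : i = 0 := by simpa using hi
    have e : allBits 0 p off m = cond (Nat.beq m 0) true (p off) := rfl
    rw [e] at h
    rcases of_cond_true h with h | h
    · rw [Nat.eq_of_beq_eq_true h] at hm
      simp at hm
    · exact h
  | succ d ih =>
    intro off m h i hi hm
    have e : allBits (d + 1) p off m = cond (Nat.beq m 0) true
      (cond (force (m % 2 ^ 2 ^ d) fun lo => allBits d p off lo)
        (force (m >>> 2 ^ d) fun hi =>
          force (off + 2 ^ d) fun o => allBits d p o hi) false) := rfl
    rw [e] at h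
    rcases of_cond_true h with h | h
    · rw [Nat.eq_of_beq_eq_true h] at hm
      simp at hm
    · obtain ⟨h1, h2⟩ := of_cond_false h
      simp only [force_eq] at h1 h2
      rcases lt_or_ge i (2 ^ d) with hid | hid
      · refine ih off _ h1 i hid ?_
        rw [Nat.testBit_mod_two_pow, hm]
        simp [hid]
      · have := ih _ _ h2 (i - 2 ^ d) (by rw [pow_succ] at hi; omega)
          (by rw [Nat.testBit_shiftRight, Nat.add_sub_cancel' hid, hm])
        rwa [show off + 2 ^ d + (i - 2 ^ d) = off + i by omega] at this

theorem testBit_rangeMask {lo hi x : ℕ} (h1 : lo ≤ x) (h2 : x ≤ hi) :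
    (rangeMask lo hi).testBit x = true := by
  have e : rangeMask lo hi = (2 ^ (hi + 1) - 1) ^^^ (2 ^ lo - 1) := rfl
  rw [e, Nat.testBit_xor, Nat.testBit_two_pow_sub_one, Nat.testBit_two_pow_sub_one]
  simp only [show x < hi + 1 by omega, show ¬ x < lo by omega]
  simp

theorem testSurvivors_spec {N W S c PL : ℕ} {qs js : List ℕ} {p : ℕ → Bool}
    (hqs : ∀ q : ℕ, q.Prime → q ≤ 1000 → q ∈ qs) (hN : N ≤ 1000000) (hS : S ≠ 0)
    (hjs : ∀ j ∈ js, j ≠ 0)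
    (h : testSurvivors N W S c PL qs js p = true) {x : ℕ} (h1 : W ≤ x) (h2 : x ≤ N) :
    HasPrimeMultiple S x 1 ∨ HasPair S c x ∨ p x = true := by
  rw [testSurvivors, withMasks_eq] at h
  simp only [force_eq] at h
  set l := js.map fun j => (j, smear S (primeMultiples N qs j))
  have hl : ∀ a ∈ l, ∀ x, a.2.testBit x = true → HasPrimeMultiple S x a.1 := by
    intro a ha x hx
    obtain ⟨j, hj, rfl⟩ := List.mem_map.1 ha
    exact hasPrimeMultiple_of_testBit_smear hqs hN (hjs j hj) hS hx
  have hK := pairKill_spec (PL := PL) (c := c) hl 0 (by simp)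
  cases hP : (smear S (primeMultiples N qs 1)).testBit x with
  | true => exact Or.inl (hasPrimeMultiple_of_testBit_smear hqs hN one_ne_zero hS hP)
  | false =>
    cases hk : (pairKill PL c l 0).testBit x with
    | true => exact Or.inr (Or.inl (hK x hk))
    | false =>
      have := allBits_spec 20 0 _ h x (by norm_num; omega)
      rw [Nat.zero_add] at this
      refine Or.inr (Or.inr (this ?_))
      have e : Nat.xor (rangeMask W N) (Nat.land (rangeMask W N)
          (Nat.lor (smear S (primeMultiples N qs 1)) (pairKill PL c l 0)))
        = rangeMask W N ^^^ (rangeMask W N &&&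
          (smear S (primeMultiples N qs 1) ||| pairKill PL c l 0)) := rfl
      rw [e, Nat.testBit_xor, Nat.testBit_and, Nat.testBit_or, hP, hk, testBit_rangeMask h1 h2]
      rfl

theorem testGaps_spec {N lo hi δ : ℕ} {qs : List ℕ}
    (hqs : ∀ q : ℕ, q.Prime → q ≤ 1000 → q ∈ qs) (hN : N ≤ 1000000) (hδ : δ ≠ 0)
    (h : testGaps N qs lo hi δ = true) {x : ℕ} (h1 : lo ≤ x) (h2 : x ≤ hi) :
    HasPrimeMultiple δ x 1 := by
  rw [testGaps, force_eq] at h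
  have h := Nat.eq_of_beq_eq_true h
  have hx := testBit_rangeMask h1 h2
  rw [← h] at hx
  have e : Nat.land (rangeMask lo hi) (smear δ (primeMultiples N qs 1))
    = rangeMask lo hi &&& smear δ (primeMultiples N qs 1) := rfl
  rw [e, Nat.testBit_and, Bool.and_eq_true] at hx
  exact hasPrimeMultiple_of_testBit_smear hqs hN one_ne_zero hδ hx.2

/-- A prime factor of `t`, or `0`. The list consists of pairs `(z, z!)`. -/
def primePart (st : List (ℕ × ℕ)) : ℕ → ℕ :=
  List.rec (motive := fun _ => ℕ → ℕ) (fun _ => 0)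
    (fun a _ r t => force (Nat.div t (Nat.gcd t a.2)) fun u =>
      force (Nat.div u (Nat.gcd u a.2)) fun y =>
        cond (Nat.ble 2 y)
          (cond (Nat.ble y (Nat.mul a.1 a.1)) (cond (Nat.beq (Nat.gcd y a.2) 1) y (r t)) (r t))
          (r t)) st

/-- Passes a list of primes dividing numbers in `(x - S, x]` to `k`, unless there is
a prime in that interval. -/
def withPrimes (st : List (ℕ × ℕ)) (x S : ℕ) (k : List ℕ → Bool) : List ℕ → Bool :=
  Nat.rec (motive := fun _ => List ℕ → Bool) k
    (fun y r acc => force (Nat.sub x y) fun t => force (primePart st t) fun q =>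
      cond (Nat.beq q 0) (r acc) (cond (Nat.beq q t) true (r (q :: acc)))) S

def maxOf (l : List ℕ) : ℕ → ℕ :=
  List.rec (motive := fun _ => ℕ → ℕ) (fun m => m)
    (fun q _ r m => cond (Nat.ble m q) (r q) (r m)) l

def upperCheck (b : ℕ) (ps : List ℕ) (c : ℕ) : Bool :=
  force (Nat.add c (Nat.mul 2 b)) fun c2 =>
    cond (anyMem ps fun p => Nat.ble (Nat.succ (Nat.mul 4 b)) (Nat.mod c2 p)) true
      (allBelow (Nat.succ (Nat.mul 2 b)) fun i => force (Nat.add c i) fun N =>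
        anyMem ps fun p => Nat.ble (Nat.succ (Nat.mul 2 b)) (Nat.mod N p))

def lowerCheck (st : List (ℕ × ℕ)) (x S b L : ℕ) (ps : List ℕ) (c : ℕ) : Bool :=
  force (Nat.add c L) fun c2 =>
    cond (anyMem ps fun p => Nat.ble (Nat.mul 2 L) (Nat.mod c2 p)) true
      (allBelow L fun i => force (Nat.add c i) fun M =>
        cond (anyMem ps fun p => Nat.ble L (Nat.mod M p)) true
          (anyBelow S fun s => force (primePart st (Nat.sub M s)) fun q =>
            cond (Nat.ble L q) (Nat.ble b (Nat.mod x q)) false))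

/-- Excludes collisions with a row size or cofactor in `[S, b]` and counterpart below `L`. -/
def windowCheck (st : List (ℕ × ℕ)) (S b L x : ℕ) : Bool :=
  withPrimes st x S (fun ps => force (maxOf ps 0) fun p => force (Nat.div x p) fun j =>
    cond (Nat.beq p 0) false
      (allBelow (Nat.mul 2 j) fun a => force (Nat.mul a p) fun c =>
        cond (Nat.ble a j)
          (cond (Nat.beq a j) true (cond (Nat.beq a 0) true (lowerCheck st x S b L ps c)))
          (upperCheck b ps c))) []

def withStages (k : List (ℕ × ℕ) → Bool) : Bool :=
  force (descFac 1000 1000) fun a => force (descFac 148 148) fun b =>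
    force (descFac 30 30) fun c => k [(1000, a), (148, b), (30, c)]

/-- Every prime dividing a number in `(x - S, x]` has a multiple close to `N`, with a cofactor
between `1` and `2` times the one it has near `x`. -/
def Upper (x N S b : ℕ) : Prop := ∀ p : ℕ, p.Prime → p ≤ x → x % p < S →
  ∃ a, x / p < a ∧ a < 2 * (x / p) ∧ a * p ≤ N + b ∧ N ≤ a * p + b

/-- Every prime dividing a number in `(x - S, x]` has a nonzero multiple in `(M - L, M]`, with a
smaller cofactor, and large primes dividing numbers in `(M - S, M]` have a multiple in
`(x - b, x]`. -/
def Lower (x M S b L : ℕ) : Prop :=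
  (∀ p : ℕ, p.Prime → p ≤ x → x % p < S → 1 ≤ M / p ∧ M / p < x / p ∧ M % p < L) ∧
    ∀ q : ℕ, q.Prime → L ≤ q → M % q < S → x % q < b

theorem div_mod_of_le {x p S j : ℕ} (h1 : j * p ≤ x) (h2 : x < j * p + S) (hS : S ≤ p) :
    x / p = j ∧ x % p = x - j * p := by
  have hp : 0 < p := by
    rcases Nat.eq_zero_or_pos p with rfl | h
    · omega
    · exact h
  have hd : x / p = j := by
    apply Nat.div_eq_of_lt_le h1
    rw [add_mul, one_mul]
    omega
  refine ⟨hd, ?_⟩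
  have := Nat.div_add_mod x p
  rw [hd, mul_comm] at this
  omega

theorem exists_prime_near {x S : ℕ} (hx : 2 * S ≤ x) (h : HasPrimeMultiple S x 1) :
    ∃ p : ℕ, p.Prime ∧ p ≤ x ∧ x % p < S ∧ x / p = 1 := by
  obtain ⟨p, hp, h1, h2⟩ := h
  obtain ⟨h3, h4⟩ := div_mod_of_le h1 h2 (by omega)
  exact ⟨p, hp, by omega, by omega, h3⟩

theorem HasPrimeMultiple.not_upper {x S N b : ℕ} (hx : 2 * S ≤ x) (h : HasPrimeMultiple S x 1) :
    ¬ Upper x N S b := by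
  obtain ⟨p, hp, h1, h2, h3⟩ := exists_prime_near hx h
  intro hU
  obtain ⟨a, h4, h5, -⟩ := hU p hp h1 h2
  omega

theorem HasPrimeMultiple.not_lower {x S M b L : ℕ} (hx : 2 * S ≤ x) (h : HasPrimeMultiple S x 1) :
    ¬ Lower x M S b L := by
  obtain ⟨p, hp, h1, h2, h3⟩ := exists_prime_near hx h
  intro hU
  have := hU.1 p hp h1 h2
  omega

/-- The cofactors of `p` and `q` near `N` are proportional to those near `x`. -/
theorem HasPair.exists_cofactors {x S c : ℕ} (hx : 2 * S ≤ x) (hc : 2 * S ≤ c)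
    (h : HasPair S c x) : ∃ i j p q : ℕ, i.Coprime j ∧ 0 < i ∧ 0 < j ∧ c * (i * j) ≤ x ∧
      (p.Prime ∧ p ≤ x ∧ x % p < S ∧ x / p = i) ∧ (q.Prime ∧ q ≤ x ∧ x % q < S ∧ x / q = j) := by
  obtain ⟨i, j, hij, hcx, ⟨p, hp, h1, h2⟩, ⟨q, hq, h3, h4⟩⟩ := h
  have hS : 0 < S := by omega
  have hi : 0 < i := by
    rcases Nat.eq_zero_or_pos i with rfl | h
    · omega
    · exact h
  have hj : 0 < j := by
    rcases Nat.eq_zero_or_pos j with rfl | h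
    · omega
    · exact h
  have aux : ∀ i j p : ℕ, 0 < i → 0 < j → c * (i * j) ≤ x → x < i * p + S → S ≤ p := by
    intro i j p hi hj h h'
    by_contra hcon
    have : 2 * S * (i * 1) ≤ c * (i * j) := Nat.mul_le_mul hc (Nat.mul_le_mul le_rfl hj)
    nlinarith
  have hSp := aux i j p hi hj hcx h2
  have hSq := aux j i q hj hi (by rwa [mul_comm j i]) h4
  obtain ⟨e1, e2⟩ := div_mod_of_le h1 h2 hSp
  obtain ⟨e3, e4⟩ := div_mod_of_le h3 h4 hSq
  exact ⟨i, j, p, q, hij, hi, hj, hcx, ⟨hp, by nlinarith, by omega, e1⟩,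
    ⟨hq, by nlinarith, by omega, e3⟩⟩

theorem HasPair.not_upper {x S N b c : ℕ} (hx : 2 * S ≤ x) (hS : S ≤ b) (hc : 4 * b < c)
    (h : HasPair S c x) : ¬ Upper x N S b := by
  obtain ⟨i, j, p, q, hij, hi, hj, hcx, ⟨hp, h1, h2, h3⟩, ⟨hq, h4, h5, h6⟩⟩ :=
    h.exists_cofactors hx (by omega)
  intro hU
  obtain ⟨a, ha1, ha2, ha3, ha4⟩ := hU p hp h1 h2
  obtain ⟨a', hb1, hb2, hb3, hb4⟩ := hU q hq h4 h5
  rw [h3] at ha1 ha2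
  rw [h6] at hb1 hb2
  have ex := Nat.div_add_mod x p
  have ey := Nat.div_add_mod x q
  rw [h3] at ex
  rw [h6] at ey
  set ρ := x % p
  set σ := x % q
  have key : a * j = a' * i := by
    zify at *
    have hij0 : (0 : ℤ) < i * j := by positivity
    have m1 : (i * j : ℤ) * (a * p) ≤ i * j * (N + b) := by gcongr
    have m2 : (i * j : ℤ) * N ≤ i * j * (a * p + b) := by gcongr
    have m3 : (i * j : ℤ) * (a' * q) ≤ i * j * (N + b) := by gcongr
    have m4 : (i * j : ℤ) * N ≤ i * j * (a' * q + b) := by gcongr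
    have e1 : (i * j : ℤ) * (a * p) = a * j * x - a * j * ρ := by rw [← ex]; ring
    have e2 : (i * j : ℤ) * (a' * q) = a' * i * x - a' * i * σ := by rw [← ey]; ring
    have r1 : (a * j * ρ : ℤ) ≤ 2 * i * j * b := by
      have : (a * j * ρ : ℤ) ≤ (2 * i) * j * b := by gcongr; linarith
      linarith
    have r2 : (a' * i * σ : ℤ) ≤ 2 * i * j * b := by
      have : (a' * i * σ : ℤ) ≤ (2 * j) * i * b := by gcongr; linarith
      linarith
    have r3 : (0 : ℤ) ≤ a * j * ρ := by positivity
    have r4 : (0 : ℤ) ≤ a' * i * σ := by positivity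
    have hbig : (4 * b * (i * j) : ℤ) < x := lt_of_lt_of_le (by gcongr) hcx
    rcases lt_trichotomy (a * j : ℤ) (a' * i) with hlt | heq | hgt
    · have : (x : ℤ) * 1 ≤ x * (a' * i - a * j) := by gcongr; linarith
      linarith
    · exact heq
    · have : (x : ℤ) * 1 ≤ x * (a * j - a' * i) := by gcongr; linarith
      linarith
  have hd : i ∣ a := hij.dvd_of_dvd_mul_right (Dvd.intro_left _ key.symm)
  obtain ⟨t, rfl⟩ := hd
  have : 1 < t := by by_contra h; have : t ≤ 1 := by omega
                     nlinarith
  nlinarith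

theorem HasPair.not_lower {x S M b c L : ℕ} (hx : 2 * S ≤ x) (hS : S ≤ b) (hc : L + b ≤ c)
    (hL : b ≤ L) (h : HasPair S c x) : ¬ Lower x M S b L := by
  obtain ⟨i, j, p, q, hij, hi, hj, hcx, ⟨hp, h1, h2, h3⟩, ⟨hq, h4, h5, h6⟩⟩ :=
    h.exists_cofactors hx (by omega)
  intro hU
  obtain ⟨ha1, ha2, ha3⟩ := hU.1 p hp h1 h2
  obtain ⟨hb1, hb2, hb3⟩ := hU.1 q hq h4 h5
  rw [h3] at ha2
  rw [h6] at hb2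
  have ex := Nat.div_add_mod x p
  have ey := Nat.div_add_mod x q
  have fx := Nat.div_add_mod M p
  have fy := Nat.div_add_mod M q
  rw [h3] at ex
  rw [h6] at ey
  set ρ := x % p
  set σ := x % q
  set r := M % p
  set s := M % q
  set a := M / p
  set a' := M / q
  have key : a * j = a' * i := by
    zify at *
    have hij0 : (0 : ℤ) < i * j := by positivity
    have e1 : (i * j : ℤ) * M = a * j * x - a * j * ρ + i * j * r := by
      rw [← fx, ← ex]; ring
    have e2 : (i * j : ℤ) * M = a' * i * x - a' * i * σ + i * j * s := by
      rw [← fy, ← ey]; ring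
    have r1 : (a * j * ρ : ℤ) ≤ i * j * b := by gcongr; linarith
    have r2 : (a' * i * σ : ℤ) ≤ i * j * b := by
      have : (a' * i * σ : ℤ) ≤ j * i * b := by gcongr; linarith
      linarith
    have r3 : (0 : ℤ) ≤ a * j * ρ := by positivity
    have r4 : (0 : ℤ) ≤ a' * i * σ := by positivity
    have r5 : (i * j : ℤ) * r < i * j * L := by gcongr
    have r6 : (i * j : ℤ) * s < i * j * L := by gcongr
    have r7 : (0 : ℤ) ≤ i * j * r := by positivity
    have r8 : (0 : ℤ) ≤ i * j * s := by positivity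
    have hbig : ((L + b) * (i * j) : ℤ) ≤ x := le_trans (by gcongr) hcx
    rcases lt_trichotomy (a * j : ℤ) (a' * i) with hlt | heq | hgt
    · have : (x : ℤ) * 1 ≤ x * (a' * i - a * j) := by gcongr; linarith
      linarith
    · exact heq
    · have : (x : ℤ) * 1 ≤ x * (a * j - a' * i) := by gcongr; linarith
      linarith
  have hd : i ∣ a := hij.dvd_of_dvd_mul_right (Dvd.intro_left _ key.symm)
  have := Nat.le_of_dvd (by omega) hd
  omega

theorem primePart_spec {st : List (ℕ × ℕ)} (hst : ∀ a ∈ st, a.2 = a.1.factorial) {t : ℕ}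
    (h : primePart st t ≠ 0) : (primePart st t).Prime ∧ primePart st t ∣ t := by
  induction st with
  | nil => exact absurd rfl h
  | cons a st ih =>
    have ih := ih fun b hb => hst b (by simp [hb])
    have e : primePart (a :: st) t = force (t / t.gcd a.2) fun u => force (u / u.gcd a.2) fun y =>
        cond (Nat.ble 2 y)
          (cond (Nat.ble y (a.1 * a.1)) (cond (Nat.beq (y.gcd a.2) 1) y (primePart st t))
            (primePart st t))
          (primePart st t) := rfl
    rw [force_eq, force_eq] at e
    set u := t / t.gcd a.2
    set y := u / u.gcd a.2
    rw [e] at h ⊢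
    have hyt : y ∣ t := (Nat.div_dvd_of_dvd (Nat.gcd_dvd_left _ _)).trans
      (Nat.div_dvd_of_dvd (Nat.gcd_dvd_left _ _))
    cases h1 : Nat.ble 2 y with
    | false => rw [h1] at h; exact ih h
    | true =>
      cases h2 : Nat.ble y (a.1 * a.1) with
      | false => rw [h1, h2] at h; exact ih h
      | true =>
        cases h3 : Nat.beq (y.gcd a.2) 1 with
        | false => rw [h1, h2, h3] at h; exact ih h
        | true =>
          refine ⟨?_, hyt⟩
          have h1 := Nat.le_of_ble_eq_true h1
          have h2 := Nat.le_of_ble_eq_true h2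
          have h3 := Nat.eq_of_beq_eq_true h3
          rw [hst a (by simp)] at h3
          change y.Prime
          by_contra hp
          have hsq := Nat.minFac_sq_le_self (n := y) (by omega) hp
          have hmp : y.minFac.Prime := Nat.minFac_prime (by omega)
          have hle : y.minFac ≤ a.1 := Nat.mul_self_le_mul_self_iff.1 (by rw [← sq]; omega)
          have := Nat.dvd_gcd (Nat.minFac_dvd y) (hmp.dvd_factorial.2 hle)
          rw [h3] at this
          exact hmp.one_lt.ne' (Nat.dvd_one.1 this)

theorem withPrimes_spec {st : List (ℕ × ℕ)} (hst : ∀ a ∈ st, a.2 = a.1.factorial)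
    {x S : ℕ} {k : List ℕ → Bool} (T : ℕ) (hT : T ≤ S) : ∀ acc : List ℕ,
    (∀ p ∈ acc, p.Prime ∧ p ≤ x ∧ x % p < S) → withPrimes st x T k acc = true →
    HasPrimeMultiple S x 1 ∨ ∃ ps : List ℕ, (∀ p ∈ ps, p.Prime ∧ p ≤ x ∧ x % p < S) ∧
      k ps = true := by
  induction T with
  | zero => intro acc hacc h; exact Or.inr ⟨acc, hacc, h⟩
  | succ y ih =>
    intro acc hacc h
    have ih := ih (by omega)
    have e : withPrimes st x (y + 1) k acc = force (x - y) fun t => force (primePart st t) fun q =>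
      cond (Nat.beq q 0) (withPrimes st x y k acc)
        (cond (Nat.beq q t) true (withPrimes st x y k (q :: acc))) := rfl
    rw [force_eq, force_eq] at e
    rw [e] at h
    cases h0 : Nat.beq (primePart st (x - y)) 0 with
    | true => rw [h0] at h; exact ih acc hacc h
    | false =>
      have hq := primePart_spec hst (Nat.ne_of_beq_eq_false h0)
      have hxy : x - y ≠ 0 := by
        intro h1
        rw [h1] at hq h0
        have h2 : primePart st 0 = 0 := by
          clear * -
          induction st with
          | nil => rfl
          | cons a st ih =>
            have e : primePart (a :: st) 0 = force (0 / Nat.gcd 0 a.2) fun u =>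
              force (u / u.gcd a.2) fun y => cond (Nat.ble 2 y)
                (cond (Nat.ble y (a.1 * a.1)) (cond (Nat.beq (y.gcd a.2) 1) y (primePart st 0))
                  (primePart st 0))
                (primePart st 0) := rfl
            rw [e, force_eq, force_eq, Nat.zero_div, Nat.zero_div, ih]
            rfl
        rw [h2] at h0
        exact absurd h0 (by decide)
      have hle := Nat.le_of_dvd (by omega) hq.2
      rw [h0] at h
      cases h1 : Nat.beq (primePart st (x - y)) (x - y) with
      | true =>
        rw [Nat.eq_of_beq_eq_true h1] at hq
        exact Or.inl ⟨_, hq.1, by omega, by omega⟩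
      | false =>
        rw [h1] at h
        refine ih _ ?_ h
        intro p hp
        rcases List.mem_cons.1 hp with rfl | hp
        · refine ⟨hq.1, by omega, lt_of_le_of_lt ?_ (show y < S by omega)⟩
          obtain ⟨c, hc⟩ := hq.2
          have : x = y + primePart st (x - y) * c := by omega
          calc x % primePart st (x - y) = (y + primePart st (x - y) * c) % primePart st (x - y) :=
                congrArg (· % _) this
            _ = y % primePart st (x - y) := Nat.add_mul_mod_self_left _ _ _
            _ ≤ y := Nat.mod_le _ _
        · exact hacc p hp

theorem maxOf_mem (l : List ℕ) : ∀ m : ℕ, maxOf l m = m ∨ maxOf l m ∈ l := by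
  induction l with
  | nil => intro m; exact Or.inl rfl
  | cons q l ih =>
    intro m
    have e : maxOf (q :: l) m = cond (Nat.ble m q) (maxOf l q) (maxOf l m) := rfl
    rw [e]
    cases Nat.ble m q with
    | false =>
      rcases ih m with h | h
      · exact Or.inl h
      · exact Or.inr (by simp [h])
    | true =>
      rcases ih q with h | h
      · exact Or.inr (by simp [h])
      · exact Or.inr (by simp [h])

theorem mod_le_of_mul_le {a p c d : ℕ} (h1 : a * p ≤ c) (h2 : c ≤ a * p + d) : c % p ≤ d := by
  obtain ⟨e, rfl⟩ := Nat.exists_eq_add_of_le h1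
  rw [Nat.add_comm, Nat.add_mul_mod_self_right]
  exact (Nat.mod_le _ _).trans (by omega)

theorem upperCheck_spec {b N c : ℕ} {ps : List ℕ} (h : upperCheck b ps c = true)
    (hps : ∀ p ∈ ps, ∃ a, a * p ≤ N + b ∧ N ≤ a * p + b) (h1 : c ≤ N + b) (h2 : N ≤ c + b) :
    False := by
  rw [upperCheck, force_eq] at h
  rcases of_cond_true h with h | h
  · obtain ⟨p, hp, h⟩ := anyMem_spec h
    have h := Nat.le_of_ble_eq_true h
    obtain ⟨a, h3, h4⟩ := hps p hp
    have := mod_le_of_mul_le (a := a) (p := p) (c := c + 2 * b) (d := 4 * b) (by omega) (by omega)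
    exact absurd (this.trans_lt h) (lt_irrefl _)
  · have := allBelow_spec h (N + b - c) (by change _ < 2 * b + 1; omega)
    rw [force_eq] at this
    obtain ⟨p, hp, h⟩ := anyMem_spec this
    have h := Nat.le_of_ble_eq_true h
    obtain ⟨a, h3, h4⟩ := hps p hp
    have := mod_le_of_mul_le (a := a) (p := p) (c := c + (N + b - c)) (d := 2 * b)
      (by omega) (by omega)
    exact absurd (this.trans_lt h) (lt_irrefl _)

theorem lowerCheck_spec {st : List (ℕ × ℕ)} (hst : ∀ a ∈ st, a.2 = a.1.factorial)
    {x S b L M c : ℕ} {ps : List ℕ} (hL : 0 < L) (h : lowerCheck st x S b L ps c = true)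
    (hM : ∀ p ∈ ps, M % p < L) (hq : ∀ q : ℕ, q.Prime → L ≤ q → M % q < S → x % q < b)
    (h1 : c ≤ M) (h2 : M < c + L) : False := by
  rw [lowerCheck, force_eq] at h
  rcases of_cond_true h with h | h
  · obtain ⟨p, hp, h⟩ := anyMem_spec h
    have h : 2 * L ≤ (c + L) % p := Nat.le_of_ble_eq_true h
    have h3 := hM p hp
    have h4 := Nat.div_add_mod M p
    rw [mul_comm] at h4
    have := mod_le_of_mul_le (a := M / p) (p := p) (c := c + L) (d := 2 * L - 1)
      (by omega) (by omega)
    omega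
  · have := allBelow_spec h (M - c) (by omega)
    rw [force_eq] at this
    have e : Nat.add c (M - c) = M := Nat.add_sub_cancel' h1
    rw [e] at this
    rcases of_cond_true this with h | h
    · obtain ⟨p, hp, h⟩ := anyMem_spec h
      have h : L ≤ M % p := Nat.le_of_ble_eq_true h
      exact absurd (hM p hp) (not_lt.2 h)
    · obtain ⟨s, hs, h⟩ := anyBelow_spec h
      rw [force_eq] at h
      obtain ⟨h3, h4⟩ := of_cond_false h
      have h3 := Nat.le_of_ble_eq_true h3
      have h4 : b ≤ x % _ := Nat.le_of_ble_eq_true h4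
      have hp := primePart_spec hst (t := M - s) (by change L ≤ primePart st (M - s) at h3; omega)
      refine absurd (hq _ hp.1 h3 ?_) (not_lt.2 h4)
      refine lt_of_le_of_lt ?_ hs
      obtain ⟨d, hd⟩ := hp.2
      rcases le_total s M with hsM | hsM
      · exact mod_le_of_mul_le (a := d) (by rw [mul_comm, ← hd]; omega)
          (by rw [mul_comm, ← hd]; omega)
      · exact (Nat.mod_le _ _).trans hsM

theorem windowCheck_spec {st : List (ℕ × ℕ)} (hst : ∀ a ∈ st, a.2 = a.1.factorial)
    {x S b L : ℕ} (hx : 2 * S ≤ x) (hL : 0 < L) (h : windowCheck st S b L x = true) :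
    (∀ N, ¬ Upper x N S b) ∧ ∀ M, ¬ Lower x M S b L := by
  rw [windowCheck] at h
  rcases withPrimes_spec hst S le_rfl [] (by simp) h with h | ⟨ps, hps, h⟩
  · exact ⟨fun N => h.not_upper hx, fun M => h.not_lower hx⟩
  rw [force_eq, force_eq] at h
  cases h0 : Nat.beq (maxOf ps 0) 0 with
  | true => rw [h0] at h; exact absurd h (by simp)
  | false =>
    rw [h0] at h
    have hmem : maxOf ps 0 ∈ ps := (maxOf_mem ps 0).resolve_left (Nat.ne_of_beq_eq_false h0)
    set p := maxOf ps 0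
    obtain ⟨hp, hpx, hpS⟩ := hps p hmem
    have hall : ∀ a < 2 * (x / p), a ≠ 0 → a ≠ x / p →
        (a < x / p → lowerCheck st x S b L ps (a * p) = true) ∧
        (x / p < a → upperCheck b ps (a * p) = true) := by
      intro a ha ha0 haj
      have := allBelow_spec h a ha
      rw [force_eq] at this
      have e1 : Nat.beq a (x / p) = false := by
        cases h : Nat.beq a (x / p) with
        | true => exact absurd (Nat.eq_of_beq_eq_true h) haj
        | false => rfl
      have e2 : Nat.beq a 0 = false := by
        cases h : Nat.beq a 0 with
        | true => exact absurd (Nat.eq_of_beq_eq_true h) ha0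
        | false => rfl
      constructor
      · intro hlt
        have e3 : Nat.ble a (x / p) = true := Nat.ble_eq_true_of_le hlt.le
        change cond (Nat.ble a (x / p)) (cond (Nat.beq a (x / p)) true (cond (Nat.beq a 0) true
          (lowerCheck st x S b L ps (a * p)))) (upperCheck b ps (a * p)) = true at this
        rwa [e3, e1, e2] at this
      · intro hlt
        have e3 : Nat.ble a (x / p) = false := by
          cases h : Nat.ble a (x / p) with
          | true => exact absurd (Nat.le_of_ble_eq_true h) (not_le.2 hlt)
          | false => rfl
        change cond (Nat.ble a (x / p)) (cond (Nat.beq a (x / p)) true (cond (Nat.beq a 0) true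
          (lowerCheck st x S b L ps (a * p)))) (upperCheck b ps (a * p)) = true at this
        rwa [e3] at this
    constructor
    · intro N hU
      obtain ⟨a, h1, h2, h3, h4⟩ := hU p hp hpx hpS
      refine upperCheck_spec ((hall a h2 (by omega) (by omega)).2 h1) ?_ h3 h4
      intro r hr
      obtain ⟨hr1, hr2, hr3⟩ := hps r hr
      obtain ⟨a', -, -, h5, h6⟩ := hU r hr1 hr2 hr3
      exact ⟨a', h5, h6⟩
    · intro M hU
      obtain ⟨h1, h2, h3⟩ := hU.1 p hp hpx hpS
      have hd := Nat.div_add_mod M p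
      rw [mul_comm] at hd
      refine lowerCheck_spec hst hL ((hall (M / p) (by omega) (by omega) (by omega)).1 h2) ?_ hU.2
        (by omega) (by omega)
      intro r hr
      obtain ⟨hr1, hr2, hr3⟩ := hps r hr
      exact (hU.1 r hr1 hr2 hr3).2.2

theorem factorial_stages (x y z : ℕ) :
    ∀ a ∈ [(x, descFac x x), (y, descFac y y), (z, descFac z z)], a.2 = a.1.factorial := by
  simp [Nat.descFactorial_self]

theorem withStages_spec {k : List (ℕ × ℕ) → Bool} (h : withStages k = true) :
    ∃ st : List (ℕ × ℕ), (∀ a ∈ st, a.2 = a.1.factorial) ∧ k st = true := by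
  rw [withStages, force_eq, force_eq, force_eq] at h
  exact ⟨_, factorial_stages _ _ _, h⟩

def primesBelowThousand : List ℕ :=
  [2, 3, 5, 7, 11, 13, 17, 19, 23, 29, 31, 37, 41, 43, 47, 53, 59, 61, 67, 71, 73, 79, 83, 89,
    97, 101, 103, 107, 109, 113, 127, 131, 137, 139, 149, 151, 157, 163, 167, 173, 179, 181,
    191, 193, 197, 199, 211, 223, 227, 229, 233, 239, 241, 251, 257, 263, 269, 271, 277, 281,
    283, 293, 307, 311, 313, 317, 331, 337, 347, 349, 353, 359, 367, 373, 379, 383, 389, 397,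
    401, 409, 419, 421, 431, 433, 439, 443, 449, 457, 461, 463, 467, 479, 487, 491, 499, 503,
    509, 521, 523, 541, 547, 557, 563, 569, 571, 577, 587, 593, 599, 601, 607, 613, 617, 619,
    631, 641, 643, 647, 653, 659, 661, 673, 677, 683, 691, 701, 709, 719, 727, 733, 739, 743,
    751, 757, 761, 769, 773, 787, 797, 809, 811, 821, 823, 827, 829, 839, 853, 857, 859, 863,
    877, 881, 883, 887, 907, 911, 919, 929, 937, 941, 947, 953, 967, 971, 977, 983, 991, 997]

theorem primesBelowThousand_check : allBelow 1001 (fun q => cond (Nat.ble q 1) true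
    (anyMem primesBelowThousand fun p => cond (Nat.beq p q) true
      (cond (Nat.ble q p) false (Nat.beq (Nat.mod q p) 0)))) = true := by decide +kernel

theorem windowCheck_small : withStages (fun st => allBelow 838 fun i =>
    force (Nat.add 523 i) fun x => cond (windowCheck st 14 18 70 x)
      (cond (windowCheck st 19 25 91 x) (windowCheck st 26 33 113 x) false) false) = true := by
  decide +kernel

theorem windowCheck_le_5399 : withStages (fun st =>
    testSurvivors 5399 1361 14 143 1000 primesBelowThousand (List.range' 2 100) fun x =>
      cond (windowCheck st 14 18 89 x) (windowCheck st 19 25 118 x) false) = true := by decide +kernel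

theorem windowCheck_le_20000 : withStages (fun st =>
    testSurvivors 20000 5400 14 164 1000 primesBelowThousand (List.range' 2 100) fun x =>
      cond (windowCheck st 14 18 105 x) (windowCheck st 19 25 139 x) false) = true := by decide +kernel

theorem windowCheck_le_150000 : withStages (fun st =>
    testSurvivors 150000 20001 14 235 2000 primesBelowThousand (List.range' 2 100) fun x =>
      cond (windowCheck st 14 18 156 x) (windowCheck st 19 25 210 x) false) = true := by decide +kernel

theorem windowCheck_le_1000000 : withStages (fun st =>
    testSurvivors 1000000 150001 14 235 4000 primesBelowThousand (List.range' 2 150) fun x =>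
      cond (windowCheck st 14 18 156 x) (windowCheck st 19 25 210 x) false) = true := by decide +kernel

theorem windowCheck_long_le_5399 : withStages (fun st =>
    testSurvivors 5399 1361 26 181 200 primesBelowThousand (List.range' 2 60) fun x =>
      windowCheck st 26 33 148 x) = true := by decide +kernel

theorem windowCheck_long_le_20000 : withStages (fun st =>
    testSurvivors 20000 5400 26 308 200 primesBelowThousand (List.range' 2 60) fun x =>
      windowCheck st 26 51 257 x) = true := by decide +kernel

theorem windowCheck_long_le_1000000 : withStages (fun st =>
    testSurvivors 1000000 20001 26 936 1000 primesBelowThousand (List.range' 2 60) fun x =>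
      cond (windowCheck st 26 40 322 x) (windowCheck st 41 113 823 x) false) = true := by decide +kernel

theorem primeGaps_check : cond (testGaps 1360 primesBelowThousand 28 522 14)
    (cond (testGaps 1360 primesBelowThousand 523 1360 34)
    (cond (testGaps 1800 primesBelowThousand 1361 1799 24)
    (cond (testGaps 5400 primesBelowThousand 1800 5399 30)
    (cond (testGaps 26000 primesBelowThousand 5400 25999 52)
      (testGaps 1000000 primesBelowThousand 26000 1000000 114)
    false) false) false) false) false = true := by decide +kernel

theorem chooseLt_rows : allMem
    [(1360, 18, 70), (1360, 25, 91), (1360, 33, 113), (5399, 18, 89), (5399, 25, 118),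
      (5399, 33, 148), (20000, 18, 105), (20000, 25, 139), (20000, 51, 257), (1000000, 18, 156),
      (1000000, 25, 210), (1000000, 40, 322), (1000000, 113, 823)]
    (fun a => chooseLt a.1 a.2.1 (2 * a.2.2) a.2.2) = true := by decide +kernel

theorem mem_primesBelowThousand (q : ℕ) (hq : q.Prime) (h : q ≤ 1000) :
    q ∈ primesBelowThousand := by
  have := allBelow_spec primesBelowThousand_check q (by omega)
  rcases of_cond_true this with h1 | h1
  · exact absurd (Nat.le_of_ble_eq_true h1) (not_le.2 hq.one_lt)
  · obtain ⟨p, hp, h1⟩ := anyMem_spec h1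
    rcases of_cond_true h1 with h1 | h1
    · rwa [← Nat.eq_of_beq_eq_true h1]
    · cases hb : Nat.ble q p with
      | true => rw [hb] at h1; exact absurd h1 (by simp)
      | false =>
        rw [hb] at h1
        have hd : p ∣ q := Nat.dvd_of_mod_eq_zero (Nat.eq_of_beq_eq_true h1)
        have hlt : p < q := by
          by_contra hcon
          have := Nat.ble_eq_true_of_le (not_lt.1 hcon)
          rw [hb] at this
          exact absurd this (by simp)
        rcases (Nat.dvd_prime hq).1 hd with rfl | rfl
        · exfalso
          revert hp
          decide
        · omega

theorem HasPrimeMultiple.mono {S T x j : ℕ} (hST : S ≤ T) (h : HasPrimeMultiple S x j) :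
    HasPrimeMultiple T x j := by
  obtain ⟨p, hp, h1, h2⟩ := h
  exact ⟨p, hp, h1, by omega⟩

theorem HasPair.mono {S T x c : ℕ} (hST : S ≤ T) (h : HasPair S c x) : HasPair T c x := by
  obtain ⟨i, j, h1, h2, h3, h4⟩ := h
  exact ⟨i, j, h1, h2, h3.mono hST, h4.mono hST⟩

/-- `x` can be the larger number of a collision neither for rows in `[S, b]` nor for widths
in `[S, b]`. -/
def Excluded (S b L x : ℕ) : Prop := (∀ N, ¬ Upper x N S b) ∧ ∀ M, ¬ Lower x M S b L

theorem excluded_of_or {T S b L c x : ℕ} {st : List (ℕ × ℕ)}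
    (hst : ∀ a ∈ st, a.2 = a.1.factorial) (hTS : T ≤ S) (hSb : S ≤ b) (hbL : b ≤ L)
    (hx : 2 * S ≤ x) (hb : 4 * b < c) (hc : L + b ≤ c) (hL : 0 < L)
    (h : HasPrimeMultiple T x 1 ∨ HasPair T c x ∨ windowCheck st S b L x = true) :
    Excluded S b L x := by
  rcases h with h | h | h
  · exact ⟨fun _ => (h.mono hTS).not_upper hx, fun _ => (h.mono hTS).not_lower hx⟩
  · exact ⟨fun _ => (h.mono hTS).not_upper hx hSb hb, fun _ => (h.mono hTS).not_lower hx hSb hc hbL⟩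
  · exact windowCheck_spec hst hx hL h

theorem range_ne_zero (n : ℕ) : ∀ j ∈ List.range' 2 n, j ≠ 0 := by
  intro j hj
  have := (List.mem_range'_1.1 hj).1
  omega

theorem excluded_pair {N W T c PL J S b L S' b' L' x : ℕ}
    (h : withStages (fun st => testSurvivors N W T c PL primesBelowThousand (List.range' 2 J)
      fun x => cond (windowCheck st S b L x) (windowCheck st S' b' L' x) false) = true)
    (hN : N ≤ 1000000) (hW : W ≤ x) (hxN : x ≤ N) (hT : T ≠ 0)
    (hS : T ≤ S ∧ S ≤ b ∧ b ≤ L ∧ 2 * S ≤ W ∧ 4 * b < c ∧ L + b ≤ c)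
    (hS' : T ≤ S' ∧ S' ≤ b' ∧ b' ≤ L' ∧ 2 * S' ≤ W ∧ 4 * b' < c ∧ L' + b' ≤ c) :
    Excluded S b L x ∧ Excluded S' b' L' x := by
  obtain ⟨st, hst, h⟩ := withStages_spec h
  have := testSurvivors_spec mem_primesBelowThousand hN hT (range_ne_zero J) h hW hxN
  refine ⟨excluded_of_or hst hS.1 hS.2.1 hS.2.2.1 (by omega) hS.2.2.2.2.1 hS.2.2.2.2.2 (by omega)
    (this.imp_right fun h => h.imp_right fun h => (of_cond_false h).1),
    excluded_of_or hst hS'.1 hS'.2.1 hS'.2.2.1 (by omega) hS'.2.2.2.2.1 hS'.2.2.2.2.2 (by omega)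
    (this.imp_right fun h => h.imp_right fun h => (of_cond_false h).2)⟩

theorem excluded_single {N W T c PL J S b L x : ℕ}
    (h : withStages (fun st => testSurvivors N W T c PL primesBelowThousand (List.range' 2 J)
      fun x => windowCheck st S b L x) = true)
    (hN : N ≤ 1000000) (hW : W ≤ x) (hxN : x ≤ N) (hT : T ≠ 0)
    (hS : T ≤ S ∧ S ≤ b ∧ b ≤ L ∧ 2 * S ≤ W ∧ 4 * b < c ∧ L + b ≤ c) : Excluded S b L x := by
  obtain ⟨st, hst, h⟩ := withStages_spec h
  have := testSurvivors_spec mem_primesBelowThousand hN hT (range_ne_zero J) h hW hxN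
  exact excluded_of_or hst hS.1 hS.2.1 hS.2.2.1 (by omega) hS.2.2.2.2.1 hS.2.2.2.2.2 (by omega) this

theorem excluded_small {x : ℕ} (h1 : 523 ≤ x) (h2 : x ≤ 1360) :
    Excluded 14 18 70 x ∧ Excluded 19 25 91 x ∧ Excluded 26 33 113 x := by
  obtain ⟨st, hst, h⟩ := withStages_spec windowCheck_small
  have := allBelow_spec h (x - 523) (by omega)
  rw [force_eq, show Nat.add 523 (x - 523) = x from Nat.add_sub_cancel' h1] at this
  obtain ⟨h3, h4⟩ := of_cond_false this
  obtain ⟨h4, h5⟩ := of_cond_false h4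
  exact ⟨windowCheck_spec hst (by omega) (by omega) h3,
    windowCheck_spec hst (by omega) (by omega) h4, windowCheck_spec hst (by omega) (by omega) h5⟩

theorem lt_of_hasPrimeMultiple {S T x : ℕ} (h : HasPrimeMultiple S x 1)
    (h' : ¬ HasPrimeMultiple T x 1) : T < S := by
  by_contra hcon
  exact h' (h.mono (not_lt.1 hcon))

/-- An upper bound, in terms of `x`, for the length of a prime-free interval ending at `x`. -/
theorem hasPrimeMultiple_one {x : ℕ} (h1 : 28 ≤ x) (h2 : x ≤ 1000000) :
    (x ≤ 522 ∧ HasPrimeMultiple 14 x 1) ∨ (523 ≤ x ∧ x ≤ 1360 ∧ HasPrimeMultiple 34 x 1) ∨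
    (1361 ≤ x ∧ x ≤ 1799 ∧ HasPrimeMultiple 24 x 1) ∨
    (1800 ≤ x ∧ x ≤ 5399 ∧ HasPrimeMultiple 30 x 1) ∨
    (5400 ≤ x ∧ x ≤ 25999 ∧ HasPrimeMultiple 52 x 1) ∨
    (26000 ≤ x ∧ HasPrimeMultiple 114 x 1) := by
  obtain ⟨g0, h⟩ := of_cond_false primeGaps_check
  obtain ⟨g1, h⟩ := of_cond_false h
  obtain ⟨g2, h⟩ := of_cond_false h
  obtain ⟨g3, h⟩ := of_cond_false h
  obtain ⟨g4, g5⟩ := of_cond_false h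
  have key {N lo hi δ : ℕ} (h : testGaps N primesBelowThousand lo hi δ = true)
      (hN : N ≤ 1000000) (hδ : δ ≠ 0) (h1 : lo ≤ x) (h2 : x ≤ hi) : HasPrimeMultiple δ x 1 :=
    testGaps_spec mem_primesBelowThousand hN hδ h h1 h2
  have k0 := key g0 (by norm_num) (by norm_num)
  have k1 := key g1 (by norm_num) (by norm_num)
  have k2 := key g2 (by norm_num) (by norm_num)
  have k3 := key g3 (by norm_num) (by norm_num)
  have k4 := key g4 (by norm_num) (by norm_num)
  have k5 := key g5 (by norm_num) (by norm_num)
  by_cases c0 : x ≤ 522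
  · exact Or.inl ⟨c0, k0 h1 c0⟩
  by_cases c1 : x ≤ 1360
  · exact Or.inr (Or.inl ⟨by omega, c1, k1 (by omega) c1⟩)
  by_cases c2 : x ≤ 1799
  · exact Or.inr (Or.inr (Or.inl ⟨by omega, c2, k2 (by omega) c2⟩))
  by_cases c3 : x ≤ 5399
  · exact Or.inr (Or.inr (Or.inr (Or.inl ⟨by omega, c3, k3 (by omega) c3⟩)))
  by_cases c4 : x ≤ 25999
  · exact Or.inr (Or.inr (Or.inr (Or.inr (Or.inl ⟨by omega, c4, k4 (by omega) c4⟩))))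
  · exact Or.inr (Or.inr (Or.inr (Or.inr (Or.inr ⟨by omega, k5 (by omega) h2⟩))))

theorem choose_lt_choose_of_mem {X b L x : ℕ} (h : (X, b, L) ∈
    [(1360, 18, 70), (1360, 25, 91), (1360, 33, 113), (5399, 18, 89), (5399, 25, 118),
      (5399, 33, 148), (20000, 18, 105), (20000, 25, 139), (20000, 51, 257), (1000000, 18, 156),
      (1000000, 25, 210), (1000000, 40, 322), (1000000, 113, 823)]) (hx : x ≤ X) :
    x.choose b < (2 * L).choose L :=
  (Nat.choose_le_choose b hx).trans_lt (chooseLt_spec (allMem_spec chooseLt_rows _ h))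

/-- Every prime-free interval `(x - T, x]` with `14 ≤ T` is covered by some row. -/
theorem exists_excluded {x T : ℕ} (h1 : 28 ≤ x) (h2 : x ≤ 1000000) (hT : 14 ≤ T)
    (h : ¬ HasPrimeMultiple T x 1) : ∃ S b L, S ≤ T ∧ T ≤ b ∧ b ≤ x / 2 ∧ b ≤ L ∧
      x.choose b < (2 * L).choose L ∧ Excluded S b L x := by
  have key {S b L X : ℕ} (he : Excluded S b L x) (hS : S ≤ T) (hb : T ≤ b) (hb' : b ≤ x / 2)
      (hL : b ≤ L) (hmem : (X, b, L) ∈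
        [(1360, 18, 70), (1360, 25, 91), (1360, 33, 113), (5399, 18, 89), (5399, 25, 118),
        (5399, 33, 148), (20000, 18, 105), (20000, 25, 139), (20000, 51, 257), (1000000, 18, 156),
        (1000000, 25, 210), (1000000, 40, 322), (1000000, 113, 823)]) (hX : x ≤ X) :
      ∃ S b L, S ≤ T ∧ T ≤ b ∧ b ≤ x / 2 ∧ b ≤ L ∧
        x.choose b < (2 * L).choose L ∧ Excluded S b L x :=
    ⟨S, b, L, hS, hb, hb', hL, choose_lt_choose_of_mem hmem hX, he⟩
  have hgap : 523 ≤ x ∧ (x ≤ 1360 ∧ T < 34 ∨ 1361 ≤ x ∧ x ≤ 5399 ∧ T < 30 ∨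
      5400 ≤ x ∧ x ≤ 20000 ∧ T < 52 ∨ 20001 ≤ x ∧ T < 114) := by
    rcases hasPrimeMultiple_one h1 h2 with h3 | h3 | h3 | h3 | h3 | h3
    · have := lt_of_hasPrimeMultiple h3.2 h
      omega
    all_goals
      have := lt_of_hasPrimeMultiple (by tauto) h
      omega
  obtain ⟨hx, ⟨h3, h4⟩ | ⟨h5, h3, h4⟩ | ⟨h5, h3, h4⟩ | ⟨h5, h4⟩⟩ := hgap
  · obtain ⟨e1, e2, e3⟩ := excluded_small hx h3
    by_cases hT1 : T ≤ 18
    · exact key e1 (by omega) hT1 (by omega) (by omega) (by simp) h3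
    by_cases hT2 : T ≤ 25
    · exact key e2 (by omega) hT2 (by omega) (by omega) (by simp) h3
    · exact key e3 (by omega) (by omega) (by omega) (by omega) (by simp) h3
  · obtain ⟨e1, e2⟩ := excluded_pair windowCheck_le_5399 (by omega) h5 h3 (by omega) (by omega)
      (by omega)
    have e3 := excluded_single windowCheck_long_le_5399 (by omega) h5 h3 (by omega) (by omega)
    by_cases hT1 : T ≤ 18
    · exact key e1 (by omega) hT1 (by omega) (by omega) (by simp) h3
    by_cases hT2 : T ≤ 25
    · exact key e2 (by omega) hT2 (by omega) (by omega) (by simp) h3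
    · exact key e3 (by omega) (by omega) (by omega) (by omega) (by simp) h3
  · obtain ⟨e1, e2⟩ := excluded_pair windowCheck_le_20000 (by omega) h5 h3 (by omega) (by omega)
      (by omega)
    have e3 := excluded_single windowCheck_long_le_20000 (by omega) h5 h3 (by omega) (by omega)
    by_cases hT1 : T ≤ 18
    · exact key e1 (by omega) hT1 (by omega) (by omega) (by simp) h3
    by_cases hT2 : T ≤ 25
    · exact key e2 (by omega) hT2 (by omega) (by omega) (by simp) h3
    · exact key e3 (by omega) (by omega) (by omega) (by omega) (by simp) h3
  · have e : Excluded 14 18 156 x ∧ Excluded 19 25 210 x := by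
      rcases le_or_gt x 150000 with h6 | h6
      · exact excluded_pair windowCheck_le_150000 (by omega) h5 h6 (by omega) (by omega) (by omega)
      · exact excluded_pair windowCheck_le_1000000 (by omega) h6 h2 (by omega) (by omega) (by omega)
    obtain ⟨e1, e2⟩ := e
    obtain ⟨e3, e4⟩ := excluded_pair windowCheck_long_le_1000000 (by omega) h5 h2 (by omega)
      (by omega) (by omega)
    by_cases hT1 : T ≤ 18
    · exact key e1 (by omega) hT1 (by omega) (by omega) (by simp) h2
    by_cases hT2 : T ≤ 25
    · exact key e2 (by omega) hT2 (by omega) (by omega) (by simp) h2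
    by_cases hT3 : T ≤ 40
    · exact key e3 (by omega) hT3 (by omega) (by omega) (by simp) h2
    · exact key e4 (by omega) (by omega) (by omega) (by omega) (by simp) h2

theorem Prime.dvd_descFactorial_iff {n k p : ℕ} (hp : p.Prime) :
    p ∣ n.descFactorial k ↔ ∃ i < k, p ∣ n - i := by
  rw [Nat.descFactorial_eq_prod_range, hp.prime.dvd_finsetProd_iff]
  simp

theorem dvd_choose_of_mod_lt {n k p : ℕ} (hp : p.Prime) (hkp : k < p) (h : n % p < k) :
    p ∣ n.choose k := by
  have h1 : p ∣ n.descFactorial k :=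
    (Prime.dvd_descFactorial_iff hp).2 ⟨n % p, h, Nat.dvd_sub_mod n⟩
  rw [Nat.descFactorial_eq_factorial_mul_choose] at h1
  refine (hp.dvd_mul.1 h1).resolve_left fun h2 => ?_
  have := (hp.dvd_factorial).1 h2
  omega

theorem mod_lt_of_dvd_choose {n k p : ℕ} (hp : p.Prime) (hkn : k ≤ n) (h : p ∣ n.choose k) :
    n % p < k ∧ p ≤ n := by
  have h1 : p ∣ n.descFactorial k := by
    rw [Nat.descFactorial_eq_factorial_mul_choose]
    exact h.mul_left _
  obtain ⟨i, hi, c, hc⟩ := (Prime.dvd_descFactorial_iff hp).1 h1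
  have hc0 : 0 < c := by
    rcases Nat.eq_zero_or_pos c with rfl | h
    · omega
    · exact h
  have hn : n = i + p * c := by omega
  refine ⟨?_, ?_⟩
  · rw [hn, Nat.add_mul_mod_self_left]
    exact (Nat.mod_le _ _).trans_lt hi
  · have := Nat.le_mul_of_pos_right p hc0
    omega

theorem choose_lt_choose_right {n k l : ℕ} (hkl : k < l) (hl : 2 * l ≤ n) :
    n.choose k < n.choose l := by
  induction l, hkl using Nat.le_induction with
  | base =>
    have h := Nat.choose_succ_right_eq n k
    have h0 : 0 < n.choose k := Nat.choose_pos (by omega)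
    by_contra! h1
    have : n.choose (k + 1) * (k + 1) ≤ n.choose k * (k + 1) := Nat.mul_le_mul_right _ h1
    have : n.choose k * (k + 1) < n.choose k * (n - k) := Nat.mul_lt_mul_of_pos_left (by omega) h0
    omega
  | succ l hkl ih =>
    refine (ih (by omega)).trans ?_
    have h := Nat.choose_succ_right_eq n l
    have h0 : 0 < n.choose l := Nat.choose_pos (by omega)
    by_contra! h1
    have : n.choose (l + 1) * (l + 1) ≤ n.choose l * (l + 1) := Nat.mul_le_mul_right _ h1
    have : n.choose l * (l + 1) < n.choose l * (n - l) := Nat.mul_lt_mul_of_pos_left (by omega) h0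
    omega

theorem choose_le_choose_right {n k l : ℕ} (hkl : k ≤ l) (hl : 2 * l ≤ n) :
    n.choose k ≤ n.choose l := by
  rcases hkl.eq_or_lt with rfl | h
  · rfl
  · exact (choose_lt_choose_right h hl).le

theorem lt_of_choose_eq {n k m l : ℕ} (hkl : k < l) (hl : 2 * l ≤ m)
    (heq : n.choose k = m.choose l) : m < n := by
  by_contra! h
  have := choose_lt_choose_right hkl hl
  have := Nat.choose_le_choose k h
  omega

theorem descFactorial_mul_eq {n k d e : ℕ} (h : 2 * k + 2 * e + d ≤ n)
    (heq : n.choose k = (n - d).choose (k + e)) :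
    n.descFactorial d * (k + e).descFactorial e = (n - k).descFactorial (d + e) := by
  have h1 := Nat.factorial_mul_descFactorial (n := n) (k := d) (by omega)
  have h2 := Nat.factorial_mul_descFactorial (n := k + e) (k := e) (by omega)
  have h3 := Nat.factorial_mul_descFactorial (n := n - k) (k := d + e) (by omega)
  have h4 := Nat.choose_mul_factorial_mul_factorial (n := n) (k := k) (by omega)
  have h5 := Nat.choose_mul_factorial_mul_factorial (n := n - d) (k := k + e) (by omega)
  rw [Nat.add_sub_cancel] at h2
  rw [show n - k - (d + e) = n - d - (k + e) by omega] at h3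
  rw [← heq] at h5
  have hpos : 0 < n.choose k * k.factorial * (n - d - (k + e)).factorial :=
    Nat.mul_pos (Nat.mul_pos (Nat.choose_pos (by omega)) (Nat.factorial_pos _))
      (Nat.factorial_pos _)
  refine Nat.eq_of_mul_eq_mul_left hpos ?_
  rw [← h4, ← h5, ← h2, ← h3] at h1
  linarith

theorem false_of_lt_sub {n k m l : ℕ} (hn : n ≤ 1000000) (hk : 14 ≤ k) (hkn : 2 * k ≤ n)
    (hkl : k < l) (hl : 2 * l ≤ m) (heq : n.choose k = m.choose l) (hd : m + k < n) : False := by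
  have hno : ¬ HasPrimeMultiple k n 1 := by
    rintro ⟨p, hp, h1, h2⟩
    have hmod := div_mod_of_le h1 h2 (by omega)
    have := dvd_choose_of_mod_lt (n := n) (k := k) hp (by omega) (by omega)
    rw [heq] at this
    have := mod_lt_of_dvd_choose hp (by omega) this
    omega
  obtain ⟨S, b, L, hS, hb, hb', hL, hch, -, hex⟩ := exists_excluded (by omega) hn hk hno
  have hlL : l < L := by
    have h1 : (2 * l).choose l ≤ m.choose l := Nat.choose_le_choose l hl
    have h2 : n.choose k ≤ n.choose b := choose_le_choose_right hb (by omega)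
    rw [← Nat.centralBinom_eq_two_mul_choose] at h1 hch
    exact Nat.centralBinom_strictMono.lt_iff_lt.1 (by omega)
  refine hex m ⟨fun p hp hpn hmod => ?_, fun q hq hLq hmod => ?_⟩
  · have hp0 := hp.pos
    have hn' := Nat.div_add_mod n p
    have hm' := Nat.div_add_mod m p
    rcases le_or_gt p k with hpk | hpk
    · have h1 : m % p < p := Nat.mod_lt _ hp0
      refine ⟨(Nat.one_le_div_iff hp0).2 (by omega), ?_, by omega⟩
      have : m + p ≤ n := by omega
      have := Nat.div_le_div_right (c := p) this
      rw [Nat.add_div_right _ hp0] at this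
      omega
    · have h1 := dvd_choose_of_mod_lt (n := n) (k := k) hp hpk (by omega)
      rw [heq] at h1
      obtain ⟨h2, h3⟩ := mod_lt_of_dvd_choose hp (by omega) h1
      refine ⟨(Nat.one_le_div_iff hp0).2 h3, ?_, by omega⟩
      by_contra! h4
      have := Nat.mul_le_mul_left p h4
      omega
  · have h1 := dvd_choose_of_mod_lt (n := m) (k := l) hq (by omega) (by omega)
    rw [← heq] at h1
    have := (mod_lt_of_dvd_choose hq (by omega) h1).1
    omega

/-- If a prime `w - y` divides the product of the numbers in `(w - S, w]`, then it also has
a multiple in `(n - d, n]` or in `(k, k + e]`. -/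
theorem exists_multiple {n k d e p : ℕ} (hp : p.Prime)
    (heq : n.descFactorial d * (k + e).descFactorial e = (n - k).descFactorial (d + e))
    (hpS : (n - k) % p < d + e) :
    (∃ i < d, p ∣ n - i) ∨ ∃ i, 1 ≤ i ∧ i ≤ e ∧ p ∣ k + i := by
  have h1 : p ∣ (n - k).descFactorial (d + e) :=
    (Prime.dvd_descFactorial_iff hp).2 ⟨_, hpS, Nat.dvd_sub_mod _⟩
  rw [← heq] at h1
  rcases hp.dvd_mul.1 h1 with h1 | h1
  · exact .inl ((Prime.dvd_descFactorial_iff hp).1 h1)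
  · obtain ⟨i, hi, h1⟩ := (Prime.dvd_descFactorial_iff hp).1 h1
    refine .inr ⟨e - i, by omega, by omega, ?_⟩
    rwa [show k + (e - i) = k + e - i by omega]

theorem gap_le_of_prime {n k d e y p : ℕ} (h : 2 * k + 2 * e + d ≤ n) (hdk : d ≤ k) (hd : 1 ≤ d)
    (hp : p.Prime) (heq : n.descFactorial d * (k + e).descFactorial e = (n - k).descFactorial (d + e))
    (hpy : p + y = n - k) (hyp : d + e ≤ p) (hy : y < d + e) : n ≤ 2 * k + 2 * y := by
  have hmod := (div_mod_of_le (x := n - k) (p := p) (S := d + e) (j := 1)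
    (by omega) (by omega) hyp).2
  rcases exists_multiple hp heq (by omega) with ⟨i, hi, c, hc⟩ | ⟨i, hi1, hi2, hc⟩
  · have : 2 ≤ c := by
      by_contra! hc2
      have : p * c ≤ p * 1 := Nat.mul_le_mul_left p (by omega)
      omega
    have := Nat.mul_le_mul_left p this
    omega
  · have := Nat.le_of_dvd (by omega) hc
    omega

theorem upper_of_eq {n k d e S b : ℕ} (h : 2 * k + 2 * e + d ≤ n) (hdk : d ≤ k) (hd : 1 ≤ d)
    (heq : n.descFactorial d * (k + e).descFactorial e = (n - k).descFactorial (d + e))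
    (hg : 2 * (d + e) ≤ n - 2 * k + 1) (hS : S ≤ d + e) (hb : d + e ≤ b) :
    Upper (n - k) n S b := by
  intro p hp hpw hmod
  set j := (n - k) / p with hj
  set y := (n - k) % p with hy
  have hp0 := hp.pos
  have hw : j * p + y = n - k := by rw [mul_comm]; exact Nat.div_add_mod _ _
  rcases exists_multiple hp heq (by omega) with ⟨i, hi, a, ha⟩ | ⟨i, hi1, hi2, c, hc⟩
  · rw [mul_comm] at ha
    refine ⟨a, ?_, ?_, by omega, by omega⟩
    · by_contra! haj
      have := Nat.mul_le_mul_right p haj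
      omega
    · by_contra! haj
      have := Nat.mul_le_mul_right p haj
      rw [mul_assoc] at this
      omega
  · rw [mul_comm] at hc
    refine ⟨c + j, ?_, ?_, ?_, ?_⟩
    · rcases Nat.eq_zero_or_pos c with rfl | hc0
      · omega
      · omega
    · have : c < j := by
        by_contra! hcj
        have := Nat.mul_le_mul_right p hcj
        omega
      omega
    all_goals
      rw [add_mul]
      omega

theorem choose_half_le (n : ℕ) : ∀ j k : ℕ, k + j = n / 2 →
    4 * (n - n / 2) * n.choose (n / 2) ≤
      4 * (n - n / 2) * n.choose k + (n - 2 * k) ^ 2 * n.choose (n / 2)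
  | 0, k, h => by
    obtain rfl : k = n / 2 := by omega
    omega
  | j + 1, k, h => by
    have ih := choose_half_le n j (k + 1) (by omega)
    obtain ⟨r, hr⟩ : ∃ r, n = 2 * (k + 1) + r := ⟨n - 2 * (k + 1), by omega⟩
    have h1 := Nat.choose_succ_right_eq n k
    have h2 := Nat.choose_le_middle (k + 1) n
    rw [show n - 2 * (k + 1) = r by omega] at ih
    rw [show n - 2 * k = r + 2 by omega]
    rw [show n - k = k + 1 + (r + 1) by omega] at h1
    obtain ⟨s, hs⟩ : ∃ s, k + 1 + (r + 1) = n - n / 2 + s := ⟨k + 1 + (r + 1) - (n - n / 2), by omega⟩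
    generalize n.choose (n / 2) = M at *
    generalize n.choose (k + 1) = b at *
    generalize n.choose k = a at *
    generalize n - n / 2 = w at *
    have hab : a ≤ b := by
      by_contra! hba
      nlinarith
    obtain ⟨c, rfl⟩ := Nat.exists_eq_add_of_le hab
    have h3 : (k + 1 + (r + 1)) * c = (a + c) * (r + 1) := by nlinarith
    have h4 : w * c ≤ M * (r + 1) := by
      have : (a + c) * (r + 1) ≤ M * (r + 1) := Nat.mul_le_mul_right _ h2
      rw [hs] at h3
      nlinarith
    nlinarith

theorem choose_pred_mul_le {n m l : ℕ} (h : m < n) :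
    m.choose l * n ≤ n.choose (n / 2) * (n - n / 2) := by
  obtain ⟨n, rfl⟩ : ∃ r, n = r + 1 := ⟨n - 1, by omega⟩
  have h1 : m.choose l ≤ n.choose ((n + 1) / 2) := by
    refine (Nat.choose_le_choose l (by omega : m ≤ n)).trans ((Nat.choose_le_middle l n).trans ?_)
    rcases Nat.even_or_odd' n with ⟨t, rfl | rfl⟩
    · rw [show 2 * t / 2 = (2 * t + 1) / 2 by omega]
    · rw [← Nat.choose_symm (by omega : (2 * t + 1) / 2 ≤ 2 * t + 1)]
      rw [show 2 * t + 1 - (2 * t + 1) / 2 = (2 * t + 1 + 1) / 2 by omega]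
  rw [← Nat.choose_mul_succ_eq]
  exact Nat.mul_le_mul_right _ h1

theorem le_gap_sq {n k m l : ℕ} (hkn : 2 * k ≤ n) (hn : 2 ≤ n) (h : m < n)
    (heq : n.choose k = m.choose l) : n ≤ (n - 2 * k) ^ 2 := by
  have h1 := choose_half_le n (n / 2 - k) k (by omega)
  have h2 := choose_pred_mul_le (l := l) h
  rw [← heq] at h2
  have hM : 0 < n.choose (n / 2) := Nat.choose_pos (by omega)
  have hw : n ^ 2 ≤ 4 * (n - n / 2) * (n / 2) + 1 ∧ n - n / 2 + n / 2 = n := by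
    rcases Nat.even_or_odd' n with ⟨t, rfl | rfl⟩
    · rw [show 2 * t / 2 = t by omega, show 2 * t - t = t by omega]
      exact ⟨by nlinarith, by omega⟩
    · rw [show (2 * t + 1) / 2 = t by omega, show 2 * t + 1 - t = t + 1 by omega]
      exact ⟨by nlinarith, by omega⟩
  generalize (n - 2 * k) ^ 2 = G at *
  generalize n.choose (n / 2) = M at *
  generalize n.choose k = a at *
  generalize n - n / 2 = w at *
  generalize n / 2 = t at *
  obtain ⟨hw1, hw2⟩ := hw
  have h3 : 4 * w * t ≤ G * n := by
    refine _root_.le_of_mul_le_mul_left (a := M) ?_ hM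
    have h4 : 4 * w * (a * n) ≤ 4 * w * (M * w) := Nat.mul_le_mul_left _ h2
    have h5 : 4 * w * M * n ≤ (4 * w * a + G * M) * n := Nat.mul_le_mul_right _ h1
    rw [← hw2] at h5 h4 ⊢
    nlinarith
  by_contra! h6
  have : (G + 1) * n ≤ n * n := Nat.mul_le_mul_right _ h6
  nlinarith

/-- `a * (k + j).descFactorial j ≠ b * (w - d).descFactorial j` for the next `c` values of `j`,
where `u = k + j` and `v = w - d - j`. -/
def noIdentity (c : ℕ) : ℕ → ℕ → ℕ → ℕ → Bool :=
  Nat.rec (motive := fun _ => ℕ → ℕ → ℕ → ℕ → Bool) (fun _ _ _ _ => true)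
    (fun _ r u v a b => force (Nat.succ u) fun u => force (Nat.mul a u) fun a =>
      force (Nat.mul b v) fun b => force (Nat.pred v) fun v =>
      cond (Nat.beq a b) false (r u v a b)) c

def gapCheck (w g : ℕ) : Bool :=
  force (Nat.sub w g) fun k => allBelow (Nat.succ g) fun d => force d fun d =>
    force (descFac (Nat.add w k) d) fun a => force (descFac w d) fun b =>
    force (Nat.sub w d) fun v =>
    noIdentity (Nat.shiftRight (Nat.sub g d) 1) k v a b

def nearCheck (P w : ℕ) : Bool :=
  Nat.rec (motive := fun _ => ℕ → Bool) (fun _ => false)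
    (fun _ r y => cond (Nat.beq (Nat.gcd P (Nat.sub w y)) 1)
      (cond (Nat.ble (Nat.succ (Nat.mul y (Nat.succ (Nat.mul 2 y)))) w) true
        (allBelow (Nat.succ (Nat.mul 2 y)) fun g => force g fun g =>
          cond (Nat.ble (Nat.mul 2 w) (Nat.mul g (Nat.succ g))) (gapCheck w g) true))
      (force (Nat.succ y) r)) 40 0

def nearCheckBelow (c : ℕ) : Bool :=
  force (descFac 36 36) fun P => allBelow c fun i => force (Nat.add 50 i) fun w => nearCheck P w

theorem nearCheckBelow_eq : nearCheckBelow 1311 = true := by decide +kernel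

theorem gapCheck_small : allBelow 36 (fun i => force (Nat.add 14 i) fun w =>
    allBelow (Nat.succ i) fun g => force g fun g => gapCheck w g) = true := by decide +kernel

theorem noIdentity_spec : ∀ {c u v a b : ℕ}, noIdentity c u v a b = true → ∀ j, 1 ≤ j → j ≤ c →
    a * (u + j).descFactorial j ≠ b * v.descFactorial j
  | 0, _, _, _, _, _ => by omega
  | c + 1, u, v, a, b, h => by
    change (force (Nat.succ u) fun u => force (Nat.mul a u) fun a => force (Nat.mul b v) fun b =>
      force (Nat.pred v) fun v => cond (Nat.beq a b) false (noIdentity c u v a b)) = true at h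
    simp only [force_eq, Nat.mul_eq, Nat.succ_eq_add_one, Nat.pred_eq_sub_one] at h
    cases h1 : Nat.beq (a * (u + 1)) (b * v) with
    | true => rw [h1] at h; exact absurd h (by simp)
    | false =>
      rw [h1] at h
      have h2 : a * (u + 1) ≠ b * v := Nat.ne_of_beq_eq_false h1
      have ih := noIdentity_spec (c := c) h
      rintro (_ | _ | j) hj1 hj2
      · omega
      · simpa using h2
      · have h3 := ih (j + 1) (by omega) (by omega)
        rw [show u + 1 + (j + 1) = u + (j + 1 + 1) by ring] at h3
        rw [Nat.descFactorial_succ _ (j + 1), show u + (j + 1 + 1) - (j + 1) = u + 1 by omega,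
          ← mul_assoc]
        rcases v with _ | v
        · simp only [mul_zero, Nat.zero_descFactorial_succ, zero_mul] at h3 ⊢
          exact h3
        · rw [Nat.succ_descFactorial_succ, ← mul_assoc]
          exact h3

theorem gapCheck_spec {w g d e : ℕ} (h : gapCheck w g = true) (he : 1 ≤ e)
    (hde : 2 * e + d ≤ g) : (w + (w - g)).descFactorial d * (w - g + e).descFactorial e ≠
      w.descFactorial (d + e) := by
  simp only [gapCheck, force_eq, descFac_eq] at h
  have h1 := noIdentity_spec (allBelow_spec h d (by simp only [Nat.succ_eq_add_one]; omega)) e he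
    (by
      have : Nat.shiftRight (Nat.sub g d) 1 = (g - d) / 2 := Nat.shiftRight_eq_div_pow _ 1
      rw [this]; omega)
  simp only [Nat.add_eq, Nat.sub_eq] at h1
  have h2 := Nat.descFactorial_mul_descFactorial (n := w) (k := d) (m := d + e) (by omega)
  rw [Nat.add_sub_cancel_left] at h2
  rw [← h2, mul_comm _ (w.descFactorial d)]
  exact h1

theorem prime_of_gcd_factorial {q : ℕ} (h2 : 2 ≤ q) (hq : q < 1369)
    (h : Nat.gcd (Nat.factorial 36) q = 1) : q.Prime := by
  by_contra hp
  have h3 := Nat.minFac_sq_le_self (by omega) hp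
  have h4 : q.minFac ≤ 36 := by nlinarith
  have hpr := Nat.minFac_prime (n := q) (by omega)
  have h5 : q.minFac ∣ Nat.gcd (Nat.factorial 36) q :=
    Nat.dvd_gcd (hpr.dvd_factorial.2 h4) (Nat.minFac_dvd q)
  rw [h] at h5
  exact hpr.one_lt.ne' (Nat.dvd_one.1 h5)

/-- Near `w` there is a prime `p` such that the gap between `p` and `w` is either small compared
with `w`, or small enough for a direct search. -/
def NearPrime (w p y : ℕ) : Prop := p.Prime ∧ p + y = w ∧
  (2 * y ^ 2 + y < w ∨ ∀ g ≤ 2 * y, 2 * w ≤ g ^ 2 + g → gapCheck w g = true)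

theorem nearCheck_spec {w : ℕ} (h1 : 50 ≤ w) (h2 : w < 1369)
    (h : nearCheck (Nat.factorial 36) w = true) : ∃ p y, NearPrime w p y := by
  unfold nearCheck at h
  have key : ∀ c y : ℕ, c + y = 40 → Nat.rec (motive := fun _ => ℕ → Bool) (fun _ => false)
    (fun _ r y => cond (Nat.beq (Nat.gcd (Nat.factorial 36) (Nat.sub w y)) 1)
      (cond (Nat.ble (Nat.succ (Nat.mul y (Nat.succ (Nat.mul 2 y)))) w) true
        (allBelow (Nat.succ (Nat.mul 2 y)) fun g => force g fun g =>
          cond (Nat.ble (Nat.mul 2 w) (Nat.mul g (Nat.succ g))) (gapCheck w g) true))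
      (force (Nat.succ y) r)) c y = true → ∃ p y, NearPrime w p y := by
    intro c
    induction c with
    | zero => intro y _ h; exact absurd h (by simp)
    | succ c ih =>
      intro y hy h
      dsimp only at h
      cases h3 : Nat.beq (Nat.gcd (Nat.factorial 36) (Nat.sub w y)) 1 with
      | false =>
        rw [h3, cond_false, force_eq] at h
        exact ih (y + 1) (by omega) h
      | true =>
        rw [h3, cond_true] at h
        have h4 := Nat.eq_of_beq_eq_true h3
        simp only [Nat.sub_eq] at h4
        refine ⟨w - y, y, prime_of_gcd_factorial (by omega) (by omega) h4, by omega, ?_⟩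
        rcases of_cond_true h with h5 | h5
        · left
          have := Nat.le_of_ble_eq_true h5
          simp only [Nat.succ_eq_add_one, Nat.mul_eq] at this
          rwa [show 2 * y ^ 2 + y = y * (2 * y + 1) by ring]
        · right
          intro g hg1 hg2
          have := allBelow_spec h5 g (by simp only [Nat.succ_eq_add_one, Nat.mul_eq]; omega)
          rw [force_eq, Nat.ble_eq_true_of_le, cond_true] at this
          · exact this
          · simp only [Nat.succ_eq_add_one, Nat.mul_eq]
            rwa [show g * (g + 1) = g ^ 2 + g by ring]
  exact key 40 0 rfl h

theorem exists_nearPrime {w : ℕ} (h1 : 50 ≤ w) (h2 : w ≤ 1000000) : ∃ p y, NearPrime w p y := by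
  rcases Nat.lt_or_ge w 1361 with h3 | h3
  · have h := nearCheckBelow_eq
    simp only [nearCheckBelow, force_eq, descFac_eq, Nat.descFactorial_self] at h
    have := allBelow_spec h (w - 50) (by omega)
    rw [Nat.add_eq, show 50 + (w - 50) = w by omega] at this
    exact nearCheck_spec h1 (by omega) this
  · have key {T : ℕ} (hT : 2 * (T - 1) ^ 2 + (T - 1) < w) (h : HasPrimeMultiple T w 1) :
        ∃ p y, NearPrime w p y := by
      obtain ⟨p, hp, h4, h5⟩ := h
      refine ⟨p, w - p, hp, by omega, .inl (lt_of_le_of_lt ?_ hT)⟩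
      have : w - p ≤ T - 1 := by omega
      gcongr
    rcases hasPrimeMultiple_one (by omega) h2 with h4 | h4 | h4 | h4 | h4 | h4
    · omega
    · omega
    · exact key (by norm_num; omega) h4.2.2
    · exact key (by norm_num; omega) h4.2.2
    · exact key (by norm_num; omega) h4.2.2
    · exact key (by norm_num; omega) h4.2

theorem false_of_gap_le {n k m l d e : ℕ} (hn : n ≤ 1000000) (h : 2 * k + 2 * e + d ≤ n)
    (hdk : d ≤ k) (hd : 1 ≤ d) (he : 1 ≤ e) (hw : 50 ≤ n - k) (hm : m < n)
    (heq : n.choose k = m.choose l)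
    (heq' : n.descFactorial d * (k + e).descFactorial e = (n - k).descFactorial (d + e))
    (hg : n + 2 ≤ 2 * k + 2 * (d + e)) : False := by
  obtain ⟨p, y, hp, hpy, hy⟩ := exists_nearPrime hw (by omega)
  have hgy : n ≤ 2 * k + 2 * y := by
    rcases Nat.lt_or_ge y (d + e) with h1 | h1
    · exact gap_le_of_prime h hdk hd hp heq' hpy (by omega) h1
    · omega
  have hsq := le_gap_sq (by omega) (by omega) hm heq
  obtain ⟨g, rfl⟩ : ∃ g, n = 2 * k + g := ⟨n - 2 * k, by omega⟩
  rw [Nat.add_sub_cancel_left] at hsq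
  rcases hy with hy | hy
  · have : g ^ 2 ≤ (2 * y) ^ 2 := Nat.pow_le_pow_left (by omega) 2
    rw [mul_pow] at this
    omega
  · have h1 := hy g (by omega) (by omega)
    refine gapCheck_spec h1 he (d := d) (by omega) ?_
    rw [show 2 * k + g - k + (2 * k + g - k - g) = 2 * k + g by omega,
      show 2 * k + g - k - g = k by omega]
    exact heq'

theorem false_of_sub_lt_fifty {n k d e : ℕ} (h : 2 * k + 2 * e + d ≤ n) (hk : 14 ≤ k)
    (he : 1 ≤ e) (hw : n - k < 50)
    (heq : n.descFactorial d * (k + e).descFactorial e = (n - k).descFactorial (d + e)) :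
    False := by
  have h1 := allBelow_spec gapCheck_small (n - k - 14) (by omega)
  rw [force_eq, Nat.add_eq, show 14 + (n - k - 14) = n - k by omega] at h1
  have h2 := allBelow_spec h1 (n - 2 * k) (by omega)
  rw [force_eq] at h2
  refine gapCheck_spec h2 he (d := d) (by omega) ?_
  rw [show n - k + (n - k - (n - 2 * k)) = n by omega, show n - k - (n - 2 * k) = k by omega]
  exact heq

theorem false_of_long {n k m l d e : ℕ} (hn : n ≤ 1000000) (h : 2 * k + 2 * e + d ≤ n)
    (hdk : d ≤ k) (hd : 1 ≤ d) (he : 1 ≤ e) (hw : 50 ≤ n - k) (hm : m < n)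
    (heq : n.choose k = m.choose l)
    (heq' : n.descFactorial d * (k + e).descFactorial e = (n - k).descFactorial (d + e))
    (hS : 14 ≤ d + e) : False := by
  have hg : ¬ n + 2 ≤ 2 * k + 2 * (d + e) := false_of_gap_le hn h hdk hd he hw hm heq heq'
  have hno : ¬ HasPrimeMultiple (d + e) (n - k) 1 := by
    rintro ⟨p, hp, h1, h2⟩
    have := gap_le_of_prime h hdk hd (y := n - k - p) hp heq' (by omega) (by omega) (by omega)
    omega
  obtain ⟨S, b, L, hS1, hb, -, -, -, hex, -⟩ := exists_excluded (by omega) (by omega) hS hno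
  exact hex n (upper_of_eq h hdk hd heq' (by omega) hS1 hb)

/-- Two consecutive Farey fractions `p / q` and `p' / q'` around the limit ratio, with bounds
for the coordinates in the lattice basis they define. -/
structure Cell where
  (p q p' q' : ℕ)
  lo : ℕ
  up : ℕ
  left : ℕ

/-- The numerical conditions on a cell that keep all solutions with `A₁ ≤ A` inside it. -/
def Cell.valid (c : Cell) (d e A₁ : ℕ) : Bool :=
  force (Nat.add d e) fun S => force c.p fun p => force c.q fun q => force c.p' fun p' =>
  force c.q' fun q' => force (Nat.add p q) fun a => force (Nat.add p' q') fun a' =>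
  force (Nat.add (Nat.mul d p) (Nat.mul e a)) fun W =>
  force (Nat.sub (Nat.mul 2 A₁) (Nat.pred S)) fun D₀ =>
  force (Nat.succ c.left) fun X =>
  force (Nat.div (Nat.mul p' A₁) q') fun K₁ =>
  force (Nat.sub (Nat.mul 2 (Nat.pred (Nat.add A₁ K₁))) (Nat.pred d)) fun D₁ =>
  force (Nat.sub (Nat.mul 2 K₁) (Nat.pred e)) fun D₂ =>
  force (Nat.mul (Nat.mul a' A₁) D₁) fun r => force (Nat.mul (Nat.mul p' A₁) D₂) fun s =>
  force (Nat.sub (Nat.add r (Nat.mul X D₁))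
    (Nat.mul q' (Nat.add D₁ (Nat.pow (Nat.pred d) 2)))) fun u =>
  force (Nat.sub (Nat.add s (Nat.mul X D₂)) (Nat.mul q' (Nat.pow (Nat.pred e) 2))) fun v =>
  cond (Nat.beq (Nat.mul p' q) (Nat.succ (Nat.mul p q')))
  (cond (Nat.ble (Nat.mul (Nat.pow a d) (Nat.pow p e)) (Nat.pow q S))
  (cond (Nat.ble (Nat.pow q' S) (Nat.mul (Nat.pow a' d) (Nat.pow p' e)))
  (cond (Nat.ble (Nat.succ (Nat.add (Nat.mul (Nat.mul D₀ c.lo) W)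
      (Nat.mul (Nat.mul S (Nat.pow (Nat.pred S) 2)) (Nat.mul a p))))
    (Nat.mul D₀ (Nat.add (Nat.mul (Nat.mul d p) q) (Nat.mul (Nat.succ c.up) W))))
  (cond (Nat.ble 1 (Nat.mul p (Nat.mul (Nat.mul D₁ D₂) (Nat.mul u v))))
  (cond (Nat.ble (Nat.pred e) D₂)
  (Nat.ble (Nat.mul (Nat.pow r d) (Nat.pow s e)) (Nat.mul (Nat.pow u d) (Nat.pow v e)))
  false) false) false) false) false) false

def noSolution (ex : List (ℕ × ℕ)) (d e S A K : ℕ) : Bool :=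
  cond (Nat.beq (Nat.mod (Nat.add A S) 2) 1)
    (cond (Nat.beq (Nat.mod (Nat.add K e) 2) 1)
      (force (Nat.shiftRight (Nat.pred (Nat.add A S)) 1) fun w =>
        force (Nat.shiftRight (Nat.pred (Nat.sub K e)) 1) fun k =>
        force (Nat.add w k) fun n => force (Nat.add k e) fun l =>
        cond (Nat.beq (Nat.mul (descFac n d) (descFac l e)) (descFac w S))
          (anyMem ex fun a => cond (Nat.beq n a.1) (Nat.beq k a.2) false) true)
      true) true

def Cell.search (c : Cell) (ex : List (ℕ × ℕ)) (d e A₁ A₂ : ℕ) : Bool :=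
  force (Nat.add d e) fun S => force c.p fun p => force c.q fun q => force c.p' fun p' =>
  force c.q' fun q' => force c.lo fun lo =>
  force (Nat.add (Nat.mul c.left q) (Nat.mul c.up q')) fun U =>
  force (Nat.add (Nat.mul c.left p) (Nat.mul c.up p')) fun V =>
  force (Nat.add A₁ U) fun B₁ => force (Nat.add A₂ U) fun B₂ =>
  allBelow (Nat.succ (Nat.div (Nat.sub B₂ (Nat.mul lo q')) q)) fun x =>
    force x fun x => force (Nat.mul x q) fun xq => force (Nat.mul x p) fun xp =>
    force (Nat.div (Nat.add (Nat.sub B₁ xq) (Nat.pred q')) q') fun y₁ =>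
    force (cond (Nat.ble y₁ lo) lo y₁) fun y₁ =>
    allBelow (Nat.sub (Nat.succ (Nat.div (Nat.sub B₂ xq) q')) y₁) fun i =>
      force (Nat.add y₁ i) fun y =>
      force (Nat.sub (Nat.add xq (Nat.mul y q')) U) fun A =>
      force (Nat.sub (Nat.add xp (Nat.mul y p')) V) fun K =>
      noSolution ex d e S A K

/-- Cells for the successive ranges `[A₁, 4 * A₁)`, up to two million. -/
def cellsCheck (ex : List (ℕ × ℕ)) (d e : ℕ) (l : List Cell) : ℕ → Bool :=
  List.rec (motive := fun _ => ℕ → Bool) (fun A₁ => Nat.ble 2000001 A₁)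
    (fun c _ r A₁ => cond (c.valid d e A₁)
      (force (cond (Nat.ble A₁ 500000) (Nat.mul 4 A₁) 2000001) fun A₂ => cond (c.search ex d e A₁ A₂) (r A₂) false) false) l

def tableCheck (ex : List (ℕ × ℕ)) (S : ℕ) (t : List (List Cell)) : ℕ → Bool :=
  List.rec (motive := fun _ => ℕ → Bool) (fun d => Nat.beq d S)
    (fun l _ r d => cond (cellsCheck ex d (Nat.sub S d) l 88) (force (Nat.succ d) r) false) t

def fibonacciPairs : List (ℕ × ℕ) :=
  [(104, 39), (714, 272), (4895, 1869), (33552, 12815), (229970, 87840), (1576239, 602069)]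

def tablesCheck (t : List (List (List Cell))) : ℕ → Bool :=
  List.rec (motive := fun _ => ℕ → Bool) (fun S => Nat.beq S 14)
    (fun l _ r S => cond (tableCheck (cond (Nat.beq S 2) fibonacciPairs []) S l 1)
      (force (Nat.succ S) r) false) t

def cellTables : List (List (List Cell)) :=
  [[[⟨144, 233, 89, 144, 64, 0, 39⟩, ⟨987, 1597, 610, 987, 440, 0, 273⟩, ⟨2584, 4181, 1597,
  2584, 1155, 0, 714⟩, ⟨17711, 28657, 10946, 17711, 7919, 0, 4895⟩, ⟨17711, 28657, 28657, 46368,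
  7921, 0, 12815⟩, ⟨317811, 514229, 196418, 317811, 142127, 0, 87841⟩, ⟨832040, 1346269, 514229,
  832040, 372098, 0, 229970⟩, ⟨832040, 1346269, 1346269, 2178309, 372100, 0, 602069⟩]], [[⟨271,
  359, 77, 102, 56, 0, 18⟩, ⟨1509, 1999, 619, 820, 344, 0, 146⟩, ⟨2128, 2819, 2747, 3639, 496,
  0, 645⟩, ⟨16753, 22193, 4875, 6458, 3922, 0, 1143⟩, ⟨117890, 156171, 48131, 63760, 27631, 0,
  11287⟩, ⟨358545, 474971, 48131, 63760, 84065, 0, 11286⟩, ⟨1417427, 1877691, 48131, 63760,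
  332359, 0, 11286⟩, ⟨1513689, 2005211, 48131, 63760, 354938, 0, 11286⟩], [⟨311, 668, 142, 305,
  247, 0, 119⟩, ⟨595, 1278, 142, 305, 491, 0, 118⟩, ⟨595, 1278, 1927, 4139, 495, 0, 1608⟩, ⟨595,
  1278, 12637, 27143, 497, 0, 10546⟩, ⟨67945, 145939, 27059, 58120, 56688, 0, 22580⟩, ⟨271185,
  582478, 149122, 320299, 226287, 0, 124439⟩, ⟨420307, 902777, 149122, 320299, 350732, 0,
  124438⟩, ⟨420307, 902777, 1410043, 3028630, 350736, 0, 1176647⟩]], [[⟨77, 94, 68, 83, 8, 0,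
  12⟩, ⟨376, 459, 299, 365, 55, 0, 49⟩, ⟨18116, 22115, 4435, 5414, 2820, 0, 714⟩, ⟨35856, 43771,
  4435, 5414, 5680, 0, 708⟩, ⟨58031, 70841, 4435, 5414, 9233, 0, 707⟩, ⟨196268, 239593, 66901,
  81669, 31258, 0, 10660⟩, ⟨459437, 560855, 263169, 321262, 73191, 0, 41929⟩, ⟨1182043, 1442972,
  722606, 882117, 188319, 0, 115126⟩], [⟨144, 233, 89, 144, 54, 0, 41⟩, ⟨987, 1597, 610, 987,
  424, 0, 274⟩, ⟨2584, 4181, 1597, 2584, 1144, 0, 715⟩, ⟨6765, 10946, 4181, 6765, 3018, 0,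
  1870⟩, ⟨17711, 28657, 10946, 17711, 7916, 0, 4895⟩, ⟨121393, 196418, 75025, 121393, 54280, 0,
  33553⟩, ⟨832040, 1346269, 514229, 832040, 372085, 0, 229971⟩, ⟨832040, 1346269, 514229,
  832040, 372096, 0, 229970⟩], [⟨829, 2180, 27, 71, 893, 0, 32⟩, ⟨1261, 3316, 27, 71, 1466, 0,
  32⟩, ⟨1288, 3387, 1315, 3458, 1524, 0, 1566⟩, ⟨9097, 23922, 2603, 6845, 10810, 0, 3098⟩,
  ⟨9097, 23922, 11700, 30767, 10822, 0, 13923⟩, ⟨48088, 126455, 38991, 102533, 57218, 0, 46398⟩,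
  ⟨48088, 126455, 327519, 861263, 57222, 0, 389733⟩, ⟨48088, 126455, 1385455, 3643273, 57223, 0,
  1648626⟩]], [[⟨257, 300, 6, 7, 5, 0, 1⟩, ⟨1046, 1221, 263, 307, 100, 0, 35⟩, ⟨1046, 1221,
  1309, 1528, 120, 0, 163⟩, ⟨1046, 1221, 9677, 11296, 125, 0, 1177⟩, ⟨51780, 60443, 25367,
  29611, 6231, 0, 3068⟩, ⟨180707, 210940, 128927, 150497, 21798, 0, 15572⟩, ⟨180707, 210940,
  309634, 361437, 21812, 0, 37384⟩, ⟨180707, 210940, 1032462, 1205197, 21815, 0, 124646⟩],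
  [⟨830, 1183, 87, 124, 155, 0, 30⟩, ⟨830, 1183, 87, 124, 231, 0, 27⟩, ⟨917, 1307, 1004, 1431,
  275, 0, 310⟩, ⟨3755, 5352, 2838, 4045, 1147, 0, 873⟩, ⟨24451, 34850, 10348, 14749, 7503, 0,
  3181⟩, ⟨233245, 332444, 34799, 49599, 71653, 0, 10695⟩, ⟨769333, 1096530, 268044, 382043,
  236404, 0, 82375⟩, ⟨1037377, 1478573, 268044, 382043, 318792, 0, 82373⟩], [⟨64, 121, 73, 138,
  32, 0, 49⟩, ⟨1069, 2021, 201, 380, 651, 0, 131⟩, ⟨2741, 5182, 1471, 2781, 1745, 0, 952⟩,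
  ⟨2741, 5182, 4212, 7963, 1764, 0, 2722⟩, ⟨59032, 111603, 56291, 106421, 38094, 0, 36363⟩,
  ⟨59032, 111603, 56291, 106421, 38120, 0, 36359⟩, ⟨464033, 877278, 289678, 547651, 299699, 0,
  187102⟩, ⟨464033, 877278, 289678, 547651, 299712, 0, 187101⟩], [⟨25, 77, 38, 117, 33, 0, 60⟩,
  ⟨201, 619, 88, 271, 295, 0, 135⟩, ⟨892, 2747, 691, 2128, 1348, 0, 1056⟩, ⟨1583, 4875, 2274,
  7003, 2408, 0, 3469⟩, ⟨15629, 48131, 7023, 21628, 23815, 0, 10709⟩, ⟨15629, 48131, 38281,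
  117890, 23825, 0, 58366⟩, ⟨15629, 48131, 335232, 1032379, 23828, 0, 511109⟩, ⟨15629, 48131,
  1241714, 3823977, 23829, 0, 1893157⟩]], [[⟨141, 160, 52, 59, 0, 8, 10⟩, ⟨527, 598, 193, 219,
  31, 0, 23⟩, ⟨2828, 3209, 2301, 2611, 248, 0, 239⟩, ⟨7957, 9029, 5129, 5820, 755, 0, 507⟩,
  ⟨65957, 74843, 29000, 32907, 6372, 0, 2831⟩, ⟨65957, 74843, 29000, 32907, 6402, 0, 2821⟩,
  ⟨292828, 332279, 226871, 257436, 28453, 0, 22058⟩, ⟨292828, 332279, 519699, 589715, 28462, 0,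
  50520⟩], [⟨271, 359, 77, 102, 15, 0, 24⟩, ⟨271, 359, 348, 461, 52, 0, 88⟩, ⟨2128, 2819, 619,
  820, 476, 0, 148⟩, ⟨21628, 28651, 4875, 6458, 5013, 0, 1148⟩, ⟨21628, 28651, 4875, 6458, 5057,
  0, 1144⟩, ⟨358545, 474971, 48131, 63760, 84013, 0, 11289⟩, ⟨1032379, 1367611, 48131, 63760,
  242036, 0, 11286⟩, ⟨2668833, 3535451, 48131, 63760, 625778, 0, 11286⟩], [⟨55, 89, 34, 55, 13,
  0, 16⟩, ⟨377, 610, 233, 377, 150, 0, 107⟩, ⟨987, 1597, 610, 987, 429, 0, 274⟩, ⟨6765, 10946,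
  4181, 6765, 3004, 0, 1873⟩, ⟨17711, 28657, 10946, 17711, 7907, 0, 4897⟩, ⟨121393, 196418,
  75025, 121393, 54265, 0, 33555⟩, ⟨317811, 514229, 196418, 317811, 142114, 0, 87843⟩, ⟨832040,
  1346269, 514229, 832040, 372090, 0, 229971⟩], [⟨27, 58, 61, 131, 16, 0, 53⟩, ⟨595, 1278, 142,
  305, 458, 0, 120⟩, ⟨595, 1278, 737, 1583, 487, 0, 617⟩, ⟨595, 1278, 4902, 10529, 495, 0,
  4094⟩, ⟨13827, 29699, 13232, 28421, 11525, 0, 11044⟩, ⟨122063, 262179, 27059, 58120, 101828,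
  0, 22581⟩, ⟨420307, 902777, 149122, 320299, 350710, 0, 124440⟩, ⟨420307, 902777, 149122,
  320299, 350730, 0, 124439⟩], [⟨79, 277, 2, 7, 113, 0, 3⟩, ⟨79, 277, 81, 284, 138, 0, 152⟩,
  ⟨79, 277, 634, 2223, 144, 0, 1174⟩, ⟨6484, 22735, 2135, 7486, 11917, 0, 3942⟩, ⟨15103, 52956,
  8619, 30221, 27830, 0, 15899⟩, ⟨69031, 242045, 53928, 189089, 127281, 0, 99461⟩, ⟨314949,
  1104313, 122959, 431134, 580800, 0, 226765⟩, ⟨191990, 673179, 122959, 431134, 354065, 0,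
  226762⟩]], [[⟨133, 148, 71, 79, 0, 19, 17⟩, ⟨133, 148, 204, 227, 4, 0, 24⟩, ⟨2403, 2674, 1135,
  1263, 163, 0, 103⟩, ⟨2403, 2674, 3538, 3937, 188, 0, 296⟩, ⟨67151, 74724, 32374, 36025, 5406,
  0, 2654⟩, ⟨293769, 326899, 32374, 36025, 23839, 0, 2639⟩, ⟨1760211, 1958720, 358517, 398949,
  143122, 0, 29184⟩, ⟨1401694, 1559771, 358517, 398949, 114028, 0, 29173⟩], [⟨430, 543, 137,
  173, 0, 26, 43⟩, ⟨1800, 2273, 137, 173, 232, 0, 30⟩, ⟨4129, 5214, 137, 173, 721, 0, 27⟩,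
  ⟨8395, 10601, 4266, 5387, 1561, 0, 817⟩, ⟨84361, 106529, 12661, 15988, 15923, 0, 2407⟩,
  ⟨763515, 964148, 97022, 122517, 144653, 0, 18416⟩, ⟨1539691, 1944284, 97022, 122517, 291978,
  0, 18407⟩, ⟨1636713, 2066801, 97022, 122517, 310449, 0, 18405⟩], [⟨59, 87, 19, 28, 4, 0, 8⟩,
  ⟨470, 693, 137, 202, 129, 0, 50⟩, ⟨5111, 7536, 1547, 2281, 1665, 0, 539⟩, ⟨15940, 23503, 1547,
  2281, 5399, 0, 532⟩, ⟨109093, 160854, 22128, 32627, 37298, 0, 7596⟩, ⟨197605, 291362, 22128,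
  32627, 67717, 0, 7590⟩, ⟨637071, 939340, 219733, 323989, 218445, 0, 75363⟩, ⟨637071, 939340,
  219733, 323989, 218477, 0, 75359⟩], [⟨121, 218, 5, 9, 30, 0, 3⟩, ⟨247, 445, 126, 227, 124, 0,
  75⟩, ⟨2848, 5131, 867, 1562, 1597, 0, 507⟩, ⟨8050, 14503, 867, 1562, 4636, 0, 504⟩, ⟨16967,
  30568, 8917, 16065, 9836, 0, 5182⟩, ⟨16967, 30568, 59818, 107769, 9852, 0, 34754⟩, ⟨756332,
  1362619, 246455, 444017, 439324, 0, 143179⟩, ⟨1988607, 3582704, 246455, 444017, 1155221, 0,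
  143176⟩], [⟨33, 79, 28, 67, 20, 0, 30⟩, ⟨216, 517, 61, 146, 197, 0, 63⟩, ⟨493, 1180, 277, 663,
  488, 0, 282⟩, ⟨2742, 6563, 2249, 5383, 2767, 0, 2286⟩, ⟨27697, 66293, 4991, 11946, 28077, 0,
  5069⟩, ⟨27697, 66293, 32688, 78239, 28111, 0, 33191⟩, ⟨365052, 873755, 337355, 807462, 370607,
  0, 342529⟩, ⟨365052, 873755, 337355, 807462, 370634, 0, 342523⟩], [⟨106, 415, 47, 184, 158, 0,
  113⟩, ⟨106, 415, 47, 184, 211, 0, 104⟩, ⟨1048, 4103, 471, 1844, 2214, 0, 1021⟩, ⟨1048, 4103,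
  1519, 5947, 2245, 0, 3275⟩, ⟨6759, 26462, 5711, 22359, 14530, 0, 12296⟩, ⟨19229, 75283, 12470,
  48821, 41371, 0, 26839⟩, ⟨159543, 624623, 70157, 274670, 343330, 0, 150990⟩, ⟨159543, 624623,
  70157, 274670, 343348, 0, 150986⟩]], [[⟨134, 147, 31, 34, 0, 32, 9⟩, ⟨464, 509, 165, 181, 0,
  2, 21⟩, ⟨2021, 2217, 1557, 1708, 104, 0, 131⟩, ⟨30645, 33617, 3578, 3925, 2002, 0, 263⟩,
  ⟨70003, 76792, 3578, 3925, 4817, 0, 253⟩, ⟨217165, 238226, 73581, 80717, 15131, 0, 5164⟩,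
  ⟨217165, 238226, 290746, 318943, 15179, 0, 20358⟩, ⟨217165, 238226, 290746, 318943, 15191, 0,
  20346⟩], [⟨77, 94, 68, 83, 0, 13, 23⟩, ⟨376, 459, 299, 365, 30, 0, 61⟩, ⟨376, 459, 1051, 1283,
  53, 0, 179⟩, ⟨44726, 54599, 4435, 5414, 6901, 0, 719⟩, ⟨62466, 76255, 4435, 5414, 9874, 0,
  709⟩, ⟨196268, 239593, 66901, 81669, 31208, 0, 10670⟩, ⟨459437, 560855, 263169, 321262, 73162,
  0, 41939⟩, ⟨459437, 560855, 263169, 321262, 73189, 0, 41930⟩], [⟨83, 115, 13, 18, 0, 7, 5⟩,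
  ⟨371, 514, 96, 133, 70, 0, 30⟩, ⟨2885, 3997, 838, 1161, 739, 0, 240⟩, ⟨2885, 3997, 3723, 5158,
  788, 0, 1045⟩, ⟨29317, 40617, 6608, 9155, 8123, 0, 1843⟩, ⟨812221, 1125285, 65242, 90389,
  225873, 0, 18175⟩, ⟨1073189, 1486841, 65242, 90389, 298726, 0, 18168⟩, ⟨942705, 1306063,
  65242, 90389, 262466, 0, 18166⟩], [⟨55, 89, 34, 55, 2, 0, 19⟩, ⟨377, 610, 233, 377, 131, 0,
  110⟩, ⟨987, 1597, 610, 987, 417, 0, 277⟩, ⟨6765, 10946, 4181, 6765, 2983, 0, 1877⟩, ⟨17711,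
  28657, 10946, 17711, 7893, 0, 4900⟩, ⟨46368, 75025, 28657, 46368, 20719, 0, 12818⟩, ⟨317811,
  514229, 196418, 317811, 142099, 0, 87846⟩, ⟨317811, 514229, 196418, 317811, 142122, 0,
  87842⟩], [⟨316, 625, 45, 89, 68, 0, 36⟩, ⟨496, 981, 45, 89, 293, 0, 33⟩, ⟨541, 1070, 586,
  1159, 368, 0, 419⟩, ⟨2750, 5439, 2209, 4369, 1932, 0, 1571⟩, ⟨23668, 46811, 10459, 20686,
  16755, 0, 7427⟩, ⟨257057, 508412, 44586, 88183, 182324, 0, 31648⟩, ⟨390815, 772961, 44586,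
  88183, 277331, 0, 31645⟩, ⟨390815, 772961, 44586, 88183, 277365, 0, 31644⟩], [⟨127, 334, 27,
  71, 71, 0, 36⟩, ⟨532, 1399, 27, 71, 552, 0, 33⟩, ⟨1288, 3387, 1315, 3458, 1484, 0, 1577⟩,
  ⟨9097, 23922, 2603, 6845, 10739, 0, 3103⟩, ⟨9097, 23922, 2603, 6845, 10804, 0, 3098⟩, ⟨48088,
  126455, 38991, 102533, 57194, 0, 46403⟩, ⟨48088, 126455, 135167, 355443, 57216, 0, 160847⟩,
  ⟨48088, 126455, 327519, 861263, 57221, 0, 389734⟩], [⟨42, 181, 13, 56, 61, 0, 37⟩, ⟨139, 599,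
  97, 418, 307, 0, 248⟩, ⟨375, 1616, 236, 1017, 897, 0, 584⟩, ⟨7374, 31777, 1597, 6882, 17961,
  0, 3924⟩, ⟨7374, 31777, 1597, 6882, 18044, 0, 3916⟩, ⟨61200, 263731, 8971, 38659, 149920, 0,
  21988⟩, ⟨61200, 263731, 70171, 302390, 149963, 0, 171968⟩, ⟨192571, 829852, 131371, 566121,
  471905, 0, 321941⟩]], [[⟨47, 51, 59, 64, 0, 16, 22⟩, ⟨1199, 1301, 576, 625, 0, 43, 80⟩, ⟨1775,
  1926, 576, 625, 66, 0, 46⟩, ⟨6477, 7028, 2351, 2551, 359, 0, 155⟩, ⟨6477, 7028, 15305, 16607,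
  388, 0, 957⟩, ⟨101857, 110522, 47690, 51747, 6213, 0, 2941⟩, ⟨251404, 272791, 149547, 162269,
  15406, 0, 9189⟩, ⟨7067571, 7668811, 400951, 435060, 433577, 0, 24614⟩], [⟨21, 25, 37, 44, 0,
  6, 14⟩, ⟨1345, 1601, 331, 394, 45, 0, 67⟩, ⟨1345, 1601, 331, 394, 150, 0, 50⟩, ⟨4366, 5197,
  3021, 3596, 572, 0, 427⟩, ⟨33583, 39975, 29217, 34778, 4559, 0, 4042⟩, ⟨33583, 39975, 62800,
  74753, 4600, 0, 8641⟩, ⟨163549, 194678, 129966, 154703, 22448, 0, 17859⟩, ⟨1404775, 1672152,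
  620613, 738737, 192917, 0, 85253⟩], [⟨40, 53, 37, 49, 0, 9, 16⟩, ⟨271, 359, 77, 102, 33, 0,
  22⟩, ⟨2128, 2819, 619, 820, 440, 0, 153⟩, ⟨21628, 28651, 4875, 6458, 4920, 0, 1159⟩, ⟨21628,
  28651, 4875, 6458, 5034, 0, 1147⟩, ⟨310414, 411211, 48131, 63760, 72652, 0, 11295⟩, ⟨1369296,
  1813931, 48131, 63760, 320932, 0, 11288⟩, ⟨1946868, 2579051, 48131, 63760, 456462, 0, 11286⟩],
  [⟨137, 206, 139, 209, 0, 21, 74⟩, ⟨137, 206, 139, 209, 33, 0, 56⟩, ⟨550, 827, 413, 621, 184,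
  0, 154⟩, ⟨9213, 13853, 8663, 13026, 3284, 0, 3177⟩, ⟨9213, 13853, 8663, 13026, 3337, 0, 3160⟩,
  ⟨449787, 676316, 146858, 220821, 163558, 0, 53497⟩, ⟨1330935, 2001242, 146858, 220821, 484455,
  0, 53479⟩, ⟨1330935, 2001242, 146858, 220821, 484576, 0, 53474⟩], [⟨37, 65, 41, 72, 0, 1, 28⟩,
  ⟨193, 339, 78, 137, 79, 0, 45⟩, ⟨1507, 2647, 657, 1154, 773, 0, 365⟩, ⟨1507, 2647, 2164, 3801,
  813, 0, 1190⟩, ⟨1507, 2647, 17234, 30271, 823, 0, 9453⟩, ⟨1507, 2647, 217665, 382322, 826, 0,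
  119312⟩, ⟨654695, 1149952, 653188, 1147305, 358690, 0, 357976⟩, ⟨654695, 1149952, 653188,
  1147305, 358758, 0, 357959⟩], [⟨27, 58, 34, 73, 4, 0, 33⟩, ⟨595, 1278, 142, 305, 397, 0, 123⟩,
  ⟨595, 1278, 142, 305, 472, 0, 119⟩, ⟨595, 1278, 2522, 5417, 491, 0, 2110⟩, ⟨13827, 29699,
  13232, 28421, 11503, 0, 11049⟩, ⟨122063, 262179, 27059, 58120, 101780, 0, 22584⟩, ⟨420307,
  902777, 149122, 320299, 350668, 0, 124444⟩, ⟨420307, 902777, 149122, 320299, 350719, 0,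
  124440⟩], [⟨148, 423, 7, 20, 69, 0, 11⟩, ⟨345, 986, 176, 503, 395, 0, 249⟩, ⟨1577, 4507, 176,
  503, 2060, 0, 241⟩, ⟨12095, 34567, 1753, 5010, 16281, 0, 2389⟩, ⟨26119, 74647, 1753, 5010,
  35421, 0, 2384⟩, ⟨87122, 248991, 29625, 84667, 118366, 0, 40280⟩, ⟨87122, 248991, 116747,
  333658, 118421, 0, 158719⟩, ⟨290991, 831640, 203869, 582649, 395576, 0, 277154⟩], [⟨13, 61,
  16, 75, 18, 0, 54⟩, ⟨201, 943, 94, 441, 482, 0, 273⟩, ⟨201, 943, 94, 441, 534, 0, 261⟩, ⟨5696,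
  26723, 1099, 5156, 15494, 0, 3023⟩, ⟨6795, 31879, 1099, 5156, 18591, 0, 3015⟩, ⟨30477, 142984,
  7894, 37035, 83506, 0, 21644⟩, ⟨229127, 1074958, 99325, 465987, 628025, 0, 272293⟩, ⟨229127,
  1074958, 99325, 465987, 628082, 0, 272281⟩]], [[⟨343, 369, 66, 71, 0, 156, 31⟩, ⟨1267, 1363,
  66, 71, 0, 86, 10⟩, ⟨10704, 11515, 1795, 1931, 260, 0, 143⟩, ⟨10704, 11515, 1795, 1931, 504,
  0, 109⟩, ⟨10704, 11515, 12499, 13446, 565, 0, 702⟩, ⟨281960, 303323, 33907, 36476, 15278, 0,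
  1866⟩, ⟨349774, 376275, 33907, 36476, 19077, 0, 1856⟩, ⟨349774, 376275, 383681, 412751, 19108,
  0, 20980⟩], [⟨257, 300, 6, 7, 0, 108, 2⟩, ⟨1046, 1221, 263, 307, 0, 10, 54⟩, ⟨1046, 1221, 263,
  307, 93, 0, 37⟩, ⟨1046, 1221, 3401, 3970, 118, 0, 428⟩, ⟨51780, 60443, 25367, 29611, 6147, 0,
  3096⟩, ⟨51780, 60443, 25367, 29611, 6225, 0, 3070⟩, ⟨180707, 210940, 128927, 150497, 21793, 0,
  15575⟩, ⟨180707, 210940, 309634, 361437, 21810, 0, 37386⟩], [⟨57, 73, 25, 32, 0, 21, 12⟩,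
  ⟨196, 251, 139, 178, 13, 0, 38⟩, ⟨727, 931, 531, 680, 123, 0, 117⟩, ⟨18200, 23307, 3243, 4153,
  3530, 0, 671⟩, ⟨21443, 27460, 3243, 4153, 4298, 0, 660⟩, ⟨46129, 59073, 24686, 31613, 9320, 0,
  5007⟩, ⟨492462, 630649, 187759, 240445, 99698, 0, 38049⟩, ⟨492462, 630649, 187759, 240445,
  99748, 0, 38039⟩], [⟨47, 67, 40, 57, 0, 15, 22⟩, ⟨917, 1307, 87, 124, 143, 0, 31⟩, ⟨917, 1307,
  1004, 1431, 248, 0, 323⟩, ⟨3755, 5352, 2838, 4045, 1119, 0, 882⟩, ⟨24451, 34850, 10348, 14749,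
  7457, 0, 3189⟩, ⟨233245, 332444, 34799, 49599, 71543, 0, 10702⟩, ⟨1037377, 1478573, 268044,
  382043, 318647, 0, 82388⟩, ⟨1037377, 1478573, 268044, 382043, 318761, 0, 82377⟩], [⟨55, 89,
  34, 55, 0, 14, 22⟩, ⟨144, 233, 89, 144, 41, 0, 44⟩, ⟨987, 1597, 610, 987, 401, 0, 280⟩, ⟨2584,
  4181, 1597, 2584, 1129, 0, 719⟩, ⟨17711, 28657, 10946, 17711, 7875, 0, 4903⟩, ⟨46368, 75025,
  28657, 46368, 20707, 0, 12821⟩, ⟨317811, 514229, 196418, 317811, 142078, 0, 87850⟩, ⟨317811,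
  514229, 196418, 317811, 142117, 0, 87843⟩], [⟨64, 121, 9, 17, 0, 9, 7⟩, ⟨868, 1641, 201, 380,
  395, 0, 139⟩, ⟨1270, 2401, 201, 380, 760, 0, 132⟩, ⟨2741, 5182, 1471, 2781, 1738, 0, 954⟩,
  ⟨2741, 5182, 12435, 23509, 1763, 0, 8040⟩, ⟨59032, 111603, 56291, 106421, 38085, 0, 36368⟩,
  ⟨174355, 329627, 115323, 218024, 112583, 0, 74491⟩, ⟨464033, 877278, 289678, 547651, 299695,
  0, 187104⟩], [⟨147, 340, 16, 37, 2, 0, 18⟩, ⟨438, 1013, 227, 525, 319, 0, 229⟩, ⟨438, 1013,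
  227, 525, 394, 0, 219⟩, ⟨438, 1013, 2417, 5590, 413, 0, 2318⟩, ⟨9425, 21798, 8987, 20785,
  8976, 0, 8597⟩, ⟨83949, 194156, 37262, 86179, 80164, 0, 35622⟩, ⟨83949, 194156, 121211,
  280335, 80220, 0, 115858⟩, ⟨83949, 194156, 205160, 474491, 80233, 0, 196092⟩], [⟨25, 77, 13,
  40, 8, 0, 24⟩, ⟨201, 619, 88, 271, 248, 0, 142⟩, ⟨1583, 4875, 691, 2128, 2299, 0, 1068⟩,
  ⟨1583, 4875, 691, 2128, 2385, 0, 1057⟩, ⟨15629, 48131, 7023, 21628, 23758, 0, 10717⟩, ⟨15629,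
  48131, 22652, 69759, 23811, 0, 34543⟩, ⟨15629, 48131, 116426, 358545, 23824, 0, 177516⟩,
  ⟨15629, 48131, 507151, 1561820, 23828, 0, 773227⟩], [⟨47, 238, 16, 81, 51, 0, 64⟩, ⟨236, 1195,
  63, 319, 604, 0, 205⟩, ⟨803, 4066, 63, 319, 2337, 0, 194⟩, ⟨2535, 12836, 866, 4385, 7596, 0,
  2632⟩, ⟨5936, 30057, 3401, 17221, 17916, 0, 10301⟩, ⟨43284, 219169, 9337, 47278, 130869, 0,
  28255⟩, ⟨43284, 219169, 52621, 266447, 130928, 0, 159206⟩, ⟨43284, 219169, 95905, 485616,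
  130943, 0, 290146⟩]], [[⟨161, 172, 44, 47, 0, 93, 25⟩, ⟨981, 1048, 205, 219, 0, 99, 36⟩, ⟨981,
  1048, 205, 219, 12, 0, 16⟩, ⟨35653, 38088, 2167, 2315, 1425, 0, 123⟩, ⟨115832, 123743, 2167,
  2315, 5438, 0, 111⟩, ⟨238165, 254431, 120166, 128373, 11596, 0, 5979⟩, ⟨238165, 254431,
  120166, 128373, 11700, 0, 5935⟩, ⟨238165, 254431, 358331, 382804, 11726, 0, 17665⟩], [⟨623,
  716, 67, 77, 0, 348, 38⟩, ⟨2365, 2718, 67, 77, 0, 122, 14⟩, ⟨8596, 9879, 67, 77, 587, 0, 9⟩,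
  ⟨35262, 40525, 67, 77, 3451, 0, 7⟩, ⟨74658, 85801, 67, 77, 7857, 0, 7⟩, ⟨241823, 277916,
  241890, 277993, 25894, 0, 26152⟩, ⟨241823, 277916, 241890, 277993, 26006, 0, 26075⟩, ⟨241823,
  277916, 241890, 277993, 26034, 0, 26056⟩], [⟨344, 429, 85, 106, 0, 182, 48⟩, ⟨429, 535, 85,
  106, 4, 0, 23⟩, ⟨429, 535, 514, 641, 59, 0, 103⟩, ⟨3517, 4386, 3088, 3851, 591, 0, 568⟩,
  ⟨3517, 4386, 13639, 17009, 619, 0, 2452⟩, ⟨220713, 275248, 108598, 135431, 39221, 0, 19408⟩,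
  ⟨220713, 275248, 108598, 135431, 39329, 0, 19378⟩, ⟨550024, 685927, 329311, 410679, 98077, 0,
  58741⟩], [⟨19, 26, 30, 41, 0, 9, 17⟩, ⟨258, 353, 239, 327, 22, 0, 82⟩, ⟨1749, 2393, 497, 680,
  387, 0, 142⟩, ⟨15225, 20831, 2246, 3073, 3879, 0, 608⟩, ⟨19717, 26977, 2246, 3073, 5189, 0,
  600⟩, ⟨19717, 26977, 41680, 57027, 5231, 0, 11098⟩, ⟨416303, 569590, 396586, 542613, 110648,
  0, 105507⟩, ⟨416303, 569590, 396586, 542613, 110703, 0, 105484⟩], [⟨65, 99, 44, 67, 0, 29,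
  29⟩, ⟨610, 929, 109, 166, 110, 0, 48⟩, ⟨610, 929, 719, 1095, 201, 0, 284⟩, ⟨35533, 54115,
  4989, 7598, 13002, 0, 1907⟩, ⟨130324, 198477, 4989, 7598, 48882, 0, 1891⟩, ⟨140302, 213673,
  4989, 7598, 52946, 0, 1887⟩, ⟨140302, 213673, 145291, 221271, 53027, 0, 54949⟩, ⟨16324312,
  24861119, 425895, 648617, 6172000, 0, 161052⟩], [⟨48, 83, 11, 19, 0, 18, 8⟩, ⟨48, 83, 155,
  268, 15, 0, 91⟩, ⟨3046, 5267, 1499, 2592, 1443, 0, 814⟩, ⟨13539, 23411, 1499, 2592, 6967, 0,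
  797⟩, ⟨16537, 28595, 1499, 2592, 8678, 0, 793⟩, ⟨16537, 28595, 34573, 59782, 8720, 0, 18266⟩,
  ⟨251053, 434109, 117258, 202757, 132528, 0, 61930⟩, ⟨251053, 434109, 117258, 202757, 132568,
  0, 61925⟩], [⟨143, 289, 48, 97, 0, 43, 47⟩, ⟨527, 1065, 48, 97, 259, 0, 38⟩, ⟨527, 1065, 575,
  1162, 358, 0, 434⟩, ⟨1629, 3292, 1102, 2227, 1183, 0, 820⟩, ⟨4360, 8811, 7091, 14330, 3216, 0,
  5262⟩, ⟨37611, 76007, 33251, 67196, 27844, 0, 24655⟩, ⟨37611, 76007, 146084, 295217, 27871, 0,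
  108296⟩, ⟨6321379, 12774695, 785471, 1587336, 4685496, 0, 582260⟩], [⟨19, 47, 17, 42, 0, 3,
  23⟩, ⟨112, 277, 93, 230, 87, 0, 106⟩, ⟨317, 784, 205, 507, 318, 0, 224⟩, ⟨317, 784, 2424,
  5995, 335, 0, 2614⟩, ⟨8447, 20891, 8130, 20107, 9035, 0, 8742⟩, ⟨33471, 82780, 25024, 61889,
  35915, 0, 26886⟩, ⟨33471, 82780, 91966, 227449, 35944, 0, 98792⟩, ⟨33471, 82780, 192379,
  475789, 35951, 0, 206648⟩], [⟨27, 89, 17, 56, 2, 0, 37⟩, ⟨863, 2844, 44, 145, 1122, 0, 79⟩,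
  ⟨863, 2844, 44, 145, 1373, 0, 75⟩, ⟨10840, 35723, 907, 2989, 18019, 0, 1536⟩, ⟨13561, 44690,
  907, 2989, 22784, 0, 1531⟩, ⟨153706, 506535, 28029, 92369, 258928, 0, 47272⟩, ⟨209764, 691273,
  28029, 92369, 353596, 0, 47261⟩, ⟨209764, 691273, 28029, 92369, 353655, 0, 47259⟩], [⟨7, 38,
  12, 65, 5, 0, 56⟩, ⟨75, 407, 68, 369, 202, 0, 247⟩, ⟨811, 4401, 368, 1997, 2555, 0, 1245⟩,
  ⟨811, 4401, 368, 1997, 2649, 0, 1223⟩, ⟨1990, 10799, 1179, 6398, 6556, 0, 3900⟩, ⟨36999,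
  200780, 35009, 189981, 122140, 0, 115699⟩, ⟨36999, 200780, 35009, 189981, 122207, 0, 115665⟩,
  ⟨473027, 2566944, 109007, 591541, 1562602, 0, 360119⟩]], [[⟨16, 17, 49, 52, 0, 11, 34⟩, ⟨193,
  205, 177, 188, 0, 26, 35⟩, ⟨756, 803, 563, 598, 0, 0, 46⟩, ⟨756, 803, 3587, 3810, 26, 0, 195⟩,
  ⟨18514, 19665, 8879, 9431, 779, 0, 419⟩, ⟨45907, 48761, 27393, 29096, 2027, 0, 1244⟩, ⟨192507,
  204475, 73300, 77857, 8600, 0, 3298⟩, ⟨1567449, 1664896, 458314, 486807, 70228, 0, 20571⟩],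
  [⟨141, 160, 52, 59, 0, 99, 35⟩, ⟨527, 598, 193, 219, 0, 49, 45⟩, ⟨527, 598, 720, 817, 27, 0,
  94⟩, ⟨2828, 3209, 2301, 2611, 242, 0, 243⟩, ⟨7957, 9029, 13086, 14849, 751, 0, 1299⟩, ⟨65957,
  74843, 29000, 32907, 6363, 0, 2834⟩, ⟨292828, 332279, 226871, 257436, 28411, 0, 22082⟩,
  ⟨292828, 332279, 226871, 257436, 28451, 0, 22060⟩], [⟨77, 94, 68, 83, 0, 53, 44⟩, ⟨376, 459,
  299, 365, 0, 16, 83⟩, ⟨376, 459, 675, 824, 42, 0, 127⟩, ⟨58031, 70841, 4435, 5414, 8523, 0,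
  739⟩, ⟨62466, 76255, 4435, 5414, 9758, 0, 714⟩, ⟨196268, 239593, 66901, 81669, 31117, 0,
  10689⟩, ⟨196268, 239593, 66901, 81669, 31232, 0, 10666⟩, ⟨459437, 560855, 263169, 321262,
  73175, 0, 41935⟩], [⟨40, 53, 37, 49, 0, 26, 24⟩, ⟨271, 359, 77, 102, 6, 0, 26⟩, ⟨2128, 2819,
  619, 820, 386, 0, 161⟩, ⟨2128, 2819, 2747, 3639, 471, 0, 661⟩, ⟨21628, 28651, 4875, 6458,
  5000, 0, 1150⟩, ⟨1417427, 1877691, 48131, 63760, 331194, 0, 11305⟩, ⟨6663706, 8827531, 48131,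
  63760, 1561171, 0, 11290⟩, ⟨2524440, 3344171, 48131, 63760, 591818, 0, 11287⟩], [⟨86, 125, 75,
  109, 0, 55, 52⟩, ⟨86, 125, 161, 234, 9, 0, 67⟩, ⟨1709, 2484, 1623, 2359, 463, 0, 567⟩, ⟨5041,
  7327, 3332, 4843, 1581, 0, 1110⟩, ⟨18455, 26824, 13414, 19497, 5983, 0, 4414⟩, ⟨783311,
  1138528, 31869, 46321, 256024, 0, 10455⟩, ⟨942656, 1370133, 31869, 46321, 308736, 0, 10447⟩,
  ⟨719573, 1045886, 31869, 46321, 235793, 0, 10445⟩], [⟨55, 89, 34, 55, 0, 33, 26⟩, ⟨144, 233,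
  89, 144, 29, 0, 46⟩, ⟨987, 1597, 610, 987, 380, 0, 284⟩, ⟨2584, 4181, 1597, 2584, 1116, 0,
  721⟩, ⟨17711, 28657, 10946, 17711, 7852, 0, 4908⟩, ⟨46368, 75025, 28657, 46368, 20692, 0,
  12824⟩, ⟨121393, 196418, 75025, 121393, 54260, 0, 33557⟩, ⟨317811, 514229, 196418, 317811,
  142111, 0, 87844⟩], [⟨37, 68, 6, 11, 0, 21, 5⟩, ⟨4754, 8735, 123, 226, 1553, 0, 83⟩, ⟨6230,
  11447, 123, 226, 3351, 0, 76⟩, ⟨6230, 11447, 123, 226, 3675, 0, 75⟩, ⟨12583, 23120, 6353,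
  11673, 7585, 0, 3863⟩, ⟨31519, 57913, 18936, 34793, 19100, 0, 11500⟩, ⟨31519, 57913, 176531,
  324358, 19126, 0, 107177⟩, ⟨951923, 1749063, 460202, 845575, 577812, 0, 279378⟩], [⟨27, 58,
  34, 73, 0, 13, 39⟩, ⟨595, 1278, 142, 305, 306, 0, 129⟩, ⟨595, 1278, 142, 305, 450, 0, 121⟩,
  ⟨595, 1278, 1927, 4139, 485, 0, 1617⟩, ⟨13827, 29699, 13232, 28421, 11471, 0, 11057⟩, ⟨122063,
  262179, 27059, 58120, 101709, 0, 22588⟩, ⟨420307, 902777, 149122, 320299, 350607, 0, 124449⟩,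
  ⟨420307, 902777, 149122, 320299, 350704, 0, 124441⟩], [⟨181, 476, 27, 71, 0, 75, 43⟩, ⟨667,
  1754, 27, 71, 539, 0, 34⟩, ⟨1288, 3387, 27, 71, 1411, 0, 32⟩, ⟨1288, 3387, 1315, 3458, 1503,
  0, 1573⟩, ⟨9097, 23922, 2603, 6845, 10772, 0, 3101⟩, ⟨48088, 126455, 38991, 102533, 57152, 0,
  46412⟩, ⟨48088, 126455, 87079, 228988, 57205, 0, 103628⟩, ⟨48088, 126455, 135167, 355443,
  57218, 0, 160845⟩], [⟨79, 277, 2, 7, 0, 19, 5⟩, ⟨79, 277, 81, 284, 107, 0, 163⟩, ⟨79, 277,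
  318, 1115, 136, 0, 600⟩, ⟨6484, 22735, 2135, 7486, 11760, 0, 3960⟩, ⟨6484, 22735, 2135, 7486,
  11909, 0, 3943⟩, ⟨15103, 52956, 8619, 30221, 27825, 0, 15901⟩, ⟨69031, 242045, 53928, 189089,
  127275, 0, 99463⟩, ⟨314949, 1104313, 122959, 431134, 580794, 0, 226766⟩], [⟨23, 133, 9, 52, 6,
  0, 49⟩, ⟨78, 451, 55, 318, 217, 0, 221⟩, ⟨922, 5331, 211, 1220, 3116, 0, 778⟩, ⟨1977, 11431,
  211, 1220, 6974, 0, 760⟩, ⟨1977, 11431, 2188, 12651, 7047, 0, 7841⟩, ⟨22380, 129401, 14261,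
  82457, 79980, 0, 51032⟩, ⟨95662, 553117, 36641, 211858, 342087, 0, 131071⟩, ⟨95662, 553117,
  36641, 211858, 342142, 0, 131060⟩]], [[⟨35, 37, 18, 19, 0, 30, 14⟩, ⟨929, 982, 298, 315, 0,
  163, 68⟩, ⟨929, 982, 298, 315, 0, 11, 26⟩, ⟨929, 982, 3085, 3261, 26, 0, 162⟩, ⟨929, 982,
  27239, 28793, 36, 0, 1199⟩, ⟨64399, 68073, 63470, 67091, 2597, 0, 2657⟩, ⟨320137, 338401,
  127869, 135164, 13109, 0, 5285⟩, ⟨320137, 338401, 127869, 135164, 13159, 0, 5268⟩], [⟨57, 64,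
  49, 55, 0, 49, 39⟩, ⟨57, 64, 163, 183, 0, 7, 41⟩, ⟨562, 631, 505, 567, 19, 0, 65⟩, ⟨18937,
  21262, 6125, 6877, 1414, 0, 605⟩, ⟨18937, 21262, 6125, 6877, 1612, 0, 558⟩, ⟨545239, 612181,
  25062, 28139, 47824, 0, 2236⟩, ⟨670549, 752876, 25062, 28139, 59252, 0, 2224⟩, ⟨670549,
  752876, 25062, 28139, 59361, 0, 2221⟩], [⟨5, 6, 61, 73, 0, 4, 46⟩, ⟨396, 475, 391, 469, 0, 37,
  114⟩, ⟨1970, 2363, 787, 944, 168, 0, 142⟩, ⟨1970, 2363, 2757, 3307, 255, 0, 422⟩, ⟨1970, 2363,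
  14577, 17485, 277, 0, 2131⟩, ⟨40187, 48204, 38217, 45841, 5749, 0, 5523⟩, ⟨198965, 238657,
  158778, 190453, 28600, 0, 22881⟩, ⟨198965, 238657, 158778, 190453, 28634, 0, 22864⟩], [⟨210,
  271, 31, 40, 0, 179, 23⟩, ⟨210, 271, 31, 40, 0, 8, 10⟩, ⟨1143, 1475, 692, 893, 169, 0, 167⟩,
  ⟨15823, 20419, 1835, 2368, 3074, 0, 399⟩, ⟨17658, 22787, 1835, 2368, 3635, 0, 388⟩, ⟨115123,
  148562, 19493, 25155, 24032, 0, 4097⟩, ⟨115123, 148562, 134616, 173717, 24115, 0, 28247⟩,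
  ⟨479985, 619403, 364862, 470841, 100629, 0, 76526⟩], [⟨322, 451, 5, 7, 0, 271, 3⟩, ⟨447, 626,
  452, 633, 10, 0, 182⟩, ⟨5841, 8180, 899, 1259, 1304, 0, 285⟩, ⟨13033, 18252, 899, 1259, 3556,
  0, 266⟩, ⟨13932, 19511, 14831, 20770, 3974, 0, 4316⟩, ⟨42695, 59792, 28763, 40281, 12308, 0,
  8333⟩, ⟨3375602, 4727345, 370323, 518617, 975712, 0, 107177⟩, ⟨1894310, 2652877, 370323,
  518617, 547913, 0, 107146⟩], [⟨218, 335, 41, 63, 0, 181, 33⟩, ⟨218, 335, 41, 63, 22, 0, 20⟩,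
  ⟨736, 1131, 259, 398, 234, 0, 106⟩, ⟨6706, 10305, 995, 1529, 2484, 0, 392⟩, ⟨22108, 33973,
  7701, 11834, 8483, 0, 3000⟩, ⟨51917, 79780, 29809, 45807, 20092, 0, 11580⟩, ⟨1521990, 2338817,
  133643, 205367, 590269, 0, 51880⟩, ⟨1121061, 1722716, 133643, 205367, 435011, 0, 51870⟩],
  [⟨83, 142, 38, 65, 0, 67, 33⟩, ⟨83, 142, 121, 207, 17, 0, 73⟩, ⟨83, 142, 785, 1343, 37, 0,
  421⟩, ⟨22901, 39180, 11409, 19519, 11345, 0, 5936⟩, ⟨34310, 58699, 11409, 19519, 17496, 0,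
  5888⟩, ⟨34310, 58699, 11409, 19519, 17620, 0, 5876⟩, ⟨80029, 136917, 125748, 215135, 41172, 0,
  64740⟩, ⟨365835, 625886, 285806, 488969, 188290, 0, 147127⟩], [⟨88, 171, 35, 68, 0, 69, 36⟩,
  ⟨580, 1127, 123, 239, 194, 0, 95⟩, ⟨580, 1127, 123, 239, 347, 0, 86⟩, ⟨3269, 6352, 1986, 3859,
  2167, 0, 1369⟩, ⟨50441, 98012, 11793, 22915, 34247, 0, 8086⟩, ⟨50441, 98012, 11793, 22915,
  34451, 0, 8074⟩, ⟨672781, 1307282, 62234, 120927, 460176, 0, 42593⟩, ⟨735015, 1428209, 62234,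
  120927, 502929, 0, 42589⟩], [⟨11, 25, 26, 59, 0, 8, 34⟩, ⟨886, 2013, 125, 284, 466, 0, 128⟩,
  ⟨886, 2013, 125, 284, 733, 0, 118⟩, ⟨886, 2013, 1897, 4310, 799, 0, 1767⟩, ⟨11768, 26737,
  5441, 12362, 10822, 0, 5045⟩, ⟨11768, 26737, 17209, 39099, 10877, 0, 15937⟩, ⟨382017, 867946,
  370249, 841209, 353507, 0, 342795⟩, ⟨382017, 867946, 370249, 841209, 353617, 0, 342768⟩],
  [⟨267, 743, 23, 64, 0, 191, 43⟩, ⟨520, 1447, 23, 64, 429, 0, 33⟩, ⟨1049, 2919, 23, 64, 1244,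
  0, 30⟩, ⟨1049, 2919, 1072, 2983, 1337, 0, 1406⟩, ⟨6317, 17578, 5268, 14659, 8188, 0, 6877⟩,
  ⟨55804, 155283, 49487, 137705, 72637, 0, 64531⟩, ⟨55804, 155283, 49487, 137705, 72714, 0,
  64511⟩, ⟨55804, 155283, 105291, 292988, 72733, 0, 137247⟩], [⟨7, 26, 10, 37, 0, 4, 30⟩, ⟨181,
  672, 87, 323, 249, 0, 194⟩, ⟨181, 672, 268, 995, 335, 0, 551⟩, ⟨1441, 5350, 630, 2339, 2826,
  0, 1268⟩, ⟨24222, 89929, 2071, 7689, 48199, 0, 4148⟩, ⟨107062, 397489, 2071, 7689, 213810, 0,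
  4142⟩, ⟨612386, 2273605, 2071, 7689, 1224073, 0, 4141⟩, ⟨345227, 1281724, 2071, 7689, 690215,
  0, 4140⟩], [⟨15, 92, 8, 49, 0, 6, 50⟩, ⟨889, 5450, 23, 141, 2523, 0, 101⟩, ⟨1280, 7847, 23,
  141, 4604, 0, 91⟩, ⟨1487, 9116, 1510, 9257, 5626, 0, 5861⟩, ⟨1487, 9116, 1510, 9257, 5696, 0,
  5820⟩, ⟨41705, 255671, 13406, 82185, 160214, 0, 51582⟩, ⟨41705, 255671, 13406, 82185, 160335,
  0, 51559⟩, ⟨41705, 255671, 55111, 337856, 160366, 0, 211935⟩]]]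

theorem tablesCheck_cellTables : tablesCheck cellTables 2 = true := by decide +kernel

end BinomialCollision

open Finset in
/-- The product of the `s` numbers with spacing `2` centered at `X`. -/
noncomputable def BinomialCollision.centered (s : ℕ) (X : ℝ) : ℝ :=
  ∏ i ∈ range s, (X + (s - 1) - 2 * i)

namespace BinomialCollision
open Finset

theorem centered_sq (s : ℕ) (X : ℝ) :
    centered s X ^ 2 = ∏ i ∈ range s, (X ^ 2 - ((s : ℝ) - 1 - 2 * i) ^ 2) := by
  have h : centered s X = ∏ i ∈ range s, (X - (s - 1) + 2 * i) := by
    rw [centered, ← prod_range_reflect]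
    refine prod_congr rfl fun i hi => ?_
    have := mem_range.1 hi
    rw [Nat.sub_sub, Nat.cast_sub (by omega)]
    push_cast
    ring
  rw [pow_two]
  nth_rewrite 2 [h]
  rw [centered, ← prod_mul_distrib]
  exact prod_congr rfl fun i _ => by ring

theorem sq_offset_le {s i : ℕ} (hi : i < s) : ((s : ℝ) - 1 - 2 * i) ^ 2 ≤ (s - 1) ^ 2 := by
  have h : (i : ℝ) + 1 ≤ s := by exact_mod_cast hi
  have h0 : (0 : ℝ) ≤ i := i.cast_nonneg
  apply sq_le_sq'
  all_goals linarith

theorem centered_nonneg {s : ℕ} {X : ℝ} (h : (s : ℝ) - 1 ≤ X) : 0 ≤ centered s X := by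
  refine prod_nonneg fun i hi => ?_
  have : (i : ℝ) + 1 ≤ s := by exact_mod_cast mem_range.1 hi
  linarith

theorem centered_le_pow {s : ℕ} {X : ℝ} (h : (s : ℝ) - 1 ≤ X) (hX : 0 ≤ X) :
    centered s X ≤ X ^ s := by
  rw [← pow_le_pow_iff_left₀ (centered_nonneg h) (by positivity) two_ne_zero, centered_sq,
    ← pow_mul, mul_comm, pow_mul, ← card_range s, ← prod_const, card_range]
  refine prod_le_prod (fun i hi => ?_) fun i hi => ?_
  · have h1 := sq_offset_le (mem_range.1 hi)
    have h2 : (i : ℝ) + 1 ≤ s := by exact_mod_cast mem_range.1 hi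
    have h3 : (0 : ℝ) ≤ i := i.cast_nonneg
    have : ((s : ℝ) - 1) ^ 2 ≤ X ^ 2 := pow_le_pow_left₀ (by linarith) h 2
    linarith
  · nlinarith [sq_nonneg ((s : ℝ) - 1 - 2 * i)]

theorem centered_lt_pow {s : ℕ} {X : ℝ} (hs : 2 ≤ s) (h : (s : ℝ) - 1 < X) :
    centered s X < X ^ s := by
  have hs' : (2 : ℝ) ≤ s := by exact_mod_cast hs
  rw [← pow_lt_pow_iff_left₀ (centered_nonneg h.le) (pow_nonneg (by linarith) s) two_ne_zero,
    centered_sq, ← pow_mul, mul_comm, pow_mul, ← card_range s, ← prod_const, card_range]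
  refine prod_lt_prod (fun i hi => ?_) (fun i hi => ?_) ⟨0, mem_range.2 (by omega), ?_⟩
  · have h1 := sq_offset_le (mem_range.1 hi)
    have : ((s : ℝ) - 1) ^ 2 < X ^ 2 := pow_lt_pow_left₀ h (by linarith) two_ne_zero
    linarith
  · nlinarith [sq_nonneg ((s : ℝ) - 1 - 2 * i)]
  · push_cast
    nlinarith

theorem pow_le_centered {s : ℕ} {X ε : ℝ} (h : (s : ℝ) - 1 ≤ X) (hε : ε ≤ X)
    (h2 : ((s : ℝ) - 1) ^ 2 ≤ ε * (2 * X - ε)) : (X - ε) ^ s ≤ centered s X := by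
  rw [← pow_le_pow_iff_left₀ (pow_nonneg (by linarith) s) (centered_nonneg h) two_ne_zero,
    centered_sq, ← pow_mul, mul_comm, pow_mul, ← card_range s, ← prod_const, card_range]
  refine prod_le_prod (fun i _ => sq_nonneg _) fun i hi => ?_
  have h1 := sq_offset_le (mem_range.1 hi)
  nlinarith

/-- The preceding bound, with a uniform choice of `ε` for all `X₁ ≤ X`. -/
theorem pow_le_centered_of_le {s : ℕ} {X X₁ D : ℝ} (hs : 1 ≤ s) (h : (s : ℝ) - 1 ≤ X)
    (hX : X₁ ≤ X) (hD : D = 2 * X₁ - (s - 1)) (hD0 : 0 < D) (hD1 : (s : ℝ) - 1 ≤ D) :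
    (s - 1 : ℝ) ^ 2 / D ≤ s - 1 ∧ (X - (s - 1 : ℝ) ^ 2 / D) ^ s ≤ centered s X := by
  have hs' : (1 : ℝ) ≤ s := by exact_mod_cast hs
  have h1 : (s - 1 : ℝ) ^ 2 / D ≤ s - 1 := by
    rw [div_le_iff₀ hD0]
    nlinarith
  refine ⟨h1, pow_le_centered h (h1.trans h) ?_⟩
  have h2 : (s - 1 : ℝ) ^ 2 = (s - 1 : ℝ) ^ 2 / D * D := by field_simp
  have h3 : 0 ≤ (s - 1 : ℝ) ^ 2 / D := by positivity
  calc (s - 1 : ℝ) ^ 2 = (s - 1 : ℝ) ^ 2 / D * D := h2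
    _ ≤ _ := mul_le_mul_of_nonneg_left (by linarith) h3

theorem two_pow_mul_descFactorial {n s : ℕ} (h : s ≤ n) :
    (2 : ℝ) ^ s * n.descFactorial s = centered s (2 * n - s + 1) := by
  rw [Nat.descFactorial_eq_prod_range, centered, ← card_range s, ← prod_const, card_range,
    Nat.cast_prod, ← prod_mul_distrib]
  refine prod_congr rfl fun i hi => ?_
  have := mem_range.1 hi
  rw [Nat.cast_sub (by omega)]
  ring

theorem le_of_pow_le {d e : ℕ} {A K ε P Q : ℝ} (hP : 0 < P) (hQ : 0 < Q)
    (hN : 0 ≤ A + K - 1) (hK : 0 ≤ K) (hε : ε < A)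
    (h : (A - ε) ^ (d + e) ≤ (A + K - 1) ^ d * K ^ e)
    (hpow : (P + Q) ^ d * P ^ e ≤ Q ^ (d + e)) :
    d * P * Q ≤ (Q * K - P * A) * (d * P + e * (P + Q)) + (d + e) * ε * ((P + Q) * P) := by
  have hB : 0 < A - ε := by linarith
  set y := Q * K - P * A with hy
  set α := ((y - Q) / (P + Q) + ε) / (A - ε) with hα
  set β := (y / P + ε) / (A - ε) with hβ
  have h1 : (A + K - 1) * Q = (P + Q) * (A - ε) * (1 + α) := by
    rw [hα, hy]; field_simp; ring
  have h2 : K * Q = P * (A - ε) * (1 + β) := by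
    rw [hβ, hy]; field_simp; ring
  have hα0 : 0 ≤ 1 + α := by
    have : 0 ≤ (P + Q) * (A - ε) * (1 + α) := h1 ▸ by positivity
    exact nonneg_of_mul_nonneg_right this (by positivity)
  have hβ0 : 0 ≤ 1 + β := by
    have : 0 ≤ P * (A - ε) * (1 + β) := h2 ▸ by positivity
    exact nonneg_of_mul_nonneg_right this (by positivity)
  have h3 : 1 ≤ (1 + α) ^ d * (1 + β) ^ e := by
    have h4 : Q ^ (d + e) * (A - ε) ^ (d + e) ≤
        Q ^ (d + e) * (A - ε) ^ (d + e) * ((1 + α) ^ d * (1 + β) ^ e) := by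
      calc Q ^ (d + e) * (A - ε) ^ (d + e)
          ≤ Q ^ (d + e) * ((A + K - 1) ^ d * K ^ e) := by gcongr
        _ = ((A + K - 1) * Q) ^ d * (K * Q) ^ e := by rw [mul_pow, mul_pow]; ring
        _ = ((P + Q) ^ d * P ^ e) * ((A - ε) ^ (d + e) * ((1 + α) ^ d * (1 + β) ^ e)) := by
          rw [h1, h2, mul_pow, mul_pow, mul_pow, mul_pow]; ring
        _ ≤ Q ^ (d + e) * ((A - ε) ^ (d + e) * ((1 + α) ^ d * (1 + β) ^ e)) := by gcongr
        _ = _ := by ring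
    exact le_of_mul_le_mul_left (by linarith) (by positivity : 0 < Q ^ (d + e) * (A - ε) ^ (d + e))
  have h5 : (1 + α) ^ d * (1 + β) ^ e ≤ Real.exp (d * α + e * β) := by
    rw [Real.exp_add, Real.exp_nat_mul, Real.exp_nat_mul]
    have := Real.add_one_le_exp α
    have := Real.add_one_le_exp β
    gcongr
    all_goals linarith
  have h6 : 0 ≤ d * α + e * β := by
    exact Real.one_le_exp_iff.1 (h3.trans h5)
  have h7 : (d * α + e * β) * ((A - ε) * ((P + Q) * P)) =
      (y * (d * P + e * (P + Q)) + (d + e) * ε * ((P + Q) * P)) - d * P * Q := by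
    rw [hα, hβ]; field_simp; ring
  have : 0 ≤ (d * α + e * β) * ((A - ε) * ((P + Q) * P)) := by positivity
  linarith

theorem pow_mul_pow_le_of_one_le {d e : ℕ} {r s u v μ : ℝ} (hr : 0 < r) (hs : 0 < s)
    (hu : 0 < r + u) (hv : 0 < s + v) (hμ : 1 ≤ μ) (h : r ^ d * s ^ e ≤ (r + u) ^ d * (s + v) ^ e) :
    (μ * r) ^ d * (μ * s) ^ e ≤ (μ * r + u) ^ d * (μ * s + v) ^ e := by
  have hμ0 : 0 < μ := by linarith
  have key {r u : ℝ} (hr : 0 < r) (hu : 0 < r + u) :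
      μ * r * (1 + u / r) ^ μ⁻¹ ≤ μ * r + u ∧ 0 < 1 + u / r ∧ r * (1 + u / r) = r + u := by
    have h0 : r * (1 + u / r) = r + u := by field_simp
    have h1 : 0 < 1 + u / r := pos_of_mul_pos_right (h0 ▸ hu) hr.le
    have h2 := rpow_one_add_le_one_add_mul_self (s := u / r) (p := μ⁻¹) (by linarith)
      (by positivity) (inv_le_one_of_one_le₀ hμ)
    refine ⟨?_, h1, h0⟩
    calc μ * r * (1 + u / r) ^ μ⁻¹ ≤ μ * r * (1 + μ⁻¹ * (u / r)) := by gcongr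
      _ = μ * r + u := by field_simp
  obtain ⟨h1, h2, h3⟩ := key hr hu
  obtain ⟨h4, h5, h6⟩ := key hs hv
  rw [← h3, ← h6, mul_pow, mul_pow] at h
  have h7 : 1 ≤ (1 + u / r) ^ d * (1 + v / s) ^ e := by
    refine le_of_mul_le_mul_left ?_ (by positivity : 0 < r ^ d * s ^ e)
    linarith
  have h8 : 1 ≤ ((1 + u / r) ^ μ⁻¹) ^ d * ((1 + v / s) ^ μ⁻¹) ^ e := by
    rw [← Real.rpow_mul_natCast h2.le, ← Real.rpow_mul_natCast h5.le, mul_comm μ⁻¹, mul_comm μ⁻¹,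
      Real.rpow_natCast_mul h2.le, Real.rpow_natCast_mul h5.le,
      ← Real.mul_rpow (by positivity) (by positivity)]
    exact Real.one_le_rpow h7 (by positivity)
  calc (μ * r) ^ d * (μ * s) ^ e
      ≤ (μ * r) ^ d * (μ * s) ^ e * (((1 + u / r) ^ μ⁻¹) ^ d * ((1 + v / s) ^ μ⁻¹) ^ e) :=
        le_mul_of_one_le_right (by positivity) h8
    _ = (μ * r * (1 + u / r) ^ μ⁻¹) ^ d * (μ * s * (1 + v / s) ^ μ⁻¹) ^ e := by
        rw [mul_pow (μ * r), mul_pow (μ * s)]; ring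
    _ ≤ _ := by
        have : 0 ≤ μ * r + u := by nlinarith
        gcongr

theorem lt_of_pow_lt {d e : ℕ} {A A₁ K X D₁ D₂ f g P Q : ℝ} (hP : 0 < P) (hQ : 0 < Q)
    (hD₁ : 0 < D₁) (hD₂ : 0 < D₂) (hA₁ : 0 < A₁) (hA : A₁ ≤ A)
    (hpow : Q ^ (d + e) ≤ (P + Q) ^ d * P ^ e)
    (hu : 0 < (P + Q) * A₁ * D₁ + X * D₁ - Q * (D₁ + f))
    (hv : 0 < P * A₁ * D₂ + X * D₂ - Q * g)
    (h : ((P + Q) * A₁ * D₁) ^ d * (P * A₁ * D₂) ^ e ≤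
      ((P + Q) * A₁ * D₁ + X * D₁ - Q * (D₁ + f)) ^ d * (P * A₁ * D₂ + X * D₂ - Q * g) ^ e)
    (hlt : (A + K - 1 - f / D₁) ^ d * (K - g / D₂) ^ e < A ^ (d + e)) :
    Q * K < P * A + X := by
  by_contra! hx
  set u := X - Q - Q * (f / D₁) with hu'
  set v := X - Q * (g / D₂) with hv'
  have h1 : (P + Q) * A₁ * D₁ + X * D₁ - Q * (D₁ + f) = D₁ * ((P + Q) * A₁ + u) := by
    rw [hu']; field_simp; ring
  have h2 : P * A₁ * D₂ + X * D₂ - Q * g = D₂ * (P * A₁ + v) := by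
    rw [hv']; field_simp; ring
  rw [h1] at h hu
  rw [h2] at h hv
  have hu0 := pos_of_mul_pos_right hu hD₁.le
  have hv0 := pos_of_mul_pos_right hv hD₂.le
  have h3 : ((P + Q) * A₁) ^ d * (P * A₁) ^ e ≤ ((P + Q) * A₁ + u) ^ d * (P * A₁ + v) ^ e := by
    refine le_of_mul_le_mul_left ?_ (by positivity : 0 < D₁ ^ d * D₂ ^ e)
    calc D₁ ^ d * D₂ ^ e * (((P + Q) * A₁) ^ d * (P * A₁) ^ e)
        = ((P + Q) * A₁ * D₁) ^ d * (P * A₁ * D₂) ^ e := by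
          rw [mul_pow _ D₁, mul_pow _ D₂]; ring
      _ ≤ _ := h
      _ = _ := by rw [mul_pow, mul_pow]; ring
  have h4 := pow_mul_pow_le_of_one_le (by positivity) (by positivity) hu0 hv0
    ((one_le_div hA₁).2 hA) h3
  rw [show A / A₁ * ((P + Q) * A₁) = (P + Q) * A by field_simp,
    show A / A₁ * (P * A₁) = P * A by field_simp] at h4
  have h5 : 0 ≤ (P + Q) * A + u := by nlinarith
  have h6 : 0 ≤ P * A + v := by nlinarith
  have hA0 : 0 < A := by linarith
  have : Q ^ (d + e) * A ^ (d + e) ≤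
      Q ^ (d + e) * ((A + K - 1 - f / D₁) ^ d * (K - g / D₂) ^ e) := by
    calc Q ^ (d + e) * A ^ (d + e) ≤ ((P + Q) ^ d * P ^ e) * A ^ (d + e) := by gcongr
      _ = ((P + Q) * A) ^ d * (P * A) ^ e := by rw [mul_pow, mul_pow]; ring
      _ ≤ ((P + Q) * A + u) ^ d * (P * A + v) ^ e := h4
      _ ≤ (Q * (A + K - 1 - f / D₁)) ^ d * (Q * (K - g / D₂)) ^ e := by
        have h7 : (P + Q) * A + u ≤ Q * (A + K - 1 - f / D₁) := by rw [hu']; linarith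
        have h8 : P * A + v ≤ Q * (K - g / D₂) := by rw [hv']; linarith
        have := h5.trans h7
        gcongr
      _ = _ := by rw [mul_pow, mul_pow]; ring
  have := le_of_mul_le_mul_left this (by positivity)
  linarith

/-- `A` and `K` are the centers of the products in the identity for `w`, `k`, `d`, `e`. -/
structure IsSolution (d e w k A K : ℕ) : Prop where
  one_le_left : 1 ≤ d
  one_le_right : 1 ≤ e
  add_le : d + e ≤ 13
  add_eq : A + (d + e) = 2 * w + 1
  eq_add : K = 2 * k + e + 1
  descFactorial_eq :
    (w + k).descFactorial d * (k + e).descFactorial e = w.descFactorial (d + e)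

theorem IsSolution.centered_eq {d e w k A K : ℕ} (h : IsSolution d e w k A K) (hA : 88 ≤ A) :
    centered (d + e) A = centered d (A + K - 1) * centered e K := by
  have h1 := h.add_le
  have h2 := h.add_eq
  have h3 : (A : ℝ) + (d + e) = 2 * w + 1 := by exact_mod_cast h2
  have h4 : (K : ℝ) = 2 * k + e + 1 := by exact_mod_cast h.eq_add
  have h5 := two_pow_mul_descFactorial (n := w) (s := d + e) (by omega)
  have h6 := two_pow_mul_descFactorial (n := w + k) (s := d) (by omega)
  have h7 := two_pow_mul_descFactorial (n := k + e) (s := e) (by omega)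
  have h8 : ((w + k).descFactorial d : ℝ) * (k + e).descFactorial e = w.descFactorial (d + e) := by
    exact_mod_cast h.descFactorial_eq
  rw [show (A : ℝ) = 2 * w - ((d + e : ℕ) : ℝ) + 1 by push_cast; linarith, ← h5,
    show 2 * (w : ℝ) - ((d + e : ℕ) : ℝ) + 1 + K - 1 = 2 * ((w + k : ℕ) : ℝ) - d + 1 by
      push_cast; linarith, ← h6, show (K : ℝ) = 2 * ((k + e : ℕ) : ℝ) - e + 1 by
      push_cast; linarith, ← h7, ← h8]
  ring

theorem IsSolution.le_add {d e w k A K A₁ p q lo up : ℕ} (h : IsSolution d e w k A K)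
    (hA₁ : 88 ≤ A₁) (hA : A₁ ≤ A) (hp : 0 < p) (hq : 0 < q)
    (hpow : (p + q) ^ d * p ^ e ≤ q ^ (d + e))
    (hlt : (2 * A₁ - (d + e - 1)) * lo * (d * p + e * (p + q)) +
      (d + e) * (d + e - 1) ^ 2 * ((p + q) * p) <
      (2 * A₁ - (d + e - 1)) * (d * p * q + (up + 1) * (d * p + e * (p + q)))) :
    lo + p * A ≤ q * K + up := by
  have hd := h.one_le_left
  have he := h.one_le_right
  have hS := h.add_le
  have hK := h.eq_add
  have hcen := h.centered_eq (by omega)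
  obtain ⟨D, hD⟩ : ∃ D, D = 2 * A₁ - (d + e - 1) := ⟨_, rfl⟩
  rw [← hD] at hlt
  have hD' : (D : ℝ) = 2 * A₁ - (((d + e : ℕ) : ℝ) - 1) := by
    rw [hD, Nat.cast_sub (by omega), Nat.cast_sub (by omega)]; push_cast; ring
  have hAR : (88 : ℝ) ≤ A := by exact_mod_cast hA₁.trans hA
  have hSR : ((d + e : ℕ) : ℝ) ≤ 13 := by exact_mod_cast hS
  have hDR : (164 : ℝ) ≤ D := by exact_mod_cast (by omega : 164 ≤ D)
  have hKR : (e : ℝ) ≤ K := by exact_mod_cast (by omega : e ≤ K)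
  have hdR : (d : ℝ) ≤ 13 := by exact_mod_cast (by omega : d ≤ 13)
  obtain ⟨hε, h1⟩ := pow_le_centered_of_le (s := d + e) (X := A) (X₁ := A₁) (D := D) (by omega)
    (by linarith) (by exact_mod_cast hA) hD' (by linarith) (by linarith)
  rw [hcen] at h1
  have hK0 : (0 : ℝ) ≤ K := K.cast_nonneg
  have h2 : centered d (A + K - 1) ≤ ((A : ℝ) + K - 1) ^ d :=
    centered_le_pow (by linarith) (by linarith)
  have h3 : centered e K ≤ (K : ℝ) ^ e := centered_le_pow (by linarith) hK0
  have h4 := le_of_pow_le (d := d) (e := e) (A := A) (K := K) (P := p) (Q := q)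
    (by exact_mod_cast hp) (by exact_mod_cast hq) (by linarith) hK0
    (by linarith : ((d + e : ℕ) - 1 : ℝ) ^ 2 / D < A)
    (h1.trans (mul_le_mul h2 h3 (centered_nonneg (by linarith)) (pow_nonneg (by linarith) d)))
    (by exact_mod_cast hpow)
  have hlt' : (D : ℝ) * lo * (d * p + e * (p + q)) +
      (d + e) * ((d + e : ℕ) - 1 : ℝ) ^ 2 * ((p + q) * p) <
      D * (d * p * q + (up + 1) * (d * p + e * (p + q))) := by
    have := (Nat.cast_lt (α := ℝ)).2 hlt
    rw [Nat.cast_add, Nat.cast_mul ((d + e) * _), Nat.cast_mul (d + e), Nat.cast_pow,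
      Nat.cast_sub (by omega)] at this
    push_cast at this ⊢
    exact this
  have h5 : (D : ℝ) * (((d + e : ℕ) - 1 : ℝ) ^ 2 / D) = ((d + e : ℕ) - 1 : ℝ) ^ 2 := by
    field_simp
  have h6 := mul_le_mul_of_nonneg_left h4 (by linarith : (0 : ℝ) ≤ D)
  by_contra! hlo
  have h7 : (q : ℝ) * K - p * A ≤ lo - (up + 1) := by
    have : (q : ℝ) * K + up + 1 ≤ lo + p * A := by exact_mod_cast hlo
    linarith
  have h8 : (D : ℝ) * ((q * K - p * A) * (d * p + e * (p + q))) ≤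
      D * ((lo - (up + 1)) * (d * p + e * (p + q))) := by gcongr
  have h9 : (D : ℝ) * ((d + e) * (((d + e : ℕ) - 1 : ℝ) ^ 2 / D) * ((p + q) * p)) =
      (d + e) * ((d + e : ℕ) - 1 : ℝ) ^ 2 * ((p + q) * p) := by
    linear_combination ((d + e) * ((p + q) * p) : ℝ) * h5
  linarith

theorem IsSolution.lt_add {d e w k A K A₁ p q X K₁ D₁ D₂ : ℕ} (h : IsSolution d e w k A K)
    (hA₁ : 88 ≤ A₁) (hA : A₁ ≤ A) (hp : 0 < p) (hq : 0 < q)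
    (hpow : q ^ (d + e) ≤ (p + q) ^ d * p ^ e) (hK₁ : q * K₁ ≤ p * A₁)
    (hD₁ : D₁ + (d - 1) = 2 * (A₁ + K₁ - 1)) (hD₂ : D₂ + (e - 1) = 2 * K₁) (hD₂0 : 0 < D₂)
    (heD : e - 1 ≤ D₂)
    (hu : q * (D₁ + (d - 1) ^ 2) < (p + q) * A₁ * D₁ + X * D₁)
    (hv : q * (e - 1) ^ 2 < p * A₁ * D₂ + X * D₂)
    (hle : ((p + q) * A₁ * D₁) ^ d * (p * A₁ * D₂) ^ e ≤
      ((p + q) * A₁ * D₁ + X * D₁ - q * (D₁ + (d - 1) ^ 2)) ^ d *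
        (p * A₁ * D₂ + X * D₂ - q * (e - 1) ^ 2) ^ e) :
    q * K < p * A + X := by
  have hd := h.one_le_left
  have he := h.one_le_right
  have hS := h.add_le
  have hK := h.eq_add
  have hcen := h.centered_eq (by omega)
  by_contra! hx
  have hKK : K₁ ≤ K := by
    refine Nat.le_of_mul_le_mul_left ?_ hq
    calc q * K₁ ≤ p * A₁ := hK₁
      _ ≤ p * A := Nat.mul_le_mul_left p hA
      _ ≤ q * K := by omega
  have hKR : (K₁ : ℝ) ≤ K := by exact_mod_cast hKK
  have hA₁R : (88 : ℝ) ≤ A₁ := by exact_mod_cast hA₁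
  have hAR : (A₁ : ℝ) ≤ A := by exact_mod_cast hA
  have hD₁R : (D₁ : ℝ) = 2 * (A₁ + K₁ - 1) - (d - 1) := by
    have : D₁ + d + 1 = 2 * (A₁ + K₁) := by omega
    have : (D₁ : ℝ) + d + 1 = 2 * (A₁ + K₁) := by exact_mod_cast this
    linarith
  have hD₂R : (D₂ : ℝ) = 2 * K₁ - (e - 1) := by
    have : D₂ + e = 2 * K₁ + 1 := by omega
    have : (D₂ : ℝ) + e = 2 * K₁ + 1 := by exact_mod_cast this
    linarith
  have hK0 : (0 : ℝ) ≤ K₁ := K₁.cast_nonneg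
  have hdR : (d : ℝ) ≤ 12 := by exact_mod_cast (by omega : d ≤ 12)
  have hSR : ((d + e : ℕ) : ℝ) ≤ 13 := by exact_mod_cast hS
  have heK : (e : ℝ) ≤ K := by exact_mod_cast (by omega : e ≤ K)
  have hD₁0 : (0 : ℝ) < D₁ := by linarith
  have hD₂0' : (0 : ℝ) < D₂ := by exact_mod_cast hD₂0
  have heD' : (e : ℝ) - 1 ≤ D₂ := by
    have : (e : ℝ) ≤ D₂ + 1 := by exact_mod_cast (by omega : e ≤ D₂ + 1)
    linarith
  obtain ⟨hf, h1⟩ := pow_le_centered_of_le (s := d) (X := A + K - 1) (X₁ := A₁ + K₁ - 1) (D := D₁)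
    hd (by linarith) (by linarith) hD₁R hD₁0 (by linarith)
  obtain ⟨hg, h2⟩ := pow_le_centered_of_le (s := e) (X := K) (X₁ := K₁) (D := D₂)
    he (by linarith) hKR hD₂R hD₂0' heD'
  have h3 := centered_lt_pow (s := d + e) (X := A) (by omega) (by linarith)
  rw [hcen] at h3
  have h4 := (mul_le_mul h1 h2 (pow_nonneg (by linarith) e)
    (centered_nonneg (by linarith))).trans_lt h3
  have hd' : ((d - 1 : ℕ) : ℝ) = d - 1 := by rw [Nat.cast_sub hd]; simp
  have he' : ((e - 1 : ℕ) : ℝ) = e - 1 := by rw [Nat.cast_sub he]; simp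
  have hu' := (Nat.cast_lt (α := ℝ)).2 hu
  have hv' := (Nat.cast_lt (α := ℝ)).2 hv
  have hle' := (Nat.cast_le (α := ℝ)).2 hle
  rw [Nat.cast_mul, Nat.cast_mul, Nat.cast_pow, Nat.cast_pow, Nat.cast_pow, Nat.cast_pow,
    Nat.cast_sub hu.le, Nat.cast_sub hv.le] at hle'
  push_cast at hu' hv' hle'
  rw [hd'] at hu' hle'
  rw [he'] at hv' hle'
  have := lt_of_pow_lt (P := p) (Q := q) (X := X) (A₁ := A₁) (by exact_mod_cast hp)
    (by exact_mod_cast hq) hD₁0 hD₂0' (by linarith) hAR (by exact_mod_cast hpow)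
    (by linarith) (by linarith) hle' h4
  have : q * K < p * A + X := by exact_mod_cast this
  omega

theorem Cell.le_of_valid {c : Cell} {d e w k A K A₁ : ℕ} (hv : c.valid d e A₁ = true)
    (h : IsSolution d e w k A K) (hA₁ : 88 ≤ A₁) (hA : A₁ ≤ A) :
    c.p' * c.q = c.p * c.q' + 1 ∧ 0 < c.q' ∧ c.lo + c.p * A ≤ c.q * K + c.up ∧
      c.q' * K ≤ c.p' * A + c.left := by
  obtain ⟨p, q, p', q', lo, up, left⟩ := c
  simp only [Cell.valid, force_eq] at hv
  obtain ⟨h1, hv⟩ := of_cond_false hv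
  obtain ⟨h2, hv⟩ := of_cond_false hv
  obtain ⟨h3, hv⟩ := of_cond_false hv
  obtain ⟨h4, hv⟩ := of_cond_false hv
  obtain ⟨h5, hv⟩ := of_cond_false hv
  obtain ⟨h6, h7⟩ := of_cond_false hv
  clear hv
  replace h1 := Nat.eq_of_beq_eq_true h1
  replace h2 := Nat.le_of_ble_eq_true h2
  replace h3 := Nat.le_of_ble_eq_true h3
  replace h4 := Nat.le_of_ble_eq_true h4
  replace h5 := Nat.le_of_ble_eq_true h5
  replace h6 := Nat.le_of_ble_eq_true h6
  replace h7 := Nat.le_of_ble_eq_true h7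
  have hdiv (a b : ℕ) : Nat.div a b = a / b := rfl
  simp only [Nat.add_eq, Nat.mul_eq, Nat.sub_eq, Nat.pred_eq_sub_one, Nat.succ_eq_add_one,
    Nat.pow_eq, hdiv, Nat.succ_le_iff, CanonicallyOrderedAdd.mul_pos, Nat.sub_pos_iff_lt]
    at h1 h2 h3 h4 h5 h6 h7
  obtain ⟨hp, ⟨hD₁, hD₂⟩, hu, hv⟩ := h5
  have hq' : 0 < q' := Nat.pos_of_ne_zero fun h0 => by simp [h0] at hD₂
  have hK₁ := Nat.mul_div_le (p' * A₁) q'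
  generalize p' * A₁ / q' = K₁ at *
  have hq : 0 < q := Nat.pos_of_ne_zero fun h0 => by simp [h0] at h1
  have hp' : 0 < p' := Nat.pos_of_ne_zero fun h0 => by simp [h0] at h1
  refine ⟨h1, hq', h.le_add hA₁ hA hp hq h2 h4, ?_⟩
  have := h.lt_add (X := left + 1) hA₁ hA hp' hq' h3 hK₁ (by omega) (by omega) (by omega) h6 hu hv h7
  simp only
  omega

theorem noSolution_spec {ex : List (ℕ × ℕ)} {d e w k A K : ℕ}
    (h : noSolution ex d e (d + e) A K = true) (hs : IsSolution d e w k A K) : (w + k, k) ∈ ex := by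
  have h1 := hs.add_eq
  have h2 := hs.eq_add
  have hmod (a b : ℕ) : Nat.mod a b = a % b := rfl
  have hb1 : Nat.beq (Nat.mod (Nat.add A (d + e)) 2) 1 = true := by
    rw [Nat.beq_eq, hmod, Nat.add_eq]; omega
  have hb2 : Nat.beq (Nat.mod (Nat.add K e) 2) 1 = true := by
    rw [Nat.beq_eq, hmod, Nat.add_eq]; omega
  have hw : Nat.shiftRight (Nat.pred (Nat.add A (d + e))) 1 = w := by
    refine (Nat.shiftRight_eq_div_pow _ 1).trans ?_
    rw [Nat.add_eq, Nat.pred_eq_sub_one]; omega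
  have hk : Nat.shiftRight (Nat.pred (Nat.sub K e)) 1 = k := by
    refine (Nat.shiftRight_eq_div_pow _ 1).trans ?_
    rw [Nat.sub_eq, Nat.pred_eq_sub_one]; omega
  simp only [noSolution, hb1, hb2, cond_true, force_eq, hw, hk, descFac_eq] at h
  have hb3 : Nat.beq (Nat.mul (Nat.descFactorial (Nat.add w k) d)
      (Nat.descFactorial (Nat.add k e) e)) (Nat.descFactorial w (d + e)) = true := by
    rw [Nat.beq_eq]; exact hs.descFactorial_eq
  rw [hb3, cond_true] at h
  obtain ⟨a, ha, h⟩ := anyMem_spec h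
  obtain ⟨h3, h4⟩ := of_cond_false h
  have h3 := Nat.eq_of_beq_eq_true h3
  have h4 := Nat.eq_of_beq_eq_true h4
  rwa [show (w + k, k) = a from Prod.ext h3 h4]

theorem Cell.mem_of_search {c : Cell} {ex : List (ℕ × ℕ)} {d e w k A K A₁ A₂ : ℕ}
    (hv : c.valid d e A₁ = true) (hc : c.search ex d e A₁ A₂ = true)
    (h : IsSolution d e w k A K) (hA₁ : 88 ≤ A₁) (hA : A₁ ≤ A) (hA₂ : A ≤ A₂) :
    (w + k, k) ∈ ex := by
  obtain ⟨h1, hq', h2, h3⟩ := c.le_of_valid hv h hA₁ hA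
  obtain ⟨p, q, p', q', lo, up, left⟩ := c
  simp only at h1 h2 h3 hq'
  have hq : 0 < q := Nat.pos_of_ne_zero fun h0 => by simp [h0] at h1
  obtain ⟨x, hx⟩ := Nat.exists_eq_add_of_le h3
  obtain ⟨y, hy⟩ := Nat.exists_eq_add_of_le h2
  have hAU : A + (left * q + up * q') = x * q + (lo + y) * q' := by
    zify at *
    linear_combination (-(A : ℤ)) * h1 + (q : ℤ) * hx + q' * hy
  have hKV : K + (left * p + up * p') = x * p + (lo + y) * p' := by
    zify at *
    linear_combination (-(K : ℤ)) * h1 + (p : ℤ) * hx + p' * hy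
  simp only [Cell.search, force_eq, Nat.add_eq, Nat.mul_eq] at hc
  have hdiv (a b : ℕ) : Nat.div a b = a / b := rfl
  have hc := allBelow_spec hc x <| by
    rw [Nat.lt_succ_iff, hdiv, Nat.le_div_iff_mul_le hq, Nat.sub_eq]
    have := Nat.zero_le (y * q')
    rw [add_mul] at hAU
    omega
  set y₁ := Nat.div (Nat.sub (A₁ + (left * q + up * q')) (x * q) + Nat.pred q') q' with hy₁
  have hy₁' : y₁ ≤ lo + y := by
    rw [hy₁, hdiv, Nat.le_iff_lt_add_one, Nat.div_lt_iff_lt_mul hq', Nat.sub_eq,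
      Nat.pred_eq_sub_one, add_mul (lo + y)]
    omega
  set y₂ := cond (Nat.ble y₁ lo) lo y₁ with hy₂
  have hy₂' : y₂ ≤ lo + y := by
    rw [hy₂]; cases Nat.ble y₁ lo
    · exact hy₁'
    · exact Nat.le_add_right lo y
  have hy₃ : lo + y ≤ Nat.div (Nat.sub (A₂ + (left * q + up * q')) (x * q)) q' := by
    rw [hdiv, Nat.le_div_iff_mul_le hq', Nat.sub_eq]
    omega
  have hc := allBelow_spec hc (lo + y - y₂) <| by
    rw [Nat.sub_eq]
    omega
  rw [Nat.add_sub_cancel' hy₂', ← hAU, ← hKV, Nat.sub_eq, Nat.sub_eq, Nat.add_sub_cancel,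
    Nat.add_sub_cancel] at hc
  exact noSolution_spec hc h

theorem mem_of_cellsCheck {ex : List (ℕ × ℕ)} {d e w k A K : ℕ} {l : List Cell} {A₁ : ℕ}
    (hc : cellsCheck ex d e l A₁ = true) (h : IsSolution d e w k A K) (hA₁ : 88 ≤ A₁)
    (hA : A₁ ≤ A) (hA₂ : A ≤ 2000000) : (w + k, k) ∈ ex := by
  induction l generalizing A₁ with
  | nil =>
    have : 2000001 ≤ A₁ := Nat.le_of_ble_eq_true hc
    omega
  | cons c l ih =>
    change cond (c.valid d e A₁) (force _ fun A₂ => cond (c.search ex d e A₁ A₂)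
      (cellsCheck ex d e l A₂) false) false = true at hc
    obtain ⟨hv, hc⟩ := of_cond_false hc
    rw [force_eq] at hc
    obtain ⟨hs, hc⟩ := of_cond_false hc
    rcases le_total A (cond (Nat.ble A₁ 500000) (Nat.mul 4 A₁) 2000001) with h1 | h1
    · exact c.mem_of_search hv hs h hA₁ hA h1
    · refine ih hc ?_ h1
      cases Nat.ble A₁ 500000
      · exact (by norm_num : 88 ≤ 2000001)
      · simp only [cond_true, Nat.mul_eq]
        omega

theorem mem_of_tableCheck {ex : List (ℕ × ℕ)} {d e w k A K : ℕ} {t : List (List Cell)} {d₀ : ℕ}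
    (hc : tableCheck ex (d + e) t d₀ = true) (h : IsSolution d e w k A K) (hd₀ : d₀ ≤ d)
    (hA : 88 ≤ A) (hA₂ : A ≤ 2000000) : (w + k, k) ∈ ex := by
  have he := h.one_le_right
  induction t generalizing d₀ with
  | nil =>
    have : d₀ = d + e := Nat.eq_of_beq_eq_true hc
    omega
  | cons l t ih =>
    change cond (cellsCheck ex d₀ (Nat.sub (d + e) d₀) l 88)
      (force _ (tableCheck ex (d + e) t)) false = true at hc
    rw [force_eq] at hc
    obtain ⟨h1, hc⟩ := of_cond_false hc
    rcases hd₀.eq_or_lt with rfl | hd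
    · rw [Nat.sub_eq, Nat.add_sub_cancel_left] at h1
      exact mem_of_cellsCheck h1 h le_rfl hA hA₂
    · exact ih hc hd

theorem mem_of_tablesCheck {d e w k A K : ℕ} {t : List (List (List Cell))} {S : ℕ}
    (hc : tablesCheck t S = true) (h : IsSolution d e w k A K) (hS : S ≤ d + e)
    (hA : 88 ≤ A) (hA₂ : A ≤ 2000000) : d + e = 2 ∧ (w + k, k) ∈ fibonacciPairs := by
  have h13 := h.add_le
  induction t generalizing S with
  | nil =>
    have : S = 14 := Nat.eq_of_beq_eq_true hc
    omega
  | cons l t ih =>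
    change cond (tableCheck (cond (Nat.beq S 2) fibonacciPairs []) S l 1)
      (force _ (tablesCheck t)) false = true at hc
    rw [force_eq] at hc
    obtain ⟨h1, hc⟩ := of_cond_false hc
    rcases hS.eq_or_lt with rfl | hS
    · have := mem_of_tableCheck h1 h h.one_le_left hA hA₂
      cases h2 : Nat.beq (d + e) 2
      · simp [h2] at this
      · rw [h2, cond_true] at this
        exact ⟨Nat.eq_of_beq_eq_true h2, this⟩
    · exact ih hc hS

theorem mem_fibonacciPairs {n k d e : ℕ} (hn : n ≤ 1000000) (hd : 1 ≤ d) (he : 1 ≤ e)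
    (h : 2 * k + 2 * e + d ≤ n) (hS : d + e ≤ 13) (hw : 50 ≤ n - k)
    (heq : n.descFactorial d * (k + e).descFactorial e = (n - k).descFactorial (d + e)) :
    d + e = 2 ∧ (n, k) ∈ fibonacciPairs := by
  obtain ⟨w, rfl⟩ : ∃ w, n = w + k := ⟨n - k, by omega⟩
  rw [Nat.add_sub_cancel] at heq hw
  exact mem_of_tablesCheck tablesCheck_cellTables (A := 2 * w + 1 - (d + e)) (K := 2 * k + e + 1)
    ⟨hd, he, hS, by omega, rfl, heq⟩ (by omega) (by omega) (by omega)

end BinomialCollision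

open BinomialCollision in
theorem collisions_up_to_million (n k m l : ℕ)
    (hn : n ≤ 10 ^ 6) (hm : m ≤ 10 ^ 6)
    (hk2 : 2 ≤ k) (hkn : k ≤ n / 2)
    (hl2 : 2 ≤ l) (hlm : l ≤ m / 2)
    (hkl : k < l)
    (heq : Nat.choose n k = Nat.choose m l) :
    (n, k, m, l) = (16, 2, 10, 3) ∨
    (n, k, m, l) = (21, 2, 10, 4) ∨
    (n, k, m, l) = (56, 2, 22, 3) ∨
    (n, k, m, l) = (120, 2, 36, 3) ∨
    (n, k, m, l) = (153, 2, 19, 5) ∨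
    (n, k, m, l) = (221, 2, 17, 8) ∨
    (n, k, m, l) = (78, 2, 15, 5) ∨
    (n, k, m, l) = (78, 2, 14, 6) ∨
    (n, k, m, l) = (15, 5, 14, 6) ∨
    ∃ i : ℕ, 1 ≤ i ∧
      (n, k, m, l) = (Nat.fib (2 * i + 2) * Nat.fib (2 * i + 3),
                      Nat.fib (2 * i) * Nat.fib (2 * i + 3),
                      Nat.fib (2 * i + 2) * Nat.fib (2 * i + 3) - 1,
                      Nat.fib (2 * i) * Nat.fib (2 * i + 3) + 1) := by
  rw [Nat.le_div_iff_mul_le two_pos, mul_comm] at hkn hlm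
  rcases le_or_gt k 13 with hk | hk
  · have := cases_of_le_thirteen hn hk2 hk hkn hlm hkl heq
    tauto
  have hmn := lt_of_choose_eq hkl hlm heq
  rcases lt_or_ge (m + k) n with hd | hd
  · exact (false_of_lt_sub (by omega) hk hkn hkl hlm heq hd).elim
  obtain ⟨d, hd1, rfl⟩ : ∃ d, 1 ≤ d ∧ n = m + d := ⟨n - m, by omega, by omega⟩
  obtain ⟨e, he1, rfl⟩ : ∃ e, 1 ≤ e ∧ l = k + e := ⟨l - k, by omega, by omega⟩
  have h : 2 * k + 2 * e + d ≤ m + d := by omega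
  have heq' := descFactorial_mul_eq h (by rwa [Nat.add_sub_cancel])
  rcases lt_or_ge (m + d - k) 50 with hw | hw
  · exact (false_of_sub_lt_fifty h hk he1 hw heq').elim
  rcases le_or_gt 14 (d + e) with hS | hS
  · exact (false_of_long (by omega) h (by omega) hd1 he1 hw hmn heq heq' hS).elim
  obtain ⟨hde, hmem⟩ := mem_fibonacciPairs (by omega) hd1 he1 h (by omega) hw heq'
  obtain ⟨rfl, rfl⟩ : d = 1 ∧ e = 1 := by omega
  iterate 9 right
  simp only [fibonacciPairs, List.mem_cons, Prod.mk.injEq, List.not_mem_nil, or_false] at hmem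
  rcases hmem with ⟨h1, rfl⟩ | ⟨h1, rfl⟩ | ⟨h1, rfl⟩ | ⟨h1, rfl⟩ | ⟨h1, rfl⟩ | ⟨h1, -⟩
  · obtain rfl : m = 103 := by omega
    exact ⟨2, by decide⟩
  · obtain rfl : m = 713 := by omega
    exact ⟨3, by decide +kernel⟩
  · obtain rfl : m = 4894 := by omega
    exact ⟨4, by decide +kernel⟩
  · obtain rfl : m = 33551 := by omega
    exact ⟨5, by decide +kernel⟩
  · obtain rfl : m = 229969 := by omega
    exact ⟨6, by decide +kernel⟩
  · omega
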